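/- Let 1 < p < ∞, ω ∈ A₁, and f ∈ BMO^p(ω). If G(f)(x₀) < +∞ (respectively S(f)(x₀) < +∞) for at least one point x₀ ∈ ℝⁿ, then G(f) (respectively S(f)) is finite almost everywhere on ℝⁿ, and there exists a constant C > 0 independent of f such that ‖G(f)‖_{BLO^p(ω)} ≤ C · ‖f‖_{BMO^p(ω)} and ‖S(f)‖_{BLO^p(ω)} ≤ C · ‖f‖_{BMO^p(ω)}. -/

import Mathlib

open MeasureTheory Metric Set ENNReal

noncomputable section

namespace LPW

variable {n : ℕ}

/-- n-dimensional Euclidean space. -/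
abbrev Rn (n : ℕ) := EuclideanSpace ℝ (Fin n)

/-- Axis-parallel open cube with center `c` and half-side `h`. -/
def cube (c : Rn n) (h : ℝ) : Set (Rn n) := {y : Rn n | ∀ i, |y i - c i| < h}

/-- The ω-measure `ω(E) = ∫_E ω`. -/
def wInt (ω : Rn n → ℝ) (E : Set (Rn n)) : ℝ := ∫ x in E, ω x

/-- The Lebesgue mean value `f_E = (1/m(E)) ∫_E f`. -/
def avg (f : Rn n → ℝ) (E : Set (Rn n)) : ℝ := ((volume E).toReal)⁻¹ * ∫ x in E, f x

/-- Weighted mean oscillation `(1/ω(E)) ∫_E |f - f_E|`. -/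
def bmoAvg (ω f : Rn n → ℝ) (E : Set (Rn n)) : ℝ :=
  (wInt ω E)⁻¹ * ∫ x in E, |f x - avg f E|

/-- Weighted lower oscillation `(1/ω(E)) ∫_E (f - essinf_E f)`. -/
def bloAvg (ω f : Rn n → ℝ) (E : Set (Rn n)) : ℝ :=
  (wInt ω E)⁻¹ * ∫ x in E, (f x - essInf f (volume.restrict E))

/-- `‖f‖_{BMO(ω)}`, supremum over all balls, valued in `[0,∞]`. -/
def bmoNorm (ω f : Rn n → ℝ) : ℝ≥0∞ :=
  ⨆ (c : Rn n) (ρ : ℝ) (_ : 0 < ρ), ENNReal.ofReal (bmoAvg ω f (Metric.ball c ρ))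

/-- `‖f‖_{BLO(ω)}`, supremum over all balls, valued in `[0,∞]`. -/
def bloNorm (ω f : Rn n → ℝ) : ℝ≥0∞ :=
  ⨆ (c : Rn n) (ρ : ℝ) (_ : 0 < ρ), ENNReal.ofReal (bloAvg ω f (Metric.ball c ρ))

/-- `‖f‖_{L^∞(ω)}`, supremum over all balls of `(essinf_B ω)⁻¹ · esssup_B |f|`. -/
def linfNorm (ω f : Rn n → ℝ) : ℝ≥0∞ :=
  ⨆ (c : Rn n) (ρ : ℝ) (_ : 0 < ρ),
    ENNReal.ofReal ((essInf ω (volume.restrict (Metric.ball c ρ)))⁻¹ *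
      essSup (fun x => |f x|) (volume.restrict (Metric.ball c ρ)))

/-- `‖f‖_{BMO(ω)}` taken over cubes. -/
def bmoNormC (ω f : Rn n → ℝ) : ℝ≥0∞ :=
  ⨆ (c : Rn n) (h : ℝ) (_ : 0 < h), ENNReal.ofReal (bmoAvg ω f (cube c h))

/-- `‖f‖_{BLO(ω)}` taken over cubes. -/
def bloNormC (ω f : Rn n → ℝ) : ℝ≥0∞ :=
  ⨆ (c : Rn n) (h : ℝ) (_ : 0 < h), ENNReal.ofReal (bloAvg ω f (cube c h))

/-- `‖f‖_{BMO^p(ω)}` taken over cubes (extended-valued). -/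
def bmoPNorm (p : ℝ) (ω f : Rn n → ℝ) : ℝ≥0∞ :=
  ⨆ (c : Rn n) (h : ℝ) (_ : 0 < h),
    ((ENNReal.ofReal (wInt ω (cube c h)))⁻¹ *
      ∫⁻ x in cube c h,
        ENNReal.ofReal (|f x - avg f (cube c h)| ^ p * (ω x) ^ (1 - p))) ^ (1/p)

/-- `‖f‖_{BLO^p(ω)}` taken over cubes (extended-valued). -/
def bloPNorm (p : ℝ) (ω f : Rn n → ℝ) : ℝ≥0∞ :=
  ⨆ (c : Rn n) (h : ℝ) (_ : 0 < h),
    ((ENNReal.ofReal (wInt ω (cube c h)))⁻¹ *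
      ∫⁻ x in cube c h,
        ENNReal.ofReal ((f x - essInf f (volume.restrict (cube c h))) ^ p * (ω x) ^ (1 - p))) ^ (1/p)

/-- A weight: nonnegative, locally integrable, positive a.e. -/
def IsWeight (ω : Rn n → ℝ) : Prop :=
  (∀ x, 0 ≤ ω x) ∧ LocallyIntegrable ω volume ∧
    ∀ᵐ x ∂(volume : Measure (Rn n)), 0 < ω x

/-- `C` is an `A₁` bound for `ω` (over balls). -/
def A1ballBound (ω : Rn n → ℝ) (C : ℝ) : Prop :=
  0 < C ∧ ∀ (c : Rn n) (ρ : ℝ), 0 < ρ →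
    avg ω (Metric.ball c ρ) ≤ C * essInf ω (volume.restrict (Metric.ball c ρ))

/-- `ω ∈ A₁` (over balls). -/
def IsA1ball (ω : Rn n → ℝ) : Prop := ∃ C, A1ballBound ω C

/-- `[ω]_{A₁}` (over balls), the least `A₁` bound. -/
def A1ballConst (ω : Rn n → ℝ) : ℝ := sInf {C | A1ballBound ω C}

/-- `C` is an `A₁` bound for `ω` (over cubes). -/
def A1cubeBound (ω : Rn n → ℝ) (C : ℝ) : Prop :=
  0 < C ∧ ∀ (c : Rn n) (h : ℝ), 0 < h →
    avg ω (cube c h) ≤ C * essInf ω (volume.restrict (cube c h))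

/-- `ω ∈ A₁` (over cubes). -/
def IsA1cube (ω : Rn n → ℝ) : Prop := ∃ C, A1cubeBound ω C

/-- `[ω]_{A₁}` (over cubes), the least `A₁` bound. -/
def A1cubeConst (ω : Rn n → ℝ) : ℝ := sInf {C | A1cubeBound ω C}

/-- `C` is an `A₂` bound for `ω` (over balls). -/
def A2ballBound (ω : Rn n → ℝ) (C : ℝ) : Prop :=
  0 < C ∧ ∀ (c : Rn n) (ρ : ℝ), 0 < ρ →
    avg ω (Metric.ball c ρ) * avg (fun x => (ω x)⁻¹) (Metric.ball c ρ) ≤ C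

/-- `ω ∈ A₂` (over balls). -/
def IsA2ball (ω : Rn n → ℝ) : Prop := ∃ C, A2ballBound ω C

/-- `[ω]_{A₂}` (over balls), the least `A₂` bound. -/
def A2ballConst (ω : Rn n → ℝ) : ℝ := sInf {C | A2ballBound ω C}

/-- Conditions (P1), (P2), (P3) on the kernel ψ. -/
def PsiKernel (n : ℕ) (C₁ C₂ δ γ : ℝ) (ψ : Rn n → ℝ) : Prop :=
  Integrable ψ volume ∧ (∫ x, ψ x) = 0 ∧
  (∀ x : Rn n, |ψ x| ≤ C₁ * (1 + ‖x‖) ^ (-((n : ℝ) + δ))) ∧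
  (∀ x h : Rn n, 2 * ‖h‖ ≤ ‖x‖ →
    |ψ (x + h) - ψ x| ≤ C₂ * ‖h‖ ^ γ * (1 + ‖x‖) ^ (-((n : ℝ) + δ + γ)))

/-- The convolution `(ψ_t * f)(x)` where `ψ_t(x) = t^{-n} ψ(x/t)`. -/
def cvl (ψ : Rn n → ℝ) (t : ℝ) (f : Rn n → ℝ) (x : Rn n) : ℝ :=
  ∫ y, (t ^ n)⁻¹ * ψ (t⁻¹ • (x - y)) * f y

/-- The generalized Littlewood–Paley g-function `G(f)(x)`, valued in `[0,∞]`. -/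
def Gfun (ψ f : Rn n → ℝ) (x : Rn n) : ℝ≥0∞ :=
  (∫⁻ t in Ioi (0:ℝ), ENNReal.ofReal ((cvl ψ t f x) ^ 2 / t)) ^ (1/2 : ℝ)

/-- The dilated Lusin area integral `S_a(f)(x)` (aperture `a`), valued in `[0,∞]`. -/
def Sdil (ψ : Rn n → ℝ) (a : ℝ) (f : Rn n → ℝ) (x : Rn n) : ℝ≥0∞ :=
  (∫⁻ t in Ioi (0:ℝ), ∫⁻ y in Metric.ball x (a * t),
      ENNReal.ofReal ((cvl ψ t f y) ^ 2 / t ^ (n + 1))) ^ (1/2 : ℝ)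

/-- The generalized Lusin area integral `S(f)(x)`, valued in `[0,∞]`. -/
def Sfun (ψ f : Rn n → ℝ) (x : Rn n) : ℝ≥0∞ := Sdil ψ 1 f x

/-- Stein's function `G*_λ(f)(x)`, valued in `[0,∞]`. -/
def Gstar (ψ : Rn n → ℝ) (lam : ℝ) (f : Rn n → ℝ) (x : Rn n) : ℝ≥0∞ :=
  (∫⁻ t in Ioi (0:ℝ), ∫⁻ y,
      ENNReal.ofReal ((t / (t + dist x y)) ^ (lam * (n : ℝ)) *
        (cvl ψ t f y) ^ 2 / t ^ (n + 1))) ^ (1/2 : ℝ)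


section PartA

/-! ### Cubes -/

theorem isOpen_cube (c : Rn n) (h : ℝ) : IsOpen (cube c h) := by
  have : cube c h = ⋂ i : Fin n, {y : Rn n | |y i - c i| < h} := by
    ext y; simp [cube]
  rw [this]
  refine isOpen_iInter_of_finite fun i => ?_
  exact isOpen_lt (by fun_prop) continuous_const

theorem measurableSet_cube (c : Rn n) (h : ℝ) : MeasurableSet (cube c h) :=
  (isOpen_cube c h).measurableSet

theorem cube_eq_preimage (c : Rn n) {h : ℝ} (hh : 0 < h) :
    cube c h = (WithLp.ofLp : Rn n → (Fin n → ℝ)) ⁻¹' (Metric.ball (WithLp.ofLp c) h) := by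
  ext y
  simp only [cube, mem_ofPred_eq, mem_preimage, Metric.mem_ball]
  rw [dist_pi_lt_iff hh]
  simp [Real.dist_eq]

theorem volume_cube (c : Rn n) {h : ℝ} (hh : 0 < h) :
    volume (cube c h) = ENNReal.ofReal ((2 * h) ^ n) := by
  rw [cube_eq_preimage c hh, (PiLp.volume_preserving_ofLp (Fin n)).measure_preimage
    (measurableSet_ball.nullMeasurableSet), Real.volume_pi_ball _ hh, Fintype.card_fin]

theorem volume_cube_pos (c : Rn n) {h : ℝ} (hh : 0 < h) : 0 < volume (cube c h) := by
  rw [volume_cube c hh]; positivity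

theorem volume_cube_ne_zero (c : Rn n) {h : ℝ} (hh : 0 < h) : volume (cube c h) ≠ 0 :=
  (volume_cube_pos c hh).ne'

theorem volume_cube_ne_top (c : Rn n) {h : ℝ} (hh : 0 < h) : volume (cube c h) ≠ ⊤ := by
  rw [volume_cube c hh]; exact ENNReal.ofReal_ne_top

theorem mem_cube_self (c : Rn n) {h : ℝ} (hh : 0 < h) : c ∈ cube c h := by
  intro i; simpa using hh

theorem cube_mono (c : Rn n) {h h' : ℝ} (hh : h ≤ h') : cube c h ⊆ cube c h' :=
  fun _ hy i => (hy i).trans_le hh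

theorem volume_cube_mul (c c' : Rn n) {h K : ℝ} (hh : 0 < h) (hK : 0 < K) :
    volume (cube c (K * h)) = ENNReal.ofReal (K ^ n) * volume (cube c' h) := by
  rw [volume_cube c (mul_pos hK hh), volume_cube c' hh, ← ENNReal.ofReal_mul (by positivity)]
  congr 1; rw [← mul_pow]; ring

/-- Points of the space that are dyadically generic. -/
theorem lebesgue_diff (c : Rn n) {h : ℝ} {u : Rn n → ℝ≥0∞} (hu : Measurable u)
    (hfin : ∫⁻ x in cube c h, u x ≠ ⊤) :
    ∀ᵐ x ∂(volume : Measure (Rn n)), x ∈ cube c h → ∀ (w : ℕ → Rn n) (d : ℕ → ℝ),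
      Filter.Tendsto d Filter.atTop (nhdsWithin 0 (Ioi 0)) → (∀ j, 0 < d j) →
      (∀ j, x ∈ cube (w j) (d j)) → (∀ j, cube (w j) (d j) ⊆ cube c h) →
      Filter.Tendsto (fun j => (∫⁻ y in cube (w j) (d j), u y) / volume (cube (w j) (d j)))
        Filter.atTop (nhds (u x)) := by
  set e := (WithLp.ofLp : Rn n → (Fin n → ℝ)) with he
  have mp : MeasurePreserving e volume volume := PiLp.volume_preserving_ofLp (Fin n)
  set e' := (WithLp.toLp 2 : (Fin n → ℝ) → Rn n)
  have mp' : MeasurePreserving e' volume volume := PiLp.volume_preserving_toLp (Fin n)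
  set U : (Fin n → ℝ) → ℝ≥0∞ := fun y => (cube c h).indicator u (e' y) with hU
  have hUm : Measurable U := (hu.indicator (measurableSet_cube c h)).comp mp'.measurable
  have hUe : ∀ x, U (e x) = (cube c h).indicator u x := fun x => by simp [hU, e', he]
  have hUi : ∫⁻ y, U y ≠ ⊤ := by
    rw [← mp.lintegral_comp hUm]
    simp_rw [hUe]
    rwa [lintegral_indicator (measurableSet_cube c h)]
  have key := (IsUnifLocDoublingMeasure.vitaliFamily (volume : Measure (Fin n → ℝ))
    1).ae_tendsto_lintegral_div hUm.aemeasurable hUi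
  have key' := mp.quasiMeasurePreserving.ae key
  filter_upwards [key'] with x hx hxc w d hd hdpos hxm hsub
  have h1 := IsUnifLocDoublingMeasure.tendsto_closedBall_filterAt
    (volume : Measure (Fin n → ℝ)) (K := 1) (x := e x) (l := Filter.atTop)
    (fun j => e (w j)) d hd (Filter.Eventually.of_forall fun j => by
      have := hxm j
      rw [cube_eq_preimage _ (hdpos j)] at this
      rw [one_mul]; exact ball_subset_closedBall this)
  have h2 := hx.comp h1
  have h3 : U (e x) = u x := by rw [hUe, indicator_of_mem hxc]
  rw [h3] at h2
  refine h2.congr fun j => ?_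
  simp only [Function.comp]
  have hcb : (closedBall (e (w j)) (d j) : Set (Fin n → ℝ)) =ᵐ[volume] ball (e (w j)) (d j) := by
    rw [ae_eq_set]
    constructor
    · rw [closedBall_sdiff_ball]
      exact Measure.addHaar_sphere_of_ne_zero _ _ (hdpos j).ne'
    · rw [sdiff_eq_empty.mpr ball_subset_closedBall]; simp
  have hpre : cube (w j) (d j) = e ⁻¹' (ball (e (w j)) (d j)) := cube_eq_preimage _ (hdpos j)
  rw [Measure.restrict_congr_set hcb, measure_congr hcb,
    ← mp.measure_preimage (measurableSet_ball.nullMeasurableSet), ← hpre,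
    ← mp.setLIntegral_comp_preimage measurableSet_ball hUm, ← hpre]
  congr 1
  refine setLIntegral_congr_fun (measurableSet_cube _ _) fun y hy => ?_
  simp only [hUe, indicator_of_mem (hsub j hy)]

/-- index of dyadic cube -/
def dIdx (c : Rn n) (h : ℝ) (k : ℕ) (x : Rn n) : Fin n → ℤ :=
  fun i => ⌊(2:ℝ) ^ k * ((x i - c i + h) / (2 * h))⌋

/-- center of dyadic cube -/
def dCen (c : Rn n) (h : ℝ) (k : ℕ) (m : Fin n → ℤ) : Rn n :=
  WithLp.toLp 2 fun i => c i - h + (2 * m i + 1) * (h / 2 ^ k)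

theorem mem_dcube {c : Rn n} {h : ℝ} (hh : 0 < h) {k : ℕ} {m : Fin n → ℤ} {y : Rn n} :
    y ∈ cube (dCen c h k m) (h / 2 ^ k) ↔
      ∀ i, (m i : ℝ) < (2:ℝ) ^ k * ((y i - c i + h) / (2 * h)) ∧
        (2:ℝ) ^ k * ((y i - c i + h) / (2 * h)) < m i + 1 := by
  simp only [cube, dCen, mem_ofPred_eq]
  refine forall_congr' fun i => ?_
  have hk : (0:ℝ) < 2 ^ k := by positivity
  rw [abs_lt]
  have e1 : (2:ℝ) ^ k * ((y i - c i + h) / (2 * h)) = (y i - c i + h) / (2 * (h / 2 ^ k)) := by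
    field_simp
  have hd : 0 < h / 2 ^ k := by positivity
  rw [e1]
  generalize h / 2 ^ k = d at hd ⊢
  rw [lt_div_iff₀ (by positivity), div_lt_iff₀ (by positivity)]
  constructor
  · rintro ⟨h1, h2⟩; constructor <;> nlinarith
  · rintro ⟨h1, h2⟩; constructor <;> nlinarith

theorem dIdx_of_mem {c : Rn n} {h : ℝ} (hh : 0 < h) {k : ℕ} {m : Fin n → ℤ} {y : Rn n}
    (hy : y ∈ cube (dCen c h k m) (h / 2 ^ k)) : dIdx c h k y = m := by
  rw [mem_dcube hh] at hy
  funext i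
  rw [dIdx, Int.floor_eq_iff]
  exact ⟨(hy i).1.le, (hy i).2⟩

theorem dcube_subset_succ {c : Rn n} {h : ℝ} (hh : 0 < h) {k : ℕ} {x : Rn n} :
    cube (dCen c h (k+1) (dIdx c h (k+1) x)) (h / 2 ^ (k+1)) ⊆
      cube (dCen c h k (dIdx c h k x)) (h / 2 ^ k) := by
  intro y hy
  rw [mem_dcube hh] at hy ⊢
  intro i
  obtain ⟨h1, h2⟩ := hy i
  set A := (y i - c i + h) / (2 * h)
  have hm : dIdx c h k x i = dIdx c h (k+1) x i / 2 := by
    simp only [dIdx]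
    rw [show (2:ℝ) ^ k * ((x i - c i + h) / (2 * h)) =
      (2:ℝ) ^ (k+1) * ((x i - c i + h) / (2 * h)) / ((2:ℕ):ℝ) by push_cast; ring]
    rw [Int.floor_div_natCast]; rfl
  rw [hm]
  set M := dIdx c h (k+1) x i
  have e : (2:ℝ) ^ (k+1) * A = 2 * (2 ^ k * A) := by ring
  rw [e] at h1 h2
  have a1 : 2 * (M / 2) ≤ M := by omega
  have a2 : M + 1 ≤ 2 * (M / 2) + 2 := by omega
  have b1 : (2:ℝ) * ((M / 2 : ℤ) : ℝ) ≤ M := by exact_mod_cast a1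
  have b2 : (M:ℝ) + 1 ≤ 2 * ((M / 2 : ℤ) : ℝ) + 2 := by exact_mod_cast a2
  constructor <;> linarith

theorem dcube_subset {c : Rn n} {h : ℝ} (hh : 0 < h) {k l : ℕ} (hkl : k ≤ l) {x : Rn n} :
    cube (dCen c h l (dIdx c h l x)) (h / 2 ^ l) ⊆
      cube (dCen c h k (dIdx c h k x)) (h / 2 ^ k) := by
  induction l, hkl using Nat.le_induction with
  | base => exact subset_rfl
  | succ l _ ih => exact (dcube_subset_succ hh).trans ih

theorem dcube_zero {c : Rn n} {h : ℝ} (hh : 0 < h) {x : Rn n} (hx : x ∈ cube c h) :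
    cube (dCen c h 0 (dIdx c h 0 x)) (h / 2 ^ 0) = cube c h := by
  have h0 : dIdx c h 0 x = fun _ => 0 := by
    apply dIdx_of_mem hh
    rw [mem_dcube hh]
    intro i
    have := abs_lt.1 (hx i)
    simp only [pow_zero, one_mul, Int.cast_zero, zero_add]
    rw [div_lt_one (by positivity)]
    exact ⟨div_pos (by linarith) (by positivity), by linarith⟩
  rw [h0]
  congr 1
  · ext i; simp [dCen]
  · simp

theorem ae_generic (c : Rn n) {h : ℝ} (hh : 0 < h) :
    ∀ᵐ x ∂(volume : Measure (Rn n)), ∀ k, x ∈ cube (dCen c h k (dIdx c h k x)) (h / 2 ^ k) := by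
  have key : ∀ᵐ x ∂(volume : Measure (Rn n)), ∀ k : ℕ, ∀ i : Fin n, ∀ m : ℤ,
      x i ≠ c i - h + m / 2 ^ k * (2 * h) := by
    rw [ae_all_iff]; intro k; rw [ae_all_iff]; intro i; rw [ae_all_iff]; intro m
    have : ∀ᵐ y ∂(volume : Measure (Fin n → ℝ)), y i ≠ c i - h + m / 2 ^ k * (2 * h) := by
      have := (Measure.quasiMeasurePreserving_eval (fun _ : Fin n => (volume : Measure ℝ)) i).ae
        (p := fun y => y ≠ c i - h + m / 2 ^ k * (2 * h)) (by
          rw [ae_iff]; simp)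
      simpa [volume_pi] using this
    exact (PiLp.volume_preserving_ofLp (Fin n)).quasiMeasurePreserving.ae this
  filter_upwards [key] with x hx k
  rw [mem_dcube hh]
  intro i
  refine ⟨lt_of_le_of_ne (Int.floor_le _) ?_, Int.lt_floor_add_one _⟩
  intro hE
  apply hx k i (dIdx c h k x i)
  rw [hE]
  have hk : (0:ℝ) < 2 ^ k := by positivity
  field_simp
  ring

/-- Calderón–Zygmund stopping cubes. -/
theorem cz_cubes (c : Rn n) {h : ℝ} (hh : 0 < h) {u : Rn n → ℝ≥0∞} (hu : Measurable u)
    (lam : ℝ≥0∞) (hfin : ∫⁻ x in cube c h, u x ≠ ⊤)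
    (hav : ∫⁻ x in cube c h, u x ≤ lam * volume (cube c h)) :
    ∃ S : Set (Rn n × ℝ), S.Countable ∧ (∀ q ∈ S, 0 < q.2 ∧ cube q.1 q.2 ⊆ cube c h ∧
        lam * volume (cube q.1 q.2) < ∫⁻ x in cube q.1 q.2, u x ∧
        ∫⁻ x in cube q.1 q.2, u x ≤ 2 ^ n * lam * volume (cube q.1 q.2)) ∧
      (S.PairwiseDisjoint fun q => cube q.1 q.2) ∧
      (∀ᵐ x ∂(volume : Measure (Rn n)), x ∈ cube c h → x ∉ ⋃ q ∈ S, cube q.1 q.2 →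
        u x ≤ lam) := by
  classical
  set D : ℕ → (Fin n → ℤ) → Set (Rn n) := fun k m => cube (dCen c h k m) (h / 2 ^ k) with hD
  set bad : ℕ → (Fin n → ℤ) → Prop := fun k m => lam * volume (D k m) < ∫⁻ x in D k m, u x with hbad
  have hpos : ∀ k : ℕ, 0 < h / 2 ^ k := fun k => by positivity
  set J : Set (ℕ × (Fin n → ℤ)) := {q | ∃ x ∈ cube c h, q.2 = dIdx c h q.1 x ∧ bad q.1 q.2 ∧
    ∀ l < q.1, ¬ bad l (dIdx c h l x)} with hJ
  have hsub : ∀ k x, x ∈ cube c h → D k (dIdx c h k x) ⊆ cube c h := fun k x hx =>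
    (dcube_subset hh (Nat.zero_le k)).trans (dcube_zero hh hx).subset
  have hdis : ∀ q ∈ J, ∀ q' ∈ J, q.1 ≤ q'.1 → ∀ y, y ∈ D q.1 q.2 → y ∈ D q'.1 q'.2 → q = q' := by
    rintro ⟨k, m⟩ ⟨x, hx, hm, hb, hl⟩ ⟨k', m'⟩ ⟨x', hx', hm', hb', hl'⟩ hkk y hy hy'
    dsimp only at *
    have e1 := dIdx_of_mem hh hy
    have hy2 : y ∈ D k (dIdx c h k x') := by
      rw [hm'] at hy'; exact dcube_subset hh hkk hy'
    have e2 := dIdx_of_mem hh hy2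
    have hk : k = k' := by
      by_contra hne
      apply hl' k (lt_of_le_of_ne hkk hne)
      rw [← e2, e1]; exact hb
    subst hk
    rw [hm', ← e2, e1]
  refine ⟨(fun q : ℕ × (Fin n → ℤ) => (dCen c h q.1 q.2, h / 2 ^ q.1)) '' J,
    (Set.to_countable J).image _, ?_, ?_, ?_⟩
  · rintro _ ⟨⟨k, m⟩, ⟨x, hx, hm, hb, hl⟩, rfl⟩
    dsimp only at *
    refine ⟨hpos k, hm ▸ hsub k x hx, hb, ?_⟩
    cases k with
    | zero =>
      exfalso
      have : D 0 m = cube c h := by rw [hm]; exact dcube_zero hh hx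
      rw [hbad] at hb
      simp only [this] at hb
      exact absurd hav (not_le.2 hb)
    | succ k =>
      have h1 := hl k (Nat.lt_succ_self k)
      rw [hbad] at h1
      simp only [not_lt] at h1
      have h2 : D (k+1) m ⊆ D k (dIdx c h k x) := by rw [hm]; exact dcube_subset_succ hh
      calc ∫⁻ x in D (k+1) m, u x ≤ ∫⁻ x in D k (dIdx c h k x), u x := lintegral_mono_set h2
        _ ≤ lam * volume (D k (dIdx c h k x)) := h1
        _ = 2 ^ n * lam * volume (D (k+1) m) := by
          have e : h / 2 ^ k = 2 * (h / 2 ^ (k+1)) := by rw [pow_succ]; field_simp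
          simp only [hD]
          rw [e, volume_cube_mul _ (dCen c h (k+1) m) (hpos (k+1)) two_pos,
            ENNReal.ofReal_pow (by norm_num)]
          simp only [ENNReal.ofReal_ofNat]
          ring
  · rintro _ ⟨q, hq, rfl⟩ _ ⟨q', hq', rfl⟩ hne
    rw [Function.onFun, Set.disjoint_left]
    intro y hy hy'
    apply hne
    rcases le_total q.1 q'.1 with hle | hle
    · rw [hdis q hq q' hq' hle y hy hy']
    · rw [hdis q' hq' q hq hle y hy' hy]
  · filter_upwards [ae_generic c hh, lebesgue_diff c hu hfin] with x hg hx hxc hxn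
    by_cases hex : ∃ k, bad k (dIdx c h k x)
    · exfalso
      apply hxn
      rw [mem_iUnion₂]
      refine ⟨_, ⟨(Nat.find hex, dIdx c h (Nat.find hex) x), ⟨x, hxc, rfl, Nat.find_spec hex,
        fun l hl => Nat.find_min hex hl⟩, rfl⟩, hg _⟩
    · push Not at hex
      have ht := hx hxc (fun k => dCen c h k (dIdx c h k x)) (fun k => h / 2 ^ k) (by
        rw [tendsto_nhdsWithin_iff]
        refine ⟨?_, Filter.Eventually.of_forall fun k => hpos k⟩
        have := (tendsto_pow_atTop_nhds_zero_of_lt_one (r := (1/2:ℝ)) (by norm_num)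
          (by norm_num)).const_mul h
        simp only [mul_zero] at this
        refine this.congr fun k => ?_
        rw [one_div, inv_pow]; rfl) hpos hg (fun k => hsub k x hxc)
      refine le_of_tendsto ht (Filter.Eventually.of_forall fun k => ?_)
      have := hex k
      rw [hbad] at this
      simp only [not_lt] at this
      exact ENNReal.div_le_of_le_mul this

end PartA

section PartB

/-- Abstract `A₁` data for a weight. -/
structure WData (w : Rn n → ℝ≥0∞) (a : Rn n → ℝ → ℝ≥0∞) (Cw : ℝ≥0∞) : Prop where
  meas : Measurable w
  pos : ∀ x, 0 < w x
  fin : ∀ x, w x < ⊤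
  le : ∀ c h, 0 < h → ∀ᵐ x ∂(volume : Measure (Rn n)), x ∈ cube c h → a c h ≤ w x
  a1 : ∀ c h, 0 < h → ∫⁻ x in cube c h, w x ≤ Cw * a c h * volume (cube c h)
  apos : ∀ c h, 0 < h → a c h ≠ 0
  afin : ∀ c h, 0 < h → a c h ≠ ⊤
  anti : ∀ c h c' h', 0 < h → 0 < h' → cube c h ⊆ cube c' h' → a c' h' ≤ a c h
  cw : Cw ≠ ⊤
  cw1 : 1 ≤ Cw

/-- infimum over cube -/
def cInf (g : Rn n → ℝ≥0∞) (c : Rn n) (h : ℝ) : ℝ≥0∞ := ⨅ x ∈ cube c h, g x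

theorem WData.lower {w : Rn n → ℝ≥0∞} {a : Rn n → ℝ → ℝ≥0∞} {Cw : ℝ≥0∞} (H : WData w a Cw)
    (c : Rn n) {h : ℝ} (hh : 0 < h) {s : Set (Rn n)} (hs : s ⊆ cube c h) (hsm : MeasurableSet s) :
    a c h * volume s ≤ ∫⁻ x in s, w x := by
  rw [← setLIntegral_const]
  refine setLIntegral_mono_ae' hsm ?_
  filter_upwards [H.le c h hh] with x hx hxs using hx (hs hxs)

theorem jn_decay {w : Rn n → ℝ≥0∞} {a : Rn n → ℝ → ℝ≥0∞} {Cw : ℝ≥0∞} (H : WData w a Cw)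
    {g : Rn n → ℝ≥0∞} (hg : Measurable g) (A : ℝ≥0∞)
    (hyp : ∀ c h, 0 < h → 2 ^ (n + 2) * volume {x | x ∈ cube c h ∧ cInf g c h + A * a c h < g x} ≤
      volume (cube c h)) (k : ℕ) :
    ∀ c h, 0 < h → ∫⁻ x in {x | x ∈ cube c h ∧ cInf g c h + k * A * w x < g x}, w x ≤
      (1 - (2 * Cw)⁻¹) ^ k * ∫⁻ x in cube c h, w x := by
  have hw := H.meas
  induction k with
  | zero =>
    intro c h hh
    simp only [pow_zero, one_mul]
    exact lintegral_mono_set fun x hx => hx.1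
  | succ k ih =>
    intro c h hh
    set R := cube c h with hR
    set E := {x | x ∈ R ∧ cInf g c h + A * a c h < g x} with hE
    have hRm : MeasurableSet R := measurableSet_cube c h
    have hEm : MeasurableSet E := hRm.inter (measurableSet_lt measurable_const hg)
    have hRtop : volume R ≠ ⊤ := volume_cube_ne_top c hh
    have h2 : (2:ℝ≥0∞) ^ (n+1) ≠ 0 := by positivity
    have h2t : (2:ℝ≥0∞) ^ (n+1) ≠ ⊤ := by finiteness
    have hEv : 2 ^ (n+2) * volume E ≤ volume R := hyp c h hh
    have hER : E ⊆ R := fun x hx => hx.1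
    have hEI : ∀ s, MeasurableSet s → ∫⁻ x in s, E.indicator 1 x = volume (E ∩ s) := by
      intro s hs
      rw [lintegral_indicator_one hEm, Measure.restrict_apply hEm]
    set lam : ℝ≥0∞ := (2 ^ (n+1))⁻¹ with hlam
    have hlamE : ∀ q : ℝ≥0∞, lam * q ≤ volume E → q ≤ 2 ^ (n+1) * volume E := by
      intro q hq
      calc q = 2 ^ (n+1) * (lam * q) := by
            rw [← mul_assoc, hlam, ENNReal.mul_inv_cancel h2 h2t, one_mul]
        _ ≤ _ := by gcongr
    obtain ⟨S, hSc, hS, hSd, hSae⟩ := cz_cubes c hh (u := E.indicator 1)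
      (measurable_one.indicator hEm) lam
      (by rw [hEI _ hRm]; exact ne_top_of_le_ne_top hRtop (measure_mono inter_subset_right))
      (by
        rw [hEI _ hRm, inter_eq_left.2 hER, hlam]
        calc volume E = (2 ^ (n+1))⁻¹ * (2 ^ (n+1) * volume E) := by
              rw [← mul_assoc, ENNReal.inv_mul_cancel h2 h2t, one_mul]
          _ ≤ (2 ^ (n+1))⁻¹ * (2 ^ (n+2) * volume E) := by
              gcongr
              · norm_num
              · omega
          _ ≤ _ := by gcongr)
    have hSm : ∀ q ∈ S, MeasurableSet (cube q.1 q.2) := fun q _ => measurableSet_cube _ _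
    set U := ⋃ q ∈ S, cube q.1 q.2 with hU
    have hUm : MeasurableSet U := MeasurableSet.biUnion hSc hSm
    have hUR : U ⊆ R := iUnion₂_subset fun q hq => (hS q hq).2.1
    -- measure of U
    have hUv : 2 * volume U ≤ volume R := by
      have h1 : lam * volume U ≤ volume E := by
        rw [hU, measure_biUnion hSc hSd hSm, ← ENNReal.tsum_mul_left]
        calc ∑' q : S, lam * volume (cube q.1.1 q.1.2)
            ≤ ∑' q : S, volume (E ∩ cube q.1.1 q.1.2) := by
              refine ENNReal.tsum_le_tsum fun q => ?_
              have := (hS q.1 q.2).2.2.1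
              rw [hEI _ (hSm q.1 q.2)] at this
              exact this.le
          _ = volume (⋃ q ∈ S, (E ∩ cube q.1 q.2)) := by
              rw [measure_biUnion hSc (fun q hq q' hq' hne =>
                (hSd hq hq' hne).mono inter_subset_right inter_subset_right)
                (fun q hq => hEm.inter (hSm q hq))]
          _ ≤ volume E := measure_mono (iUnion₂_subset fun q _ => inter_subset_left)
      calc 2 * volume U ≤ 2 * (2 ^ (n+1) * volume E) := by gcongr; exact hlamE _ h1
        _ = 2 ^ (n+2) * volume E := by ring
        _ ≤ _ := hEv
    have hUtop : volume U ≠ ⊤ := ne_top_of_le_ne_top hRtop (measure_mono hUR)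
    have hWR : ∫⁻ x in R, w x ≠ ⊤ := by
      refine ne_top_of_le_ne_top ?_ (H.a1 c h hh)
      have := H.afin c h hh; have := H.cw
      finiteness
    have hdiff : volume R ≤ 2 * volume (R \ U) := by
      rw [measure_sdiff hUR hUm.nullMeasurableSet hUtop]
      rw [ENNReal.mul_sub (by simp)]
      refine ENNReal.le_sub_of_add_le_right (by finiteness) ?_
      rw [two_mul (volume R)]; gcongr
    have hCw0 : Cw ≠ 0 := (lt_of_lt_of_le one_pos H.cw1).ne'
    have hCwt := H.cw
    have hWU : ∫⁻ x in U, w x ≤ (1 - (2 * Cw)⁻¹) * ∫⁻ x in R, w x := by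
      have h1 : (2 * Cw)⁻¹ * ∫⁻ x in R, w x ≤ ∫⁻ x in R \ U, w x := by
        rw [ENNReal.inv_mul_le_iff (by positivity) (by finiteness)]
        calc ∫⁻ x in R, w x ≤ Cw * a c h * volume R := H.a1 c h hh
          _ ≤ Cw * a c h * (2 * volume (R \ U)) := by gcongr
          _ = 2 * Cw * (a c h * volume (R \ U)) := by ring
          _ ≤ _ := by gcongr; exact H.lower c hh sdiff_subset (hRm.diff hUm)
      have h2 : ∫⁻ x in R, w x = (∫⁻ x in U, w x) + ∫⁻ x in R \ U, w x := by
        rw [← lintegral_union (hRm.diff hUm) disjoint_sdiff_right, union_sdiff_cancel hUR]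
      rw [ENNReal.sub_mul (fun _ _ => hWR), one_mul]
      refine ENNReal.le_sub_of_add_le_right ?_ ?_
      · exact ENNReal.mul_ne_top (ENNReal.inv_ne_top.2 (by positivity)) hWR
      · conv_rhs => rw [h2]
        gcongr
    set F : Rn n × ℝ → Set (Rn n) := fun q => {x | x ∈ cube q.1 q.2 ∧
      cInf g q.1 q.2 + k * A * w x < g x} with hF
    have hcover : ∀ᵐ x ∂(volume : Measure (Rn n)),
        x ∈ {x | x ∈ R ∧ cInf g c h + (k+1 : ℕ) * A * w x < g x} → x ∈ ⋃ q ∈ S, F q := by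
      filter_upwards [hSae, H.le c h hh] with x hx hax hxF
      obtain ⟨hxR, hxg⟩ := hxF
      have hxg' : cInf g c h + A * a c h + k * A * w x < g x := by
        refine lt_of_le_of_lt ?_ hxg
        have := hax hxR
        push_cast
        calc cInf g c h + A * a c h + k * A * w x ≤ cInf g c h + A * w x + k * A * w x := by gcongr
          _ = _ := by ring
      have hxE : x ∈ E := ⟨hxR, lt_of_le_of_lt le_self_add hxg'⟩
      have hxU : x ∈ U := by
        by_contra hxU
        have := hx hxR hxU
        rw [indicator_of_mem hxE] at this
        simp only [Pi.one_apply, hlam] at this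
        rw [ENNReal.one_le_inv] at this
        have h3 : (1:ℝ≥0∞) < 2 ^ (n+1) := one_lt_pow₀ (by norm_num) (by omega)
        exact absurd this (not_le.2 h3)
      rw [hU, mem_iUnion₂] at hxU
      obtain ⟨q, hq, hxq⟩ := hxU
      rw [mem_iUnion₂]
      refine ⟨q, hq, hxq, lt_of_le_of_lt ?_ hxg'⟩
      gcongr
      -- find a point of q outside E
      obtain ⟨hq0, hqR, _, hq2⟩ := hS q hq
      have : ∃ y ∈ cube q.1 q.2, y ∉ E := by
        by_contra hcon
        push Not at hcon
        rw [hEI _ (hSm q hq), inter_eq_right.2 (fun y hy => hcon y hy)] at hq2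
        have h4 : (2:ℝ≥0∞) ^ n * lam = 2⁻¹ := by
          rw [hlam, pow_succ, ENNReal.mul_inv (by simp) (by simp), ← mul_assoc,
            ENNReal.mul_inv_cancel (by positivity) (by finiteness), one_mul]
        rw [h4] at hq2
        have := ENNReal.half_lt_self (volume_cube_ne_zero q.1 hq0) (volume_cube_ne_top q.1 hq0)
        rw [ENNReal.div_eq_inv_mul] at this
        exact absurd hq2 (not_le.2 this)
      obtain ⟨y, hyq, hyE⟩ := this
      have : g y ≤ cInf g c h + A * a c h := by
        by_contra hcon
        exact hyE ⟨hqR hyq, not_le.1 hcon⟩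
      exact (iInf₂_le y hyq).trans this
    calc ∫⁻ x in {x | x ∈ R ∧ cInf g c h + (k+1 : ℕ) * A * w x < g x}, w x
        ≤ ∫⁻ x in ⋃ q ∈ S, F q, w x := lintegral_mono_set' hcover
      _ ≤ ∑' q : S, ∫⁻ x in F q, w x := by
          have : Countable S := hSc.to_subtype
          rw [biUnion_eq_iUnion]
          exact lintegral_iUnion_le _ _
      _ ≤ ∑' q : S, (1 - (2 * Cw)⁻¹) ^ k * ∫⁻ x in cube q.1.1 q.1.2, w x :=
          ENNReal.tsum_le_tsum fun q => ih _ _ (hS q.1 q.2).1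
      _ = (1 - (2 * Cw)⁻¹) ^ k * ∫⁻ x in U, w x := by
          rw [ENNReal.tsum_mul_left, hU, lintegral_biUnion hSc hSm hSd]
      _ ≤ (1 - (2 * Cw)⁻¹) ^ k * ((1 - (2 * Cw)⁻¹) * ∫⁻ x in R, w x) := by gcongr
      _ = _ := by rw [pow_succ, mul_assoc]

theorem jn_const {Cw : ℝ≥0∞} (hcw : Cw ≠ ⊤) (p : ℝ) :
    ∑' k : ℕ, ((k : ℝ≥0∞) + 1) ^ p * (1 - (2 * Cw)⁻¹) ^ k ≠ ⊤ := by
  obtain ⟨m, hm⟩ := exists_nat_ge p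
  set θ : ℝ := (1 - (2 * Cw)⁻¹).toReal with hθ
  have ht : (1 - (2 * Cw)⁻¹ : ℝ≥0∞) ≠ ⊤ := by finiteness
  have hlt : (1 - (2 * Cw)⁻¹ : ℝ≥0∞) < 1 := by
    apply ENNReal.sub_lt_self (by simp) (by simp)
    apply ENNReal.inv_ne_zero.2; finiteness
  have hθ1 : ‖θ‖ < 1 := by
    rw [Real.norm_of_nonneg ENNReal.toReal_nonneg]
    have := (ENNReal.toReal_lt_toReal ht (by simp)).2 hlt
    simpa using this
  have hs := summable_pow_mul_geometric_of_norm_lt_one m hθ1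
  have hs2 : Summable fun k : ℕ => (((k : ℝ) + 1) ^ m * θ ^ k) := by
    by_cases h0 : θ = 0
    · refine summable_of_ne_finset_zero (s := {0}) fun k hk => ?_
      have : k ≠ 0 := by simpa using hk
      simp [h0, this]
    · have h1 := (summable_nat_add_iff 1).2 hs
      have h2 := h1.mul_right θ⁻¹
      refine h2.congr fun k => ?_
      push_cast
      rw [pow_succ]; field_simp
  have hfin := hs2.tsum_ofReal_ne_top
  refine ne_top_of_le_ne_top hfin (ENNReal.tsum_le_tsum fun k => ?_)
  have e : (1 - (2 * Cw)⁻¹ : ℝ≥0∞) = ENNReal.ofReal θ := (ENNReal.ofReal_toReal ht).symm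
  rw [ENNReal.ofReal_mul (by positivity), ENNReal.ofReal_pow (by positivity),
    ENNReal.ofReal_pow (by positivity), e]
  gcongr
  have e2 : (k : ℝ≥0∞) + 1 = ENNReal.ofReal ((k:ℝ) + 1) := by
    rw [ENNReal.ofReal_add (by positivity) (by norm_num)]; simp
  rw [e2, ← ENNReal.rpow_natCast]
  apply ENNReal.rpow_le_rpow_of_exponent_le _ hm
  rw [ENNReal.one_le_ofReal]; linarith [(Nat.cast_nonneg k : (0:ℝ) ≤ k)]

/-- The John–Nirenberg type conclusion. -/
theorem jn_main {w : Rn n → ℝ≥0∞} {a : Rn n → ℝ → ℝ≥0∞} {Cw : ℝ≥0∞} (H : WData w a Cw)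
    {g : Rn n → ℝ≥0∞} (hg : Measurable g) {A : ℝ≥0∞} (hA : A ≠ 0)
    (hyp : ∀ c h, 0 < h → 2 ^ (n + 2) * volume {x | x ∈ cube c h ∧ cInf g c h + A * a c h < g x} ≤
      volume (cube c h)) (p : ℝ) (hp : 1 < p) (c : Rn n) {h : ℝ} (hh : 0 < h) :
    ∫⁻ x in cube c h, ((g x - cInf g c h) / w x) ^ p * w x ≤
      A ^ p * (∑' k : ℕ, ((k : ℝ≥0∞) + 1) ^ p * (1 - (2 * Cw)⁻¹) ^ k) * ∫⁻ x in cube c h, w x := by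
  have hw := H.meas
  set F : ℕ → Set (Rn n) := fun k => {x | x ∈ cube c h ∧ cInf g c h + k * A * w x < g x} with hF
  have hFm : ∀ k, MeasurableSet (F k) := fun k =>
    (measurableSet_cube c h).inter (measurableSet_lt (by fun_prop) hg)
  have hp0 : 0 < p := by linarith
  have key : ∀ x ∈ cube c h, ((g x - cInf g c h) / w x) ^ p * w x ≤
      ∑' k : ℕ, (F k).indicator (fun x => (A * (k + 1)) ^ p * w x) x := by
    intro x hx
    by_cases hall : ∀ k, x ∈ F k
    · have : ∑' k : ℕ, (F k).indicator (fun x => (A * (k + 1)) ^ p * w x) x = ⊤ := by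
        rw [eq_top_iff, ← ENNReal.tsum_const_eq_top_of_ne_zero (α := ℕ) (c := A ^ p * w x)]
        · refine ENNReal.tsum_le_tsum fun k => ?_
          rw [indicator_of_mem (hall k)]
          gcongr
          exact le_mul_of_one_le_right (by positivity) le_add_self
        · refine mul_ne_zero ?_ (H.pos x).ne'
          rw [Ne, ENNReal.rpow_eq_zero_iff]
          push Not
          exact ⟨fun h => absurd h hA, fun _ => hp0.le⟩
      rw [this]; exact le_top
    · push Not at hall
      classical
      have hspec := Nat.find_spec hall
      set k0 := Nat.find hall with hk0
      have hle : g x - cInf g c h ≤ k0 * A * w x := by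
        rw [tsub_le_iff_left]
        by_contra hcon
        exact hspec ⟨hx, not_le.1 hcon⟩
      rcases Nat.eq_zero_or_pos k0 with h0 | h0
      · rw [h0] at hle
        simp only [Nat.cast_zero, zero_mul, nonpos_iff_eq_zero] at hle
        rw [hle, ENNReal.zero_div, ENNReal.zero_rpow_of_pos hp0, zero_mul]
        exact zero_le
      · have hmem : x ∈ F (k0 - 1) := by
          have := Nat.find_min hall (m := k0 - 1) (by omega)
          simpa using this
        refine le_trans ?_ (ENNReal.le_tsum (k0 - 1))
        rw [indicator_of_mem hmem]
        gcongr
        apply ENNReal.div_le_of_le_mul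
        refine hle.trans (le_of_eq ?_)
        have : ((k0 - 1 : ℕ) : ℝ≥0∞) + 1 = k0 := by
          rw [← Nat.cast_succ]; congr 1; omega
        rw [this, mul_comm A]
  calc ∫⁻ x in cube c h, ((g x - cInf g c h) / w x) ^ p * w x
      ≤ ∫⁻ x in cube c h, ∑' k : ℕ, (F k).indicator (fun x => (A * (k + 1)) ^ p * w x) x :=
        setLIntegral_mono' (measurableSet_cube c h) key
    _ = ∑' k : ℕ, ∫⁻ x in cube c h, (F k).indicator (fun x => (A * (k + 1)) ^ p * w x) x := by
        rw [lintegral_tsum]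
        intro k
        exact ((hw.const_mul _).indicator (hFm k)).aemeasurable
    _ ≤ ∑' k : ℕ, A ^ p * (((k : ℝ≥0∞) + 1) ^ p * (1 - (2 * Cw)⁻¹) ^ k *
          ∫⁻ x in cube c h, w x) := by
        refine ENNReal.tsum_le_tsum fun k => ?_
        rw [lintegral_indicator (hFm k), Measure.restrict_restrict (hFm k),
          lintegral_const_mul _ hw, ENNReal.mul_rpow_of_nonneg _ _ hp0.le, mul_assoc, mul_assoc]
        gcongr
        refine (lintegral_mono_set inter_subset_left).trans ?_
        exact jn_decay H hg A hyp k c h hh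
    _ = _ := by
        rw [ENNReal.tsum_mul_left, ENNReal.tsum_mul_right, mul_assoc]

end PartB

section PartC

theorem cube_subset_ball (c : Rn n) {h : ℝ} {y : Rn n} (hy : y ∈ cube c h) (hh : 0 < h) :
    ‖y - c‖ ≤ n * h := by
  rw [EuclideanSpace.norm_eq]
  have h1 : ∑ i, ‖(y - c) i‖ ^ 2 ≤ ∑ _i : Fin n, h ^ 2 := by
    refine Finset.sum_le_sum fun i _ => ?_
    have := hy i
    rw [PiLp.sub_apply, Real.norm_eq_abs]
    gcongr
  rw [Finset.sum_const, Finset.card_univ, Fintype.card_fin, nsmul_eq_mul] at h1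
  rw [Real.sqrt_le_iff]
  refine ⟨by positivity, h1.trans ?_⟩
  rw [mul_pow]
  gcongr
  rcases Nat.eq_zero_or_pos n with h0 | h0
  · simp [h0]
  · have : (1:ℝ) ≤ n := by exact_mod_cast h0
    nlinarith

theorem norm_ge_of_not_mem_cube {c : Rn n} {h : ℝ} {y : Rn n} (hy : y ∉ cube c h) :
    h ≤ ‖y - c‖ := by
  simp only [cube, mem_ofPred_eq, not_forall, not_lt] at hy
  obtain ⟨i, hi⟩ := hy
  exact hi.trans (by simpa using PiLp.norm_apply_le (y - c) i)

theorem integrableOn_cube {f : Rn n → ℝ} (hf : LocallyIntegrable f volume) (c : Rn n) (h : ℝ) :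
    IntegrableOn f (cube c h) volume := by
  rcases le_or_gt h 0 with h0 | h0
  · rcases Nat.eq_zero_or_pos n with hn | hn
    · subst hn
      exact (hf.integrableOn_isCompact (Set.toFinite (cube c h)).isCompact)
    · have : cube c h = ∅ := by
        ext y
        simp only [cube, mem_ofPred_eq, mem_empty_iff_false, iff_false, not_forall, not_lt]
        exact ⟨⟨0, hn⟩, h0.trans (abs_nonneg _)⟩
      rw [this]; exact integrableOn_empty
  · refine (hf.integrableOn_isCompact (isCompact_closedBall c (n * h))).mono_set ?_
    intro y hy
    rw [mem_closedBall, dist_eq_norm]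
    exact cube_subset_ball c hy h0

theorem avg_sub_le {f : Rn n → ℝ} (hf : LocallyIntegrable f volume) (c : Rn n) {h : ℝ} (hh : 0 < h)
    (b : ℝ) : ‖avg f (cube c h) - b‖ₑ * volume (cube c h) ≤ ∫⁻ x in cube c h, ‖f x - b‖ₑ := by
  have hI := integrableOn_cube hf c h
  have hv0 := volume_cube_ne_zero c hh
  have hvt := volume_cube_ne_top c hh
  have hvr : (volume (cube c h)).toReal ≠ 0 := ENNReal.toReal_ne_zero.2 ⟨hv0, hvt⟩
  have e : avg f (cube c h) - b = ((volume (cube c h)).toReal)⁻¹ * ∫ x in cube c h, (f x - b) := by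
    rw [integral_sub hI (integrableOn_const hvt)]
    rw [avg, setIntegral_const, Measure.real, smul_eq_mul]
    field_simp
  rw [e, enorm_mul, enorm_inv hvr, Real.enorm_of_nonneg ENNReal.toReal_nonneg,
    ENNReal.ofReal_toReal hvt, mul_comm, ← mul_assoc, ENNReal.mul_inv_cancel hv0 hvt, one_mul]
  exact enorm_integral_le_lintegral_enorm _

theorem growth_avg {w : Rn n → ℝ≥0∞} {a : Rn n → ℝ → ℝ≥0∞} {Cw : ℝ≥0∞} (H : WData w a Cw)
    {f : Rn n → ℝ} (hf : LocallyIntegrable f volume) {N : ℝ≥0∞}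
    (hN : ∀ c h, 0 < h → ∫⁻ x in cube c h, ‖f x - avg f (cube c h)‖ₑ ≤ N * ∫⁻ x in cube c h, w x)
    (c : Rn n) {r : ℝ} (hr : 0 < r) (k : ℕ) :
    ‖avg f (cube c r) - avg f (cube c (2 ^ k * r))‖ₑ ≤ k * (2 ^ n * (Cw * N * a c r)) ∧
    ∫⁻ x in cube c (2 ^ k * r), ‖f x - avg f (cube c (2 ^ k * r))‖ₑ ≤
      Cw * N * a c r * volume (cube c (2 ^ k * r)) := by
  have hk : ∀ k : ℕ, 0 < 2 ^ k * r := fun k => by positivity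
  have h2 : ∀ k : ℕ, ∫⁻ x in cube c (2 ^ k * r), ‖f x - avg f (cube c (2 ^ k * r))‖ₑ ≤
      Cw * N * a c r * volume (cube c (2 ^ k * r)) := by
    intro k
    refine (hN c _ (hk k)).trans ?_
    calc N * ∫⁻ x in cube c (2 ^ k * r), w x
        ≤ N * (Cw * a c (2 ^ k * r) * volume (cube c (2 ^ k * r))) := by
          gcongr; exact H.a1 c _ (hk k)
      _ ≤ N * (Cw * a c r * volume (cube c (2 ^ k * r))) := by
          gcongr
          apply H.anti _ _ _ _ hr (hk k)
          apply cube_mono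
          have : (1:ℝ) ≤ 2 ^ k := one_le_pow₀ (by norm_num)
          nlinarith
      _ = _ := by ring
  refine ⟨?_, h2 k⟩
  induction k with
  | zero => simp
  | succ k ih =>
    have hstep : ‖avg f (cube c (2 ^ k * r)) - avg f (cube c (2 ^ (k+1) * r))‖ₑ ≤
        2 ^ n * (Cw * N * a c r) := by
      have h3 := avg_sub_le hf c (hk k) (avg f (cube c (2 ^ (k+1) * r)))
      have hsub : cube c (2 ^ k * r) ⊆ cube c (2 ^ (k+1) * r) := by
        apply cube_mono; rw [pow_succ]; nlinarith [hk k]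
      have h4 := h3.trans ((lintegral_mono_set hsub).trans (h2 (k+1)))
      have e : volume (cube c (2 ^ (k+1) * r)) = 2 ^ n * volume (cube c (2 ^ k * r)) := by
        rw [show (2:ℝ) ^ (k+1) * r = 2 * (2 ^ k * r) by ring, volume_cube_mul c c (hk k) two_pos,
          ENNReal.ofReal_pow (by norm_num)]
        simp
      rw [e, ← mul_assoc] at h4
      have h5 := (ENNReal.mul_le_mul_iff_left (volume_cube_ne_zero c (hk k))
        (volume_cube_ne_top c (hk k))).1 h4
      rw [mul_comm (2 ^ n)]; exact h5
    calc ‖avg f (cube c r) - avg f (cube c (2 ^ (k+1) * r))‖ₑ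
        = ‖(avg f (cube c r) - avg f (cube c (2 ^ k * r))) +
          (avg f (cube c (2 ^ k * r)) - avg f (cube c (2 ^ (k+1) * r)))‖ₑ := by congr 1; ring
      _ ≤ _ := enorm_add_le _ _
      _ ≤ k * (2 ^ n * (Cw * N * a c r)) + 2 ^ n * (Cw * N * a c r) := by gcongr
      _ = _ := by push_cast; ring

theorem growth_int {w : Rn n → ℝ≥0∞} {a : Rn n → ℝ → ℝ≥0∞} {Cw : ℝ≥0∞} (H : WData w a Cw)
    {f : Rn n → ℝ} (hf : LocallyIntegrable f volume) {N : ℝ≥0∞}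
    (hN : ∀ c h, 0 < h → ∫⁻ x in cube c h, ‖f x - avg f (cube c h)‖ₑ ≤ N * ∫⁻ x in cube c h, w x)
    (c : Rn n) {r : ℝ} (hr : 0 < r) (k : ℕ) :
    ∫⁻ x in cube c (2 ^ k * r), ‖f x - avg f (cube c r)‖ₑ ≤
      (k + 1) * (2 ^ n * (Cw * N * a c r)) * volume (cube c (2 ^ k * r)) := by
  obtain ⟨h1, h2⟩ := growth_avg H hf hN c hr k
  set M := avg f (cube c (2 ^ k * r))
  set M0 := avg f (cube c r)
  calc ∫⁻ x in cube c (2 ^ k * r), ‖f x - M0‖ₑ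
      ≤ ∫⁻ x in cube c (2 ^ k * r), (‖f x - M‖ₑ + ‖M0 - M‖ₑ) := by
        refine lintegral_mono fun x => ?_
        have : f x - M0 = (f x - M) - (M0 - M) := by ring
        rw [this]; exact enorm_sub_le
    _ = (∫⁻ x in cube c (2 ^ k * r), ‖f x - M‖ₑ) + ‖M0 - M‖ₑ * volume (cube c (2 ^ k * r)) := by
        rw [lintegral_add_right _ measurable_const, setLIntegral_const]
    _ ≤ Cw * N * a c r * volume (cube c (2 ^ k * r)) +
          k * (2 ^ n * (Cw * N * a c r)) * volume (cube c (2 ^ k * r)) := by gcongr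
    _ ≤ 2 ^ n * (Cw * N * a c r) * volume (cube c (2 ^ k * r)) +
          k * (2 ^ n * (Cw * N * a c r)) * volume (cube c (2 ^ k * r)) := by
        have h1' : (1:ℝ≥0∞) ≤ 2 ^ n := one_le_pow₀ (by norm_num)
        have h2' : Cw * N * a c r ≤ 2 ^ n * (Cw * N * a c r) := by
         calc Cw * N * a c r = 1 * (Cw * N * a c r) := (one_mul _).symm
          _ ≤ 2 ^ n * (Cw * N * a c r) := by gcongr
        exact add_le_add_left (mul_le_mul_left h2' _) _
    _ = _ := by ring

/-- Poisson type kernel. -/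
def kap (n : ℕ) (ε r s : ℝ) : ℝ := r ^ ε * (r + s) ^ (-((n:ℝ) + ε))

/-- constant -/
def Kg (n : ℕ) (ε : ℝ) : ℝ≥0∞ :=
  ∑' k : ℕ, ENNReal.ofReal (2 ^ (3 * n + ε) * (((k:ℝ) + 1) * (2 ^ (-ε)) ^ k))

theorem Kg_ne_top (n : ℕ) {ε : ℝ} (hε : 0 < ε) : Kg n ε ≠ ⊤ := by
  apply Summable.tsum_ofReal_ne_top
  apply Summable.mul_left
  have h1 : ‖(2:ℝ) ^ (-ε)‖ < 1 := by
    rw [Real.norm_of_nonneg (by positivity)]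
    exact Real.rpow_lt_one_of_one_lt_of_neg (by norm_num) (by linarith)
  have a1 := summable_pow_mul_geometric_of_norm_lt_one 1 h1
  have a0 := summable_pow_mul_geometric_of_norm_lt_one 0 h1
  refine (a1.add a0).congr fun k => ?_
  simp; ring

theorem kap_le_sum {ε r : ℝ} (hε : 0 < ε) (hr : 0 < r) (c y : Rn n) :
    ENNReal.ofReal (kap n ε r ‖y - c‖) ≤ ∑' k : ℕ, (cube c (2 ^ k * r)).indicator
      (fun _ => ENNReal.ofReal (r ^ (-(n:ℝ)) * (2 ^ ((n:ℝ) + ε) * (2 ^ (-((n:ℝ) + ε))) ^ k))) y := by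
  classical
  have hex : ∃ k : ℕ, y ∈ cube c (2 ^ k * r) := by
    obtain ⟨k, hk⟩ := pow_unbounded_of_one_lt (‖y - c‖ / r) (one_lt_two (α := ℝ))
    refine ⟨k, ?_⟩
    by_contra hcon
    have := norm_ge_of_not_mem_cube hcon
    rw [div_lt_iff₀ hr] at hk
    linarith
  have hs := Nat.find_spec hex
  set k := Nat.find hex with hk
  refine le_trans ?_ (ENNReal.le_tsum k)
  rw [indicator_of_mem hs]
  apply ENNReal.ofReal_le_ofReal
  have hlow : (2:ℝ)⁻¹ * 2 ^ k * r ≤ r + ‖y - c‖ := by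
    rcases Nat.eq_zero_or_pos k with h0 | h0
    · rw [h0]; have := norm_nonneg (y - c); simp; linarith
    · have := Nat.find_min hex (m := k - 1) (by omega)
      have h1 := norm_ge_of_not_mem_cube this
      have e : (2:ℝ) ^ k = 2 * 2 ^ (k - 1) := by rw [← pow_succ']; congr 1; omega
      rw [e]; linarith
  have hpos : (0:ℝ) < 2⁻¹ * 2 ^ k * r := by positivity
  rw [kap]
  have h3 : (r + ‖y - c‖) ^ (-((n:ℝ) + ε)) ≤ (2⁻¹ * 2 ^ k * r) ^ (-((n:ℝ) + ε)) :=
    Real.rpow_le_rpow_of_nonpos hpos hlow (by have : (0:ℝ) ≤ n := Nat.cast_nonneg n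
                                              linarith)
  calc r ^ ε * (r + ‖y - c‖) ^ (-((n:ℝ) + ε)) ≤ r ^ ε * (2⁻¹ * 2 ^ k * r) ^ (-((n:ℝ) + ε)) := by
        gcongr
    _ = _ := by
        rw [Real.mul_rpow (by positivity) hr.le, Real.mul_rpow (by positivity) (by positivity),
          Real.inv_rpow (by norm_num), Real.rpow_neg (x := 2) (by norm_num), inv_inv,
          ← Real.rpow_natCast 2 k, ← Real.rpow_natCast _ k, ← Real.rpow_neg (by norm_num),
          ← Real.rpow_mul (by norm_num), ← Real.rpow_mul (by norm_num), mul_comm (k:ℝ),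
          mul_comm _ (r ^ _), ← mul_assoc, ← Real.rpow_add hr]
        congr 2
        ring

theorem growth_kap {w : Rn n → ℝ≥0∞} {a : Rn n → ℝ → ℝ≥0∞} {Cw : ℝ≥0∞} (H : WData w a Cw)
    {f : Rn n → ℝ} (hf : LocallyIntegrable f volume) {N : ℝ≥0∞}
    (hN : ∀ c h, 0 < h → ∫⁻ x in cube c h, ‖f x - avg f (cube c h)‖ₑ ≤ N * ∫⁻ x in cube c h, w x)
    {ε : ℝ} (hε : 0 < ε) (c : Rn n) {r : ℝ} (hr : 0 < r) :
    ∫⁻ y, ENNReal.ofReal (kap n ε r ‖y - c‖) * ‖f y - avg f (cube c r)‖ₑ ≤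
      Kg n ε * (Cw * N * a c r) := by
  set M := avg f (cube c r)
  have hfm : AEMeasurable (fun y => ‖f y - M‖ₑ) volume :=
    (hf.aestronglyMeasurable.aemeasurable.sub_const M).enorm
  set b : ℕ → ℝ≥0∞ := fun k =>
    ENNReal.ofReal (r ^ (-(n:ℝ)) * (2 ^ ((n:ℝ) + ε) * (2 ^ (-((n:ℝ) + ε))) ^ k)) with hb
  calc ∫⁻ y, ENNReal.ofReal (kap n ε r ‖y - c‖) * ‖f y - M‖ₑ
      ≤ ∫⁻ y, ∑' k : ℕ, (cube c (2 ^ k * r)).indicator (fun y => b k * ‖f y - M‖ₑ) y := by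
        refine lintegral_mono fun y => ?_
        refine (mul_le_mul_left (kap_le_sum hε hr c y) _).trans ?_
        rw [← ENNReal.tsum_mul_right]
        refine ENNReal.tsum_le_tsum fun k => ?_
        by_cases hy : y ∈ cube c (2 ^ k * r) <;> simp [hy, hb]
    _ = ∑' k : ℕ, b k * ∫⁻ y in cube c (2 ^ k * r), ‖f y - M‖ₑ := by
        rw [lintegral_tsum]
        · refine tsum_congr fun k => ?_
          rw [lintegral_indicator (measurableSet_cube _ _), lintegral_const_mul'' _ hfm.restrict]
        · intro k
          exact (hfm.const_mul _).indicator (measurableSet_cube _ _)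
    _ ≤ ∑' k : ℕ, ENNReal.ofReal (2 ^ (3 * n + ε) * (((k:ℝ) + 1) * (2 ^ (-ε)) ^ k)) *
          (Cw * N * a c r) := by
        refine ENNReal.tsum_le_tsum fun k => ?_
        refine (mul_le_mul_right (growth_int H hf hN c hr k) _).trans ?_
        rw [volume_cube c (by positivity)]
        have e1 : ((k:ℝ≥0∞) + 1) = ENNReal.ofReal ((k:ℝ) + 1) := by
          rw [ENNReal.ofReal_add (by positivity) (by norm_num)]; simp
        have e2 : (2:ℝ≥0∞) ^ n = ENNReal.ofReal (2 ^ n) := by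
          rw [ENNReal.ofReal_pow (by norm_num)]; simp
        rw [e1, e2]
        have e3 : b k * (ENNReal.ofReal ((k:ℝ) + 1) * (ENNReal.ofReal (2 ^ n) * (Cw * N * a c r)) *
            ENNReal.ofReal ((2 * (2 ^ k * r)) ^ n)) =
            (b k * ENNReal.ofReal ((k:ℝ) + 1) * ENNReal.ofReal (2 ^ n) *
              ENNReal.ofReal ((2 * (2 ^ k * r)) ^ n)) * (Cw * N * a c r) := by ring
        rw [e3]
        gcongr
        rw [hb]
        simp only
        rw [← ENNReal.ofReal_mul (by positivity), ← ENNReal.ofReal_mul (by positivity),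
          ← ENNReal.ofReal_mul (by positivity)]
        apply ENNReal.ofReal_le_ofReal
        apply le_of_eq
        have hrn : r ^ (-(n:ℝ)) = (r ^ n)⁻¹ := by rw [Real.rpow_neg hr.le, Real.rpow_natCast]
        have h3n : (2:ℝ) ^ (3 * n + ε) = 2 ^ n * 2 ^ n * 2 ^ ((n:ℝ) + ε) := by
          rw [← Real.rpow_natCast 2 n, ← Real.rpow_add two_pos, ← Real.rpow_add two_pos]
          congr 1; ring
        have h2k : ((2:ℝ) ^ (-((n:ℝ) + ε))) ^ k * (2 ^ k) ^ n = (2 ^ (-ε)) ^ k := by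
          rw [neg_add, Real.rpow_add two_pos, mul_pow, Real.rpow_neg two_pos.le, Real.rpow_natCast,
            inv_pow, ← pow_mul, ← pow_mul, mul_comm k n]
          have : (0:ℝ) < 2 ^ (n * k) := by positivity
          field_simp
        rw [hrn, h3n, ← h2k, mul_pow, mul_pow]
        have : (0:ℝ) < r ^ n := by positivity
        field_simp
    _ = _ := by rw [ENNReal.tsum_mul_right, Kg]

end PartC

section PartD

/-- The `L²` norm of a nonnegative function. -/
def L2n {X : Type*} [MeasurableSpace X] (ν : Measure X) (F : X → ℝ≥0∞) : ℝ≥0∞ :=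
  (∫⁻ x, F x ^ 2 ∂ν) ^ (1/2 : ℝ)

section L2
variable {X Y : Type*} [MeasurableSpace X] [MeasurableSpace Y] {ν : Measure X} {ρ : Measure Y}

theorem sqrt_sq_enn (a : ℝ≥0∞) : (a ^ (1/2:ℝ)) ^ 2 = a := by
  rw [← ENNReal.rpow_natCast, ← ENNReal.rpow_mul]; norm_num

theorem sq_sqrt_enn (a : ℝ≥0∞) : (a ^ 2) ^ (1/2:ℝ) = a := by
  rw [← ENNReal.rpow_natCast, ← ENNReal.rpow_mul]; norm_num

theorem L2n_sq (F : X → ℝ≥0∞) : L2n ν F ^ 2 = ∫⁻ x, F x ^ 2 ∂ν := sqrt_sq_enn _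

theorem L2n_mono {F G : X → ℝ≥0∞} (h : ∀ᵐ x ∂ν, F x ≤ G x) : L2n ν F ≤ L2n ν G := by
  unfold L2n
  refine ENNReal.rpow_le_rpow (lintegral_mono_ae ?_) (by norm_num)
  filter_upwards [h] with x hx
  gcongr

theorem L2n_le {F : X → ℝ≥0∞} {B : ℝ≥0∞} (h : ∫⁻ x, F x ^ 2 ∂ν ≤ B ^ 2) : L2n ν F ≤ B := by
  unfold L2n
  rw [← sq_sqrt_enn B]
  exact ENNReal.rpow_le_rpow h (by norm_num)

theorem L2n_add {F G : X → ℝ≥0∞} (hF : AEMeasurable F ν) (hG : AEMeasurable G ν) :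
    L2n ν (fun x => F x + G x) ≤ L2n ν F + L2n ν G := by
  have := ENNReal.lintegral_Lp_add_le (p := 2) hF hG (by norm_num)
  simpa [L2n] using this

theorem L2n_CS {F G : X → ℝ≥0∞} (hF : AEMeasurable F ν) (hG : AEMeasurable G ν) :
    ∫⁻ x, F x * G x ∂ν ≤ L2n ν F * L2n ν G := by
  have := ENNReal.lintegral_mul_le_Lp_mul_Lq ν (p := 2) (q := 2)
    (Real.holderConjugate_iff.mpr (by norm_num)) hF hG
  simpa [L2n] using this

theorem minkowski [SFinite ν] [SFinite ρ] {D : X → Y → ℝ≥0∞} (hD : Measurable (Function.uncurry D)) :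
    L2n ν (fun x => ∫⁻ y, D x y ∂ρ) ≤ ∫⁻ y, L2n ν (fun x => D x y) ∂ρ := by
  apply L2n_le
  have hx : ∀ x, Measurable (fun y => D x y) := fun x => hD.of_uncurry_left
  have hy : ∀ y, Measurable (fun x => D x y) := fun y => hD.of_uncurry_right
  have hL : Measurable (fun y => L2n ν (fun x => D x y)) := by
    unfold L2n
    refine Measurable.pow_const (Measurable.lintegral_prod_right' (f := fun q : Y × X => D q.2 q.1 ^ 2) ?_) _
    exact (hD.comp measurable_swap).pow_const 2
  calc ∫⁻ x, (∫⁻ y, D x y ∂ρ) ^ 2 ∂ν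
      = ∫⁻ x, ∫⁻ y, ∫⁻ y', D x y * D x y' ∂ρ ∂ρ ∂ν := by
        refine lintegral_congr fun x => ?_
        rw [sq, ← lintegral_mul_const _ (hx x)]
        refine lintegral_congr fun y => ?_
        rw [lintegral_const_mul _ (hx x)]
    _ = ∫⁻ y, ∫⁻ x, ∫⁻ y', D x y * D x y' ∂ρ ∂ν ∂ρ := by
        apply lintegral_lintegral_swap
        apply Measurable.aemeasurable
        refine Measurable.lintegral_prod_right' (f := fun q : (X × Y) × Y => D q.1.1 q.1.2 * D q.1.1 q.2) ?_
        exact (hD.comp measurable_fst).mul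
          (hD.comp ((measurable_fst.comp measurable_fst).prodMk measurable_snd))
    _ = ∫⁻ y, ∫⁻ y', ∫⁻ x, D x y * D x y' ∂ν ∂ρ ∂ρ := by
        refine lintegral_congr fun y => ?_
        apply lintegral_lintegral_swap
        apply Measurable.aemeasurable
        exact ((hy y).comp measurable_fst).mul hD
    _ ≤ ∫⁻ y, ∫⁻ y', L2n ν (fun x => D x y) * L2n ν (fun x => D x y') ∂ρ ∂ρ := by
        refine lintegral_mono fun y => lintegral_mono fun y' => ?_
        exact L2n_CS (hy y).aemeasurable (hy y').aemeasurable
    _ = (∫⁻ y, L2n ν (fun x => D x y) ∂ρ) ^ 2 := by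
        rw [sq, ← lintegral_mul_const _ hL]
        refine lintegral_congr fun y => ?_
        rw [lintegral_const_mul _ hL]

theorem L2n_const_mul {F : X → ℝ≥0∞} (hF : Measurable F) (k : ℝ≥0∞) :
    L2n ν (fun x => k * F x) = k * L2n ν F := by
  unfold L2n
  simp_rw [mul_pow]
  rw [lintegral_const_mul _ (hF.pow_const 2), ENNReal.mul_rpow_of_nonneg _ _ (by norm_num), sq_sqrt_enn]

end L2

/-- The measure `dt/t` on `(0,∞)`. -/
def tau : Measure ℝ := (volume.restrict (Ioi (0:ℝ))).withDensity (fun t => ENNReal.ofReal (t⁻¹))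

instance : SFinite tau := by unfold tau; infer_instance

theorem lintegral_tau {F : ℝ → ℝ≥0∞} (hF : Measurable F) :
    ∫⁻ t, F t ∂tau = ∫⁻ t in Ioi (0:ℝ), ENNReal.ofReal (t⁻¹) * F t := by
  unfold tau
  rw [lintegral_withDensity_eq_lintegral_mul _ (by fun_prop) hF]
  rfl

theorem ae_tau_pos : ∀ᵐ t ∂tau, 0 < t := by
  unfold tau
  apply (withDensity_absolutelyContinuous _ _).ae_le
  exact ae_restrict_mem measurableSet_Ioi

/-- time factor -/
def tf (b s t : ℝ) : ℝ := (min (t/s) (s/t)) ^ b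

theorem tf_meas (b s : ℝ) : Measurable (tf b s) := by unfold tf; fun_prop

theorem tf_int {b s : ℝ} (hb : 0 < b) (hs : 0 < s) :
    ∫⁻ t, ENNReal.ofReal (tf b s t) ∂tau ≤ ENNReal.ofReal (2 / b) := by
  rw [lintegral_tau (tf_meas b s).ennreal_ofReal, ← Ioc_union_Ioi_eq_Ioi hs.le,
    lintegral_union measurableSet_Ioi (by
      rw [Set.disjoint_left]; intro x hx hx'; exact absurd hx' (not_lt.mpr hx.2))]
  have h1 : ∫⁻ t in Ioc 0 s, ENNReal.ofReal t⁻¹ * ENNReal.ofReal (tf b s t) ≤ ENNReal.ofReal (1 / b) := by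
    calc ∫⁻ t in Ioc 0 s, ENNReal.ofReal t⁻¹ * ENNReal.ofReal (tf b s t)
        ≤ ∫⁻ t in Ioc 0 s, ENNReal.ofReal (s ^ (-b) * t ^ (b - 1)) := by
          refine setLIntegral_mono' measurableSet_Ioc fun t ht => ?_
          have ht0 := ht.1
          rw [← ENNReal.ofReal_mul (by positivity)]
          apply ENNReal.ofReal_le_ofReal
          calc t⁻¹ * tf b s t ≤ t⁻¹ * (t / s) ^ b := by
                unfold tf; gcongr; exact min_le_left _ _
            _ = _ := by
                rw [Real.div_rpow ht0.le hs.le, Real.rpow_sub_one ht0.ne', Real.rpow_neg hs.le]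
                field_simp
      _ = ENNReal.ofReal (∫ t in Ioc 0 s, s ^ (-b) * t ^ (b - 1)) := by
          rw [ofReal_integral_eq_lintegral_ofReal]
          · apply Integrable.const_mul
            have := (intervalIntegral.intervalIntegrable_rpow' (a := 0) (b := s) (r := b - 1) (by linarith))
            rwa [intervalIntegrable_iff_integrableOn_Ioc_of_le hs.le] at this
          · filter_upwards [ae_restrict_mem measurableSet_Ioc] with t ht
            have := ht.1
            simp only [Pi.zero_apply]; positivity
      _ ≤ _ := by
          apply ENNReal.ofReal_le_ofReal
          rw [integral_const_mul, ← intervalIntegral.integral_of_le hs.le,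
            integral_rpow (Or.inl (by linarith))]
          simp only [sub_add_cancel]
          rw [Real.zero_rpow hb.ne', Real.rpow_neg hs.le]
          have : 0 < s ^ b := by positivity
          apply le_of_eq; field_simp; ring
  have h2 : ∫⁻ t in Ioi s, ENNReal.ofReal t⁻¹ * ENNReal.ofReal (tf b s t) ≤ ENNReal.ofReal (1 / b) := by
    calc ∫⁻ t in Ioi s, ENNReal.ofReal t⁻¹ * ENNReal.ofReal (tf b s t)
        ≤ ∫⁻ t in Ioi s, ENNReal.ofReal (s ^ b * t ^ (-b - 1)) := by
          refine setLIntegral_mono' measurableSet_Ioi fun t ht => ?_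
          have ht0 : 0 < t := hs.trans ht
          rw [← ENNReal.ofReal_mul (by positivity)]
          apply ENNReal.ofReal_le_ofReal
          calc t⁻¹ * tf b s t ≤ t⁻¹ * (s / t) ^ b := by
                unfold tf; gcongr; exact min_le_right _ _
            _ = _ := by
                rw [Real.div_rpow hs.le ht0.le, Real.rpow_sub_one ht0.ne', Real.rpow_neg ht0.le]
                field_simp
      _ = ENNReal.ofReal (∫ t in Ioi s, s ^ b * t ^ (-b - 1)) := by
          rw [ofReal_integral_eq_lintegral_ofReal]
          · apply Integrable.const_mul
            exact integrableOn_Ioi_rpow_of_lt (by linarith) hs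
          · filter_upwards [ae_restrict_mem measurableSet_Ioi] with t ht
            have : 0 < t := hs.trans ht
            simp only [Pi.zero_apply]; positivity
      _ ≤ _ := by
          apply ENNReal.ofReal_le_ofReal
          rw [integral_const_mul, integral_Ioi_rpow_of_lt (by linarith) hs]
          simp only [sub_add_cancel]
          rw [Real.rpow_neg hs.le]
          have : 0 < s ^ b := by positivity
          apply le_of_eq; field_simp
  calc _ ≤ ENNReal.ofReal (1 / b) + ENNReal.ofReal (1 / b) := add_le_add h1 h2
    _ = _ := by rw [← ENNReal.ofReal_add (by positivity) (by positivity)]; congr 1; ring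

theorem kap_nonneg {ε r s : ℝ} (hr : 0 < r) (hs : 0 ≤ s) : 0 ≤ kap n ε r s := by
  unfold kap; positivity

theorem kap_meas {ε r : ℝ} : Measurable (kap n ε r) := by
  unfold kap; fun_prop

theorem kap_int {ε : ℝ} (hε : 0 < ε) (c : Rn n) {r : ℝ} (hr : 0 < r) :
    ∫⁻ y, ENNReal.ofReal (kap n ε r ‖y - c‖) ≤ Kg n ε := by
  set b : ℕ → ℝ≥0∞ := fun k =>
    ENNReal.ofReal (r ^ (-(n:ℝ)) * (2 ^ ((n:ℝ) + ε) * (2 ^ (-((n:ℝ) + ε))) ^ k)) with hb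
  calc ∫⁻ y, ENNReal.ofReal (kap n ε r ‖y - c‖)
      ≤ ∫⁻ y, ∑' k : ℕ, (cube c (2 ^ k * r)).indicator (fun y => b k) y := by
        refine lintegral_mono fun y => ?_
        refine (kap_le_sum hε hr c y).trans ?_
        refine ENNReal.tsum_le_tsum fun k => ?_
        by_cases hy : y ∈ cube c (2 ^ k * r) <;> simp [hy, hb]
    _ = ∑' k : ℕ, b k * volume (cube c (2 ^ k * r)) := by
        rw [lintegral_tsum]
        · refine tsum_congr fun k => ?_
          rw [lintegral_indicator (measurableSet_cube _ _), setLIntegral_const]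
        · intro k
          exact (measurable_const.indicator (measurableSet_cube _ _)).aemeasurable
    _ ≤ ∑' k : ℕ, ENNReal.ofReal (2 ^ (3 * n + ε) * (((k:ℝ) + 1) * (2 ^ (-ε)) ^ k)) := by
        refine ENNReal.tsum_le_tsum fun k => ?_
        rw [volume_cube c (by positivity)]
        rw [hb]
        simp only
        rw [← ENNReal.ofReal_mul (by positivity)]
        apply ENNReal.ofReal_le_ofReal
        have hrn : r ^ (-(n:ℝ)) = (r ^ n)⁻¹ := by rw [Real.rpow_neg hr.le, Real.rpow_natCast]
        have h3n : (2:ℝ) ^ (3 * n + ε) = 2 ^ n * 2 ^ n * 2 ^ ((n:ℝ) + ε) := by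
          rw [← Real.rpow_natCast 2 n, ← Real.rpow_add two_pos, ← Real.rpow_add two_pos]
          congr 1; ring
        have h2k : ((2:ℝ) ^ (-((n:ℝ) + ε))) ^ k * (2 ^ k) ^ n = (2 ^ (-ε)) ^ k := by
          rw [neg_add, Real.rpow_add two_pos, mul_pow, Real.rpow_neg two_pos.le, Real.rpow_natCast,
            inv_pow, ← pow_mul, ← pow_mul, mul_comm k n]
          have : (0:ℝ) < 2 ^ (n * k) := by positivity
          field_simp
        have e : r ^ (-(n:ℝ)) * (2 ^ ((n:ℝ) + ε) * (2 ^ (-((n:ℝ) + ε))) ^ k) * (2 * (2 ^ k * r)) ^ n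
            = 2 ^ n * 2 ^ ((n:ℝ) + ε) * ((2 ^ (-ε)) ^ k) := by
          rw [hrn, ← h2k, mul_pow, mul_pow]
          have : (0:ℝ) < r ^ n := by positivity
          field_simp
        rw [e, h3n]
        have h1 : (1:ℝ) ≤ 2 ^ n := one_le_pow₀ (by norm_num)
        have h2 : (1:ℝ) ≤ (k:ℝ) + 1 := by linarith [(Nat.cast_nonneg k : (0:ℝ) ≤ k)]
        have h3 : (0:ℝ) ≤ 2 ^ n * 2 ^ ((n:ℝ) + ε) * ((2 ^ (-ε)) ^ k) := by positivity
        calc 2 ^ n * 2 ^ ((n:ℝ) + ε) * (((2:ℝ) ^ (-ε)) ^ k)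
            ≤ (2 ^ n * ((k:ℝ) + 1)) * (2 ^ n * 2 ^ ((n:ℝ) + ε) * ((2 ^ (-ε)) ^ k)) :=
              le_mul_of_one_le_left h3 (by nlinarith)
          _ = _ := by ring
    _ = _ := by rw [Kg]

end PartD

section PartE

/-- Kernel data: everything we use about `ψ` and the cone measure `μ`. -/
structure KD (ψ : Rn n → ℝ) (μ : Measure (Rn n)) (η C : ℝ) : Prop where
  n1 : 1 ≤ n
  meas : Measurable ψ
  int : Integrable ψ volume
  zero : ∫ x, ψ x = 0
  hη : 0 < η
  hη1 : η ≤ 1/4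
  hC : 0 < C
  size : ∀ x, |ψ x| ≤ C * (1 + ‖x‖) ^ (-((n:ℝ) + η))
  supp : ∀ᵐ z ∂μ, ‖z‖ ≤ 1
  E : ∀ (u v : Rn n) (k : ℝ), 0 < k → ‖u - v‖ ≤ 2 * n * k → (k ≤ 1 ∨ 8 * n * k ≤ ‖u‖) →
    ∫⁻ z, ‖ψ (u + z) - ψ (v + z)‖ₑ ^ 2 ∂μ ≤
      ENNReal.ofReal (C * ((k / (k + ‖u‖)) ^ (2 * η) * (1 + ‖u‖) ^ (-((n:ℝ) + η)))) ^ 2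
  modu : ∀ h : Rn n, ∫⁻ x, ‖ψ (x + h) - ψ x‖ₑ ≤ ENNReal.ofReal (C * ‖h‖ ^ (η / 2))

/-- The square function. -/
def Tf (ψ : Rn n → ℝ) (μ : Measure (Rn n)) (f : Rn n → ℝ) (x : Rn n) : ℝ≥0∞ :=
  L2n (μ.prod tau) (fun q => ‖cvl ψ q.2 f (x + q.2 • q.1)‖ₑ)

theorem kap_eq {η t s : ℝ} (ht : 0 < t) (hs : 0 ≤ s) :
    (t ^ n)⁻¹ * (1 + s / t) ^ (-((n:ℝ) + η)) = kap n η t s := by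
  unfold kap
  have h1 : 1 + s / t = (t + s) * t⁻¹ := by field_simp
  rw [h1, Real.mul_rpow (by positivity) (by positivity), Real.inv_rpow ht.le, ← Real.rpow_neg ht.le,
    neg_neg, ← Real.rpow_natCast, ← Real.rpow_neg ht.le, mul_comm ((t + s) ^ _), ← mul_assoc,
    ← Real.rpow_add ht]
  congr 2; ring

theorem norm_scale {t : ℝ} (ht : 0 < t) (v : Rn n) : ‖t⁻¹ • v‖ = ‖v‖ / t := by
  rw [norm_smul, Real.norm_of_nonneg (by positivity)]; field_simp

theorem ker_size {ψ : Rn n → ℝ} {μ : Measure (Rn n)} {η C : ℝ} (H : KD ψ μ η C) {t : ℝ}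
    (ht : 0 < t) (v : Rn n) : |(t ^ n)⁻¹ * ψ (t⁻¹ • v)| ≤ C * kap n η t ‖v‖ := by
  rw [← kap_eq ht (norm_nonneg v), abs_mul, abs_of_pos (by positivity : 0 < (t ^ n)⁻¹)]
  have := H.size (t⁻¹ • v)
  rw [norm_scale ht] at this
  calc (t ^ n)⁻¹ * |ψ (t⁻¹ • v)| ≤ (t ^ n)⁻¹ * (C * (1 + ‖v‖ / t) ^ (-((n:ℝ) + η))) := by gcongr
    _ = _ := by ring

theorem ker_size_e {ψ : Rn n → ℝ} {μ : Measure (Rn n)} {η C : ℝ} (H : KD ψ μ η C) {t : ℝ}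
    (ht : 0 < t) (v : Rn n) :
    ‖(t ^ n)⁻¹ * ψ (t⁻¹ • v)‖ₑ ≤ ENNReal.ofReal (C * kap n η t ‖v‖) := by
  rw [Real.enorm_eq_ofReal_abs]
  exact ENNReal.ofReal_le_ofReal (ker_size H ht v)

theorem ker_E {ψ : Rn n → ℝ} {μ : Measure (Rn n)} {η C : ℝ} (H : KD ψ μ η C) {t r : ℝ}
    (ht : 0 < t) (hr : 0 < r) (u v : Rn n) (huv : ‖u - v‖ ≤ 2 * n * r)
    (hc : r ≤ t ∨ 8 * n * r ≤ ‖u‖) :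
    ∫⁻ z, ‖(t ^ n)⁻¹ * ψ (t⁻¹ • (u + t • z)) - (t ^ n)⁻¹ * ψ (t⁻¹ • (v + t • z))‖ₑ ^ 2 ∂μ ≤
      ENNReal.ofReal (C * ((r / (r + ‖u‖)) ^ (2 * η) * kap n η t ‖u‖)) ^ 2 := by
  have h1 := H.E (t⁻¹ • u) (t⁻¹ • v) (r / t) (by positivity) (by
      rw [← smul_sub, norm_scale ht]
      calc ‖u - v‖ / t ≤ (2 * n * r) / t := by gcongr
        _ = _ := by ring) (by
      rcases hc with h | h
      · left; rwa [div_le_one ht]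
      · right; rw [norm_scale ht]
        calc 8 * n * (r / t) = (8 * n * r) / t := by ring
          _ ≤ _ := by gcongr)
  have e : ∀ z : Rn n, ∀ u : Rn n, t⁻¹ • (u + t • z) = t⁻¹ • u + z := by
    intro z u; rw [smul_add, smul_smul, inv_mul_cancel₀ ht.ne', one_smul]
  simp_rw [e, ← mul_sub, enorm_mul, mul_pow]
  rw [lintegral_const_mul _ (by
    have := H.meas
    fun_prop)]
  calc ‖(t ^ n)⁻¹‖ₑ ^ 2 * _ ≤ ‖(t ^ n)⁻¹‖ₑ ^ 2 * _ := mul_le_mul_right h1 _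
    _ = _ := by
      rw [Real.enorm_eq_ofReal (by positivity), ← mul_pow, ← ENNReal.ofReal_mul (by positivity),
        norm_scale ht, ← kap_eq ht (norm_nonneg u)]
      congr 2
      have : r / t / (r / t + ‖u‖ / t) = r / (r + ‖u‖) := by field_simp
      rw [this]; ring

theorem kap_comp {η : ℝ} (hη : 0 < η) {t r M s s' : ℝ} (ht : 0 < t) (hr : 0 < r) (hM : 0 < M)
    (hs : 0 ≤ s) (hs' : 0 ≤ s')
    (h : r + s' ≤ M * (t + s)) :
    kap n η t s ≤ M ^ ((n:ℝ) + η) * (t / r) ^ η * kap n η r s' := by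
  unfold kap
  have h1 : (t + s) ^ (-((n:ℝ) + η)) ≤ M ^ ((n:ℝ) + η) * (r + s') ^ (-((n:ℝ) + η)) := by
    rw [Real.rpow_neg (by positivity), Real.rpow_neg (by positivity), ← div_eq_mul_inv,
      ← one_div, div_le_div_iff₀ (by positivity) (by positivity), one_mul,
      ← Real.mul_rpow (by positivity) (by positivity)]
    exact Real.rpow_le_rpow (by positivity) h (by positivity)
  calc t ^ η * (t + s) ^ (-((n:ℝ) + η))
      ≤ t ^ η * (M ^ ((n:ℝ) + η) * (r + s') ^ (-((n:ℝ) + η))) := by gcongr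
    _ = _ := by
      rw [Real.div_rpow ht.le hr.le]
      have : 0 < r ^ η := by positivity
      field_simp

/-- kap-weighted integral -/
def KInt (η : ℝ) (f : Rn n → ℝ) (c : Rn n) (r : ℝ) : ℝ≥0∞ :=
  ∫⁻ y, ENNReal.ofReal (kap n η r ‖y - c‖) * ‖f y‖ₑ

section
variable {ψ : Rn n → ℝ} {μ : Measure (Rn n)} {η C : ℝ}

theorem kmeas (hψ : Measurable ψ) {f : Rn n → ℝ} (hf : Measurable f) :
    Measurable (fun q : (Rn n × ℝ) × Rn n => (q.1.2 ^ n)⁻¹ * ψ (q.1.2⁻¹ • (q.1.1 - q.2)) * f q.2) := by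
  fun_prop

theorem cvl_meas (hψ : Measurable ψ) {f : Rn n → ℝ} (hf : Measurable f) :
    Measurable (fun q : Rn n × ℝ => cvl ψ q.2 f q.1) := by
  unfold cvl
  exact ((kmeas hψ hf).stronglyMeasurable.integral_prod_right').measurable

theorem F_meas (hψ : Measurable ψ) {f : Rn n → ℝ} (hf : Measurable f) (x : Rn n) :
    Measurable (fun q : Rn n × ℝ => cvl ψ q.2 f (x + q.2 • q.1)) :=
  (cvl_meas hψ hf).comp (g := fun q : Rn n × ℝ => cvl ψ q.2 f q.1) (f := fun q : Rn n × ℝ => (x + q.2 • q.1, q.2))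
    (by fun_prop)

theorem Tf_meas [SFinite μ] (hψ : Measurable ψ) {f : Rn n → ℝ} (hf : Measurable f) :
    Measurable (Tf ψ μ f) := by
  unfold Tf L2n
  refine Measurable.pow_const (Measurable.lintegral_prod_right'
    (f := fun q : Rn n × (Rn n × ℝ) => ‖cvl ψ q.2.2 f (q.1 + q.2.2 • q.2.1)‖ₑ ^ 2) ?_) _
  refine Measurable.pow_const (Measurable.enorm ?_) _
  exact (cvl_meas hψ hf).comp (g := fun q : Rn n × ℝ => cvl ψ q.2 f q.1)
    (f := fun q : Rn n × (Rn n × ℝ) => (q.1 + q.2.2 • q.2.1, q.2.2)) (by fun_prop)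

theorem cvl_congr_ae {f g : Rn n → ℝ} (h : f =ᵐ[volume] g) (t : ℝ) (w : Rn n) :
    cvl ψ t f w = cvl ψ t g w := by
  unfold cvl
  apply integral_congr_ae
  filter_upwards [h] with y hy
  rw [hy]

theorem Tf_congr_ae {f g : Rn n → ℝ} (h : f =ᵐ[volume] g) : Tf ψ μ f = Tf ψ μ g := by
  funext x; unfold Tf
  simp_rw [cvl_congr_ae h]

theorem cvl_const (H : KD ψ μ η C) {t : ℝ} (M : ℝ) (w : Rn n) :
    cvl ψ t (fun _ => M) w = 0 := by
  unfold cvl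
  rw [integral_mul_const, integral_const_mul,
    integral_sub_left_eq_self (fun y => ψ (t⁻¹ • y)) volume w,
    Measure.integral_comp_smul volume ψ t⁻¹, H.zero]
  simp

theorem ker_integrable (H : KD ψ μ η C) {t : ℝ} (ht : 0 < t) (w : Rn n) :
    Integrable (fun y => (t ^ n)⁻¹ * ψ (t⁻¹ • (w - y))) volume := by
  apply Integrable.const_mul
  exact (H.int.comp_smul (inv_ne_zero ht.ne')).comp_sub_left w

theorem cvl_integrable (H : KD ψ μ η C) {f : Rn n → ℝ} (hf : AEStronglyMeasurable f volume) {c : Rn n} {r : ℝ}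
    (hr : 0 < r) (hK : KInt η f c r ≠ ⊤) {t : ℝ} (ht : 0 < t) (w : Rn n) :
    Integrable (fun y => (t ^ n)⁻¹ * ψ (t⁻¹ • (w - y)) * f y) volume := by
  have hm := H.meas
  refine ⟨(ker_integrable H ht w).aestronglyMeasurable.mul hf, ?_⟩
  have hC := H.hC
  set M := (r + ‖w - c‖) / t + 1
  have hM : 0 < M := by positivity
  set A := C * (M ^ ((n:ℝ) + η) * (t / r) ^ η)
  have hA : 0 ≤ A := by positivity
  calc ∫⁻ y, ‖(t ^ n)⁻¹ * ψ (t⁻¹ • (w - y)) * f y‖ₑ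
      ≤ ∫⁻ y, ENNReal.ofReal A * (ENNReal.ofReal (kap n η r ‖y - c‖) * ‖f y‖ₑ) := by
        refine lintegral_mono fun y => ?_
        rw [enorm_mul, ← mul_assoc, ← ENNReal.ofReal_mul hA]
        gcongr
        refine (ker_size_e H ht _).trans (ENNReal.ofReal_le_ofReal ?_)
        have : kap n η t ‖w - y‖ ≤ M ^ ((n:ℝ) + η) * (t / r) ^ η * kap n η r ‖y - c‖ := by
          apply kap_comp H.hη ht hr hM (norm_nonneg _) (norm_nonneg _)
          have h1 : ‖y - c‖ ≤ ‖w - c‖ + ‖w - y‖ := by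
            have : y - c = (w - c) - (w - y) := by abel
            rw [this]; exact norm_sub_le _ _
          have h2 : M * (t + ‖w - y‖) = (r + ‖w - c‖) + t + M * ‖w - y‖ := by
            simp only [M]; field_simp
          have h3 : ‖w - y‖ ≤ M * ‖w - y‖ := le_mul_of_one_le_left (norm_nonneg _)
            (by simp only [M]; linarith [show 0 ≤ (r + ‖w - c‖) / t by positivity])
          linarith
        calc C * kap n η t ‖w - y‖ ≤ C * (M ^ ((n:ℝ) + η) * (t / r) ^ η * kap n η r ‖y - c‖) := by gcongr
          _ = _ := by simp only [A]; ring
    _ = ENNReal.ofReal A * KInt η f c r := by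
        rw [lintegral_const_mul' _ _ ENNReal.ofReal_ne_top]; rfl
    _ < ⊤ := ENNReal.mul_lt_top ENNReal.ofReal_lt_top hK.lt_top

theorem cvl_sub_const (H : KD ψ μ η C) {f : Rn n → ℝ} (hf : AEStronglyMeasurable f volume) {c : Rn n} {r : ℝ}
    (hr : 0 < r) (M : ℝ) (hK : KInt η (fun y => f y - M) c r ≠ ⊤) {t : ℝ} (ht : 0 < t) (w : Rn n) :
    cvl ψ t f w = cvl ψ t (fun y => f y - M) w := by
  have h1 := cvl_integrable (f := fun y => f y - M) H (hf.sub aestronglyMeasurable_const) hr hK ht w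
  have h2 := (ker_integrable H ht w).mul_const M
  have h3 := cvl_const (t := t) H M w
  unfold cvl at h3 ⊢
  simp only at h3
  rw [← add_zero (∫ y, (t ^ n)⁻¹ * ψ (t⁻¹ • (w - y)) * (f y - M)), ← h3, ← integral_add h1 h2]
  congr 1; funext y; ring

theorem ae_prod_tau [SFinite μ] (P : Rn n × ℝ → Prop) (hP : ∀ z t, 0 < t → P (z, t)) :
    ∀ᵐ q ∂(μ.prod tau), P q := by
  have := (Measure.quasiMeasurePreserving_snd (μ := μ) (ν := tau)).ae ae_tau_pos
  filter_upwards [this] with q hq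
  exact hP q.1 q.2 hq

theorem ae_prod_tau' [SFinite μ] (hs : ∀ᵐ z ∂μ, ‖z‖ ≤ 1) (P : Rn n × ℝ → Prop)
    (hP : ∀ z t, 0 < t → ‖z‖ ≤ 1 → P (z, t)) :
    ∀ᵐ q ∂(μ.prod tau), P q := by
  have h1 := (Measure.quasiMeasurePreserving_snd (μ := μ) (ν := tau)).ae ae_tau_pos
  have h2 := (Measure.quasiMeasurePreserving_fst (μ := μ) (ν := tau)).ae hs
  filter_upwards [h1, h2] with q hq hq'
  exact hP q.1 q.2 hq hq'

theorem Tf_sub_const [SFinite μ] (H : KD ψ μ η C) {f : Rn n → ℝ} (hf : AEStronglyMeasurable f volume) {c : Rn n} {r : ℝ}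
    (hr : 0 < r) (M : ℝ) (hK : KInt η (fun y => f y - M) c r ≠ ⊤) :
    Tf ψ μ f = Tf ψ μ (fun y => f y - M) := by
  funext x
  unfold Tf L2n
  congr 1
  apply lintegral_congr_ae
  apply ae_prod_tau
  intro z t ht
  simp only
  rw [cvl_sub_const H hf hr M hK ht]

end
end PartE

section PartF

/-- time constant -/
def Ct (η : ℝ) : ℝ≥0∞ := ENNReal.ofReal (η⁻¹) ^ (1/2:ℝ)

theorem Ct_ne_top (η : ℝ) : Ct η ≠ ⊤ := by
  unfold Ct; exact ENNReal.rpow_ne_top_of_nonneg (by norm_num) ENNReal.ofReal_ne_top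

theorem tf_sq {η s t : ℝ} (hs : 0 < s) (ht : 0 < t) : tf η s t ^ 2 = tf (2 * η) s t := by
  unfold tf
  rw [← Real.rpow_natCast, ← Real.rpow_mul (by positivity)]
  congr 1; push_cast; ring

theorem tf_nonneg {η s t : ℝ} (hs : 0 < s) (ht : 0 < t) : 0 ≤ tf η s t := by
  unfold tf; positivity

theorem L2z {μ : Measure (Rn n)} [SFinite μ] {η s : ℝ} (hη : 0 < η) (hs : 0 < s)
    {F : Rn n × ℝ → ℝ≥0∞} (hF : Measurable F) {k : ℝ≥0∞}
    (h : ∀ t, 0 < t → ∫⁻ z, F (z, t) ^ 2 ∂μ ≤ (k * ENNReal.ofReal (tf η s t)) ^ 2) :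
    L2n (μ.prod tau) F ≤ k * Ct η := by
  apply L2n_le
  rw [lintegral_prod_symm' _ (hF.pow_const 2)]
  calc ∫⁻ t, ∫⁻ z, F (z, t) ^ 2 ∂μ ∂tau
      ≤ ∫⁻ t, k ^ 2 * ENNReal.ofReal (tf (2 * η) s t) ∂tau := by
        apply lintegral_mono_ae
        filter_upwards [ae_tau_pos] with t ht
        refine (h t ht).trans (le_of_eq ?_)
        rw [mul_pow, ← tf_sq hs ht, ENNReal.ofReal_pow (tf_nonneg hs ht)]
    _ = k ^ 2 * ∫⁻ t, ENNReal.ofReal (tf (2 * η) s t) ∂tau :=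
        lintegral_const_mul _ (tf_meas _ _).ennreal_ofReal
    _ ≤ k ^ 2 * ENNReal.ofReal (2 / (2 * η)) := by
        gcongr; exact tf_int (by positivity) hs
    _ = _ := by
        rw [mul_pow, Ct, sqrt_sq_enn]
        congr 2; field_simp

theorem kap_large {η : ℝ} (hn : 1 ≤ n) (hη : 0 < η) (hη1 : η ≤ 1/4) {t r s : ℝ} (hr : 0 < r) (hrt : r ≤ t)
    (hs : 0 ≤ s) :
    (r / (r + s)) ^ (2 * η) * kap n η t s ≤ tf η r t * kap n η r s := by
  have ht : 0 < t := hr.trans_le hrt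
  have hmin : min (t / r) (r / t) = r / t := by
    apply min_eq_right
    calc r / t ≤ 1 := by rwa [div_le_one ht]
      _ ≤ t / r := by rwa [one_le_div hr]
  unfold tf kap
  rw [hmin]
  have hn' : (1:ℝ) ≤ n := by exact_mod_cast hn
  have hts : 0 < t + s := by positivity
  have hrs : 0 < r + s := by positivity
  -- core
  have key : t ^ (2 * η) * (t + s) ^ (-((n:ℝ) + η)) ≤ (r + s) ^ (-(n:ℝ) + η) := by
    calc t ^ (2 * η) * (t + s) ^ (-((n:ℝ) + η)) ≤ (t + s) ^ (2 * η) * (t + s) ^ (-((n:ℝ) + η)) := by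
          gcongr; linarith
      _ = (t + s) ^ (-(n:ℝ) + η) := by rw [← Real.rpow_add hts]; congr 1; ring
      _ ≤ _ := Real.rpow_le_rpow_of_nonpos hrs (by linarith) (by linarith)
  have e1 : (r / t) ^ η * (r ^ η * (r + s) ^ (-((n:ℝ) + η))) =
      (r ^ (2 * η) * (r + s) ^ (-(2 * η)) * t ^ (-η)) * (r + s) ^ (-(n:ℝ) + η) := by
    rw [Real.div_rpow hr.le ht.le, Real.rpow_neg ht.le,
      show (-((n:ℝ) + η)) = -(2 * η) + (-(n:ℝ) + η) by ring, Real.rpow_add hrs (-(2 * η)),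
      show 2 * η = η + η by ring, Real.rpow_add hr]
    field_simp
  have e2 : (r / (r + s)) ^ (2 * η) * (t ^ η * (t + s) ^ (-((n:ℝ) + η))) =
      (r ^ (2 * η) * (r + s) ^ (-(2 * η)) * t ^ (-η)) * (t ^ (2 * η) * (t + s) ^ (-((n:ℝ) + η))) := by
    have : t ^ η = t ^ (-η) * t ^ (2 * η) := by rw [← Real.rpow_add ht]; congr 1; ring
    rw [Real.div_rpow hr.le hrs.le, this, Real.rpow_neg hrs.le (2 * η)]
    field_simp
  rw [e1, e2]
  gcongr

section
variable {ψ : Rn n → ℝ} {μ : Measure (Rn n)} {η C : ℝ}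

theorem KInt_mono {f g : Rn n → ℝ} (h : ∀ y, ‖f y‖ₑ ≤ ‖g y‖ₑ) (c : Rn n) (r : ℝ) :
    KInt η f c r ≤ KInt η g c r := by
  unfold KInt
  exact lintegral_mono fun y => mul_le_mul_right (h y) _

/-- dilation factor -/
def dil (n : ℕ) : ℝ := 4 * n + 4

/-- decomposition constant -/
def Cd (μ : Measure (Rn n)) (η C : ℝ) : ℝ≥0∞ :=
  ENNReal.ofReal (C * 4 ^ ((n:ℝ) + η)) * (μ univ) ^ (1/2:ℝ) * Ct η +
    ENNReal.ofReal (C * ((n:ℝ) + 1) ^ ((n:ℝ) + η)) * Ct η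

theorem Cd_ne_top [IsFiniteMeasure μ] : Cd μ η C ≠ ⊤ := by
  have := Ct_ne_top η
  have h2 : (μ univ) ^ (1/2:ℝ) ≠ ⊤ := ENNReal.rpow_ne_top_of_nonneg (by norm_num) (measure_ne_top _ _)
  unfold Cd
  finiteness

theorem decomp_far (H : KD ψ μ η C) {f : Rn n → ℝ} {c : Rn n} {r : ℝ} (hr : 0 < r)
    (hsupp : ∀ y ∈ cube c (dil n * r), f y = 0) {x : Rn n} (hx : x ∈ cube c r) {t : ℝ} (ht : 0 < t)
    (htr : t ≤ r) {z : Rn n} (hz : ‖z‖ ≤ 1) :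
    ‖cvl ψ t f (x + t • z)‖ₑ ≤ ENNReal.ofReal (C * 4 ^ ((n:ℝ) + η)) * KInt η f c r *
      ENNReal.ofReal (tf η r t) := by
  have hC := H.hC
  have hmin : min (t / r) (r / t) = t / r := by
    apply min_eq_left
    calc t / r ≤ 1 := by rwa [div_le_one hr]
      _ ≤ r / t := by rwa [one_le_div ht]
  have htf : tf η r t = (t / r) ^ η := by unfold tf; rw [hmin]
  have hxc := cube_subset_ball c hx hr
  unfold cvl
  refine (enorm_integral_le_lintegral_enorm _).trans ?_
  calc ∫⁻ y, ‖(t ^ n)⁻¹ * ψ (t⁻¹ • (x + t • z - y)) * f y‖ₑ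
      ≤ ∫⁻ y, ENNReal.ofReal (C * 4 ^ ((n:ℝ) + η)) * ENNReal.ofReal (tf η r t) *
          (ENNReal.ofReal (kap n η r ‖y - c‖) * ‖f y‖ₑ) := by
        refine lintegral_mono fun y => ?_
        by_cases hy : y ∈ cube c (dil n * r)
        · simp [hsupp y hy]
        have hyc := norm_ge_of_not_mem_cube hy
        rw [enorm_mul, ← mul_assoc, ← ENNReal.ofReal_mul (by positivity),
          ← ENNReal.ofReal_mul (by rw [htf]; positivity)]
        gcongr
        refine (ker_size_e H ht _).trans (ENNReal.ofReal_le_ofReal ?_)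
        have : kap n η t ‖x + t • z - y‖ ≤ 4 ^ ((n:ℝ) + η) * (t / r) ^ η * kap n η r ‖y - c‖ := by
          apply kap_comp H.hη ht hr (by norm_num) (norm_nonneg _) (norm_nonneg _)
          have h1 : ‖y - c‖ ≤ ‖x - c‖ + ‖t • z‖ + ‖x + t • z - y‖ := by
            have : y - c = (x - c) + t • z - (x + t • z - y) := by abel
            rw [this]
            exact (norm_sub_le _ _).trans (by gcongr; exact norm_add_le _ _)
          have h2 : ‖t • z‖ ≤ r := by
            rw [norm_smul, Real.norm_of_nonneg ht.le]; nlinarith [norm_nonneg z]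
          have h3 : (4 * n + 4) * r ≤ ‖y - c‖ := hyc
          nlinarith
        calc C * kap n η t ‖x + t • z - y‖
            ≤ C * (4 ^ ((n:ℝ) + η) * (t / r) ^ η * kap n η r ‖y - c‖) := by gcongr
          _ = _ := by rw [htf]; ring
    _ = _ := by
        rw [lintegral_const_mul' _ _ (by finiteness)]
        unfold KInt; ring

theorem decomp [IsFiniteMeasure μ] (H : KD ψ μ η C) {f : Rn n → ℝ} (hf : Measurable f) {c : Rn n} {r : ℝ}
    (hr : 0 < r) (hK : KInt η f c r ≠ ⊤) {x x' : Rn n} (hx : x ∈ cube c r) (hx' : x' ∈ cube c r) :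
    Tf ψ μ f x ≤ Tf ψ μ ((cube c (dil n * r)).indicator f) x + Cd μ η C * KInt η f c r + Tf ψ μ f x' := by
  have hC := H.hC
  have hη := H.hη
  set K0 := KInt η f c r
  set f1 := (cube c (dil n * r)).indicator f with hf1
  set f2 := (cube c (dil n * r))ᶜ.indicator f with hf2
  have hf1m : Measurable f1 := hf.indicator (measurableSet_cube _ _)
  have hf2m : Measurable f2 := hf.indicator (measurableSet_cube _ _).compl
  have hK1 : KInt η f1 c r ≠ ⊤ := ne_top_of_le_ne_top hK (KInt_mono (fun y => by
    simp only [hf1, indicator]; split_ifs <;> simp) c r)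
  have hK2' : KInt η f2 c r ≤ K0 := KInt_mono (fun y => by
    simp only [hf2, indicator]; split_ifs <;> simp) c r
  have hK2 : KInt η f2 c r ≠ ⊤ := ne_top_of_le_ne_top hK hK2'
  have hsum : ∀ y, f y = f1 y + f2 y := fun y => by
    simp only [hf1, hf2]; exact (congrFun (indicator_self_add_compl _ f) y).symm
  set B2 : Rn n × ℝ → ℝ≥0∞ := fun q => ENNReal.ofReal (C * 4 ^ ((n:ℝ) + η)) * K0 * ENNReal.ofReal (tf η r q.2) with hB2
  set D : Rn n × ℝ → Rn n → ℝ≥0∞ := fun q y => (Ici r).indicator (fun t =>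
    ‖(t ^ n)⁻¹ * ψ (t⁻¹ • (x - y + t • q.1)) - (t ^ n)⁻¹ * ψ (t⁻¹ • (x' - y + t • q.1))‖ₑ * ‖f y‖ₑ) q.2 with hDd
  have hm := H.meas
  have hD : Measurable (Function.uncurry D) := by
    have : Function.uncurry D = {p : (Rn n × ℝ) × Rn n | r ≤ p.1.2}.indicator (fun p =>
      ‖(p.1.2 ^ n)⁻¹ * ψ (p.1.2⁻¹ • (x - p.2 + p.1.2 • p.1.1)) - (p.1.2 ^ n)⁻¹ *
        ψ (p.1.2⁻¹ • (x' - p.2 + p.1.2 • p.1.1))‖ₑ * ‖f p.2‖ₑ) := by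
      funext p
      simp only [Function.uncurry, hDd, indicator, mem_Ici, mem_ofPred_eq]
    rw [this]
    refine Measurable.indicator ?_ (measurableSet_le measurable_const (by fun_prop))
    fun_prop
  have hB2m : Measurable B2 := ((tf_meas η r).ennreal_ofReal.comp measurable_snd).const_mul _
  have hG3m : Measurable (fun q => ∫⁻ y, D q y) := hD.lintegral_prod_right'
  have hdiff : ‖x - x'‖ ≤ 2 * n * r := by
    have h1 := cube_subset_ball c hx hr
    have h2 := cube_subset_ball c hx' hr
    have : x - x' = (x - c) - (x' - c) := by abel
    rw [this]
    linarith [norm_sub_le (x - c) (x' - c)]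
  -- pointwise
  have hpt : ∀ᵐ q ∂(μ.prod tau), ‖cvl ψ q.2 f (x + q.2 • q.1)‖ₑ ≤
      ((‖cvl ψ q.2 f1 (x + q.2 • q.1)‖ₑ + B2 q) + ∫⁻ y, D q y) + ‖cvl ψ q.2 f (x' + q.2 • q.1)‖ₑ := by
    apply ae_prod_tau' H.supp
    intro z t ht hz
    simp only
    rcases lt_or_ge t r with htr | htr
    · have e : cvl ψ t f (x + t • z) = cvl ψ t f1 (x + t • z) + cvl ψ t f2 (x + t • z) := by
        unfold cvl
        rw [← integral_add (cvl_integrable H hf1m.aestronglyMeasurable hr hK1 ht _)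
          (cvl_integrable H hf2m.aestronglyMeasurable hr hK2 ht _)]
        congr 1; funext y; rw [hsum y]; ring
      have h2 : ‖cvl ψ t f2 (x + t • z)‖ₑ ≤ B2 (z, t) := by
        refine (decomp_far H hr (fun y hy => ?_) hx ht htr.le hz).trans ?_
        · simp [hf2, hy]
        · simp only [hB2]; gcongr
      rw [e, add_assoc]
      exact (enorm_add_le _ _).trans (le_add_right (by gcongr))
    · have e : cvl ψ t f (x + t • z) = (cvl ψ t f (x + t • z) - cvl ψ t f (x' + t • z)) +
        cvl ψ t f (x' + t • z) := by ring
      have h3 : ‖cvl ψ t f (x + t • z) - cvl ψ t f (x' + t • z)‖ₑ ≤ ∫⁻ y, D (z, t) y := by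
        unfold cvl
        rw [← integral_sub (cvl_integrable H hf.aestronglyMeasurable hr hK ht _)
          (cvl_integrable H hf.aestronglyMeasurable hr hK ht _)]
        refine (enorm_integral_le_lintegral_enorm _).trans (lintegral_mono fun y => ?_)
        simp only [hDd]
        rw [indicator_of_mem (mem_Ici.mpr htr), ← enorm_mul]
        apply le_of_eq; congr 1
        rw [sub_mul, show x - y + t • z = x + t • z - y by abel, show x' - y + t • z = x' + t • z - y by abel]
      rw [e]
      refine (enorm_add_le _ _).trans ?_
      gcongr
      refine h3.trans le_add_self
  -- norms
  have hn2 : L2n (μ.prod tau) B2 ≤ ENNReal.ofReal (C * 4 ^ ((n:ℝ) + η)) * K0 * (μ univ) ^ (1/2:ℝ) * Ct η := by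
    apply L2z hη hr hB2m
    intro t ht
    simp only [hB2, lintegral_const]
    rw [mul_pow, mul_pow (_ * _ * _), mul_pow _ ((μ univ) ^ (1/2:ℝ)), sqrt_sq_enn]
    apply le_of_eq; ring
  have hn3 : L2n (μ.prod tau) (fun q => ∫⁻ y, D q y) ≤
      ENNReal.ofReal (C * ((n:ℝ) + 1) ^ ((n:ℝ) + η)) * Ct η * K0 := by
    refine (minkowski hD).trans ?_
    calc ∫⁻ y, L2n (μ.prod tau) (fun q => D q y)
        ≤ ∫⁻ y, ENNReal.ofReal (C * ((n:ℝ) + 1) ^ ((n:ℝ) + η)) * Ct η *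
            (ENNReal.ofReal (kap n η r ‖y - c‖) * ‖f y‖ₑ) := by
          refine lintegral_mono fun y => ?_
          have := L2z (μ := μ) (F := fun q => D q y) (k := ENNReal.ofReal (C * ((n:ℝ) + 1) ^ ((n:ℝ) + η)) *
              (ENNReal.ofReal (kap n η r ‖y - c‖) * ‖f y‖ₑ)) hη hr hD.of_uncurry_right (by
            intro t ht
            simp only [hDd]
            rcases lt_or_ge t r with htr | htr
            · simp only [indicator, mem_Ici, not_le.mpr htr, if_false]; simp
            simp only [indicator, mem_Ici, htr, if_true, mul_pow]
            rw [lintegral_mul_const _ (by fun_prop)]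
            refine (mul_le_mul_left (ker_E H ht hr (x - y) (x' - y) (by simpa using hdiff) (Or.inl htr)) _).trans ?_
            simp only [← mul_pow]
            have hk : C * ((r / (r + ‖x - y‖)) ^ (2 * η) * kap n η t ‖x - y‖) ≤
                C * ((n:ℝ) + 1) ^ ((n:ℝ) + η) * kap n η r ‖y - c‖ * tf η r t := by
              have h1 := kap_large H.n1 hη H.hη1 hr htr (norm_nonneg (x - y))
              have h2 : kap n η r ‖x - y‖ ≤ ((n:ℝ) + 1) ^ ((n:ℝ) + η) * (r / r) ^ η * kap n η r ‖y - c‖ := by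
                apply kap_comp hη hr hr (by positivity) (norm_nonneg _) (norm_nonneg _)
                have hxc := cube_subset_ball c hx hr
                have : ‖y - c‖ ≤ ‖x - c‖ + ‖x - y‖ := by
                  have : y - c = (x - c) - (x - y) := by abel
                  rw [this]; exact norm_sub_le _ _
                nlinarith [norm_nonneg (x - y), (Nat.cast_nonneg n : (0:ℝ) ≤ n),
                  mul_nonneg (Nat.cast_nonneg n : (0:ℝ) ≤ n) (norm_nonneg (x - y))]
              rw [div_self hr.ne', Real.one_rpow, mul_one] at h2
              have h0 := tf_nonneg (η := η) hr ht
              calc _ ≤ C * (tf η r t * kap n η r ‖x - y‖) := by gcongr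
                _ ≤ C * (tf η r t * (((n:ℝ) + 1) ^ ((n:ℝ) + η) * kap n η r ‖y - c‖)) := by gcongr
                _ = _ := by ring
            gcongr ?_ ^ 2
            calc _ ≤ ENNReal.ofReal (C * ((n:ℝ) + 1) ^ ((n:ℝ) + η) * kap n η r ‖y - c‖ * tf η r t) * ‖f y‖ₑ := by
                  gcongr
              _ = _ := by
                  rw [ENNReal.ofReal_mul' (tf_nonneg hr ht), ENNReal.ofReal_mul (by positivity)]; ring)
          refine this.trans (le_of_eq (by ring))
      _ = _ := by
          rw [lintegral_const_mul' _ _ (by have := Ct_ne_top η; finiteness)]; rfl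
  calc Tf ψ μ f x ≤ _ := L2n_mono hpt
    _ ≤ ((L2n (μ.prod tau) (fun q => ‖cvl ψ q.2 f1 (x + q.2 • q.1)‖ₑ) + L2n (μ.prod tau) B2) +
        L2n (μ.prod tau) (fun q => ∫⁻ y, D q y)) + Tf ψ μ f x' := by
      have m1 : Measurable fun q : Rn n × ℝ => ‖cvl ψ q.2 f1 (x + q.2 • q.1)‖ₑ := (F_meas hm hf1m x).enorm
      have m2 : Measurable fun q : Rn n × ℝ => ‖cvl ψ q.2 f (x' + q.2 • q.1)‖ₑ := (F_meas hm hf x').enorm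
      refine (L2n_add ((m1.add hB2m).add hG3m).aemeasurable m2.aemeasurable).trans ?_
      gcongr
      · refine (L2n_add (m1.add hB2m).aemeasurable hG3m.aemeasurable).trans ?_
        gcongr
        exact L2n_add m1.aemeasurable hB2m.aemeasurable
      · exact le_rfl
    _ ≤ _ := by
      have : Cd μ η C * K0 = ENNReal.ofReal (C * 4 ^ ((n:ℝ) + η)) * K0 * (μ univ) ^ (1/2:ℝ) * Ct η +
        ENNReal.ofReal (C * ((n:ℝ) + 1) ^ ((n:ℝ) + η)) * Ct η * K0 := by unfold Cd; ring
      rw [this, ← add_assoc]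
      gcongr
      exact le_rfl

end
end PartF

section PartG

/-- convolution -/
def cnv (k h : Rn n → ℝ) (x : Rn n) : ℝ := ∫ y, k (x - y) * h y

/-- measurable bounded integrable functions -/
structure Bd (h : Rn n → ℝ) : Prop where
  meas : Measurable h
  int : Integrable h volume
  bd : ∃ B : ℝ, ∀ x, ‖h x‖ ≤ B

theorem integrand_prod {k h : Rn n → ℝ} (hk : Integrable k volume) (hh : Integrable h volume) :
    Integrable (fun p : Rn n × Rn n => k (p.1 - p.2) * h p.2) (volume.prod volume) := by
  have := hh.convolution_integrand (ContinuousLinearMap.mul ℝ ℝ) hk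
  refine this.congr (Filter.Eventually.of_forall fun p => ?_)
  simp [mul_comm]

theorem cnv_bd {k h : Rn n → ℝ} (hkm : Measurable k) (hk : Integrable k volume) (hh : Bd h) :
    Bd (cnv k h) := by
  obtain ⟨B, hB⟩ := hh.bd
  refine ⟨?_, ?_, ⟨(∫ y, ‖k y‖) * B, fun x => ?_⟩⟩
  · unfold cnv
    have hm := hh.meas
    have : Measurable (fun q : Rn n × Rn n => k (q.1 - q.2) * h q.2) := by fun_prop
    exact this.stronglyMeasurable.integral_prod_right'.measurable
  · exact (integrand_prod hk hh.int).integral_prod_left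
  · unfold cnv
    refine (norm_integral_le_integral_norm _).trans ?_
    have h1 : Integrable (fun y => ‖k (x - y)‖ * B) volume := (hk.comp_sub_left x).norm.mul_const B
    calc ∫ y, ‖k (x - y) * h y‖ ≤ ∫ y, ‖k (x - y)‖ * B := by
          refine integral_mono_of_nonneg (Filter.Eventually.of_forall fun y => norm_nonneg _) h1
            (Filter.Eventually.of_forall fun y => ?_)
          simp only [norm_mul]
          gcongr
          exact hB y
      _ = _ := by
          rw [integral_mul_const, integral_sub_left_eq_self (fun y => ‖k y‖) volume x]

theorem Bd.mul_int {h g : Rn n → ℝ} (hh : Bd h) (hg : Bd g) : Integrable (fun x => h x * g x) volume := by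
  obtain ⟨B, hB⟩ := hh.bd
  exact hg.int.bdd_mul hh.meas.aestronglyMeasurable (Filter.Eventually.of_forall hB)

theorem Bd.sum {ι : Type*} (s : Finset ι) {h : ι → Rn n → ℝ} (hh : ∀ i ∈ s, Bd (h i)) :
    Bd (fun x => ∑ i ∈ s, h i x) := by
  refine ⟨Finset.measurable_sum _ fun i hi => (hh i hi).meas,
    integrable_finsetSum _ fun i hi => (hh i hi).int, ?_⟩
  have : ∀ i, ∃ B : ℝ, i ∈ s → ∀ x, ‖h i x‖ ≤ B := by
    intro i
    by_cases hi : i ∈ s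
    · obtain ⟨B, hB⟩ := (hh i hi).bd; exact ⟨B, fun _ => hB⟩
    · exact ⟨0, fun h => absurd h hi⟩
  choose B hB using this
  exact ⟨∑ i ∈ s, B i, fun x => (norm_sum_le _ _).trans (Finset.sum_le_sum fun i hi => hB i hi x)⟩

/-- reflection -/
def rv (k : Rn n → ℝ) (v : Rn n) : ℝ := k (-v)

theorem rv_int {k : Rn n → ℝ} (hk : Integrable k volume) : Integrable (rv k) volume := hk.comp_neg

theorem cnv_adj {k g h : Rn n → ℝ} (hk : Integrable k volume) (hg : Bd g) (hh : Bd h) :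
    ∫ x, cnv k g x * h x = ∫ y, g y * cnv (rv k) h y := by
  obtain ⟨B, hB⟩ := hh.bd
  have hI : Integrable (fun p : Rn n × Rn n => h p.1 * (k (p.1 - p.2) * g p.2)) (volume.prod volume) := by
    refine (integrand_prod hk hg.int).bdd_mul (c := B) ?_ (Filter.Eventually.of_forall fun p => hB p.1)
    exact (hh.meas.comp measurable_fst).aestronglyMeasurable
  unfold cnv
  calc ∫ x, (∫ y, k (x - y) * g y) * h x = ∫ x, ∫ y, h x * (k (x - y) * g y) := by
        congr 1; funext x; rw [integral_const_mul, mul_comm]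
    _ = ∫ y, ∫ x, h x * (k (x - y) * g y) := integral_integral_swap hI
    _ = _ := by
        congr 1; funext y
        rw [← integral_const_mul]
        congr 1; funext x
        simp only [rv, neg_sub]; ring

theorem cnv_comp {k l h : Rn n → ℝ} (hk : Integrable k volume) (hl : Integrable l volume) (hh : Bd h)
    (x : Rn n) : cnv k (cnv l h) x = cnv (cnv k l) h x := by
  obtain ⟨B, hB⟩ := hh.bd
  have h1 := integrand_prod (rv_int hl) (hk.comp_sub_left x)
  have h2 : Integrable (fun p : Rn n × Rn n => h p.1 * (rv l (p.1 - p.2) * k (x - p.2))) (volume.prod volume) := by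
    refine h1.bdd_mul (c := B) ?_ (Filter.Eventually.of_forall fun p => hB p.1)
    exact (hh.meas.comp measurable_fst).aestronglyMeasurable
  unfold cnv
  calc ∫ y, k (x - y) * ∫ z, l (y - z) * h z = ∫ y, ∫ z, h z * (rv l (z - y) * k (x - y)) := by
        congr 1; funext y; rw [← integral_const_mul]; congr 1; funext z
        simp only [rv, neg_sub]; ring
    _ = ∫ z, ∫ y, h z * (rv l (z - y) * k (x - y)) := (integral_integral_swap h2).symm
    _ = _ := by
        congr 1; funext z
        rw [integral_const_mul, mul_comm]
        congr 1
        rw [← integral_add_right_eq_self _ z]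
        congr 1; funext y
        simp only [rv]
        rw [show -(z - (y + z)) = y by abel, show x - (y + z) = x - z - y by abel, mul_comm]

theorem cnv_comm (k l : Rn n → ℝ) : cnv k l = cnv l k := by
  funext x
  unfold cnv
  rw [← integral_sub_left_eq_self _ volume x]
  congr 1; funext y
  rw [show x - (x - y) = y by abel, mul_comm]

theorem cnv_young {k h g : Rn n → ℝ} (hk : Measurable k) (hh : Measurable h) (hg : Measurable g) :
    ‖∫ x, cnv k h x * g x‖ₑ ≤ (∫⁻ y, ‖k y‖ₑ) * (L2n volume (fun x => ‖h x‖ₑ) * L2n volume (fun x => ‖g x‖ₑ)) := by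
  calc ‖∫ x, cnv k h x * g x‖ₑ ≤ ∫⁻ x, ‖cnv k h x * g x‖ₑ := enorm_integral_le_lintegral_enorm _
    _ ≤ ∫⁻ x, ∫⁻ y, ‖k y‖ₑ * (‖h (x - y)‖ₑ * ‖g x‖ₑ) := by
        refine lintegral_mono fun x => ?_
        rw [enorm_mul]
        have : ‖cnv k h x‖ₑ ≤ ∫⁻ y, ‖k y‖ₑ * ‖h (x - y)‖ₑ := by
          rw [cnv_comm]
          unfold cnv
          refine (enorm_integral_le_lintegral_enorm _).trans (le_of_eq ?_)
          congr 1; funext y; rw [enorm_mul, mul_comm]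
        refine (mul_le_mul_left this _).trans (le_of_eq ?_)
        rw [← lintegral_mul_const _ (by fun_prop)]
        congr 1; funext y; ring
    _ = ∫⁻ y, ∫⁻ x, ‖k y‖ₑ * (‖h (x - y)‖ₑ * ‖g x‖ₑ) := by
        apply lintegral_lintegral_swap
        apply Measurable.aemeasurable
        simp only [Function.uncurry_def]
        fun_prop
    _ ≤ ∫⁻ y, ‖k y‖ₑ * (L2n volume (fun x => ‖h x‖ₑ) * L2n volume (fun x => ‖g x‖ₑ)) := by
        refine lintegral_mono fun y => ?_
        rw [lintegral_const_mul _ (by fun_prop)]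
        refine mul_le_mul_right ?_ _
        have e : L2n volume (fun x => ‖h (x - y)‖ₑ) = L2n volume (fun x => ‖h x‖ₑ) := by
          unfold L2n
          rw [lintegral_sub_right_eq_self (fun x => ‖h x‖ₑ ^ 2) y]
        rw [← e]
        exact L2n_CS (by fun_prop) (by fun_prop)
    _ = _ := lintegral_mul_const _ (by fun_prop)

/-- real L2 norm -/
def n2 (h : Rn n → ℝ) : ℝ := Real.sqrt (∫ x, h x * h x)

theorem n2_nonneg (h : Rn n → ℝ) : 0 ≤ n2 h := Real.sqrt_nonneg _

theorem n2_sq (h : Rn n → ℝ) : n2 h * n2 h = ∫ x, h x * h x :=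
  Real.mul_self_sqrt (integral_nonneg fun x => mul_self_nonneg _)

theorem lint_sq {h : Rn n → ℝ} (hh : Bd h) : ∫⁻ x, ‖h x‖ₑ ^ 2 = ENNReal.ofReal (n2 h * n2 h) := by
  rw [n2_sq, ofReal_integral_eq_lintegral_ofReal (hh.mul_int hh)
    (Filter.Eventually.of_forall fun x => mul_self_nonneg _)]
  congr 1; funext x
  rw [Real.enorm_eq_ofReal_abs, ← ENNReal.ofReal_pow (abs_nonneg _), sq_abs, sq]

theorem L2n_eq {h : Rn n → ℝ} (hh : Bd h) : L2n volume (fun x => ‖h x‖ₑ) = ENNReal.ofReal (n2 h) := by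
  unfold L2n
  rw [lint_sq hh, ENNReal.ofReal_mul (n2_nonneg h), ← sq, sq_sqrt_enn]

theorem CS_real {h g : Rn n → ℝ} (hh : Bd h) (hg : Bd g) : |∫ x, h x * g x| ≤ n2 h * n2 g := by
  have h1 := L2n_CS (ν := (volume : Measure (Rn n))) hh.meas.enorm.aemeasurable hg.meas.enorm.aemeasurable
  rw [L2n_eq hh, L2n_eq hg, ← ENNReal.ofReal_mul (n2_nonneg h)] at h1
  have h2 : ‖∫ x, h x * g x‖ₑ ≤ ENNReal.ofReal (n2 h * n2 g) := by
    refine (enorm_integral_le_lintegral_enorm _).trans ?_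
    simpa only [enorm_mul] using h1
  rw [Real.enorm_eq_ofReal_abs] at h2
  exact (ENNReal.ofReal_le_ofReal_iff (mul_nonneg (n2_nonneg h) (n2_nonneg g))).mp h2

theorem young_real {k h g : Rn n → ℝ} (hk : Measurable k) (hh : Bd h) (hg : Bd g) {A : ℝ} (hA : 0 ≤ A)
    (hkA : ∫⁻ y, ‖k y‖ₑ ≤ ENNReal.ofReal A) : ∫ x, cnv k h x * g x ≤ A * (n2 h * n2 g) := by
  have h1 := cnv_young hk hh.meas hg.meas
  rw [L2n_eq hh, L2n_eq hg, ← ENNReal.ofReal_mul (n2_nonneg h)] at h1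
  have h3 := h1.trans (mul_le_mul_left hkA _)
  rw [← ENNReal.ofReal_mul hA, Real.enorm_eq_ofReal_abs] at h3
  have hnn := mul_nonneg (n2_nonneg h) (n2_nonneg g)
  exact (le_abs_self _).trans ((ENNReal.ofReal_le_ofReal_iff (by positivity)).mp h3)

/-- Finite almost orthogonality. -/
theorem almost_orth {ι : Type*} (J : Finset ι) {k : ι → Rn n → ℝ} (hkm : ∀ i, Measurable (k i))
    (hk : ∀ i, Integrable (k i) volume)
    {ρ : ι → ι → ℝ} (hρ : ∀ i j, 0 ≤ ρ i j) (hρs : ∀ i j, ρ i j = ρ j i)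
    (hΦ : ∀ i j, ∫⁻ v, ‖cnv (k j) (rv (k i)) v‖ₑ ≤ ENNReal.ofReal (ρ i j))
    (hΦm : ∀ i j, Measurable (cnv (k j) (rv (k i))))
    {S : ℝ} (hS0 : 0 ≤ S) (hS : ∀ i, ∑ j ∈ J, ρ i j ≤ S) {g : Rn n → ℝ} (hg : Bd g) :
    ∑ j ∈ J, ∫ x, cnv (k j) g x * cnv (k j) g x ≤ S * ∫ x, g x * g x := by
  set h : ι → Rn n → ℝ := fun j => cnv (k j) g with hh
  have hB : ∀ j, Bd (h j) := fun j => cnv_bd (hkm j) (hk j) hg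
  have hkr : ∀ j, Measurable (rv (k j)) := fun j => (hkm j).comp measurable_neg
  have hBs : ∀ j, Bd (cnv (rv (k j)) (h j)) := fun j => cnv_bd (hkr j) (rv_int (hk j)) (hB j)
  set u : Rn n → ℝ := fun x => ∑ j ∈ J, cnv (rv (k j)) (h j) x with hu
  have hBu : Bd u := Bd.sum J fun j _ => hBs j
  set A := ∑ j ∈ J, ∫ x, h j x * h j x with hA
  have hA' : A = ∑ j ∈ J, n2 (h j) * n2 (h j) := by simp only [hA, n2_sq]
  have hA0 : 0 ≤ A := by rw [hA']; exact Finset.sum_nonneg fun j _ => mul_self_nonneg _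
  have s1 : A = ∫ y, g y * u y := by
    simp only [hA, hu, Finset.mul_sum]
    rw [integral_finsetSum _ fun j _ => hg.mul_int (hBs j)]
    exact Finset.sum_congr rfl fun j _ => cnv_adj (hk j) hg (hB j)
  have rvrv : ∀ j, rv (rv (k j)) = k j := fun j => by funext v; simp [rv]
  have s2 : ∫ y, u y * u y = ∑ j ∈ J, ∑ i ∈ J, ∫ x, cnv (cnv (k j) (rv (k i))) (h i) x * h j x := by
    have e1 : ∫ y, u y * u y = ∑ j ∈ J, ∫ y, cnv (rv (k j)) (h j) y * u y := by
      rw [← integral_finsetSum _ fun j _ => (hBs j).mul_int hBu]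
      congr 1; funext y; rw [← Finset.sum_mul]
    rw [e1]
    refine Finset.sum_congr rfl fun j _ => ?_
    rw [cnv_adj (rv_int (hk j)) (hB j) hBu, rvrv]
    have e2 : ∀ y, cnv (k j) u y = ∑ i ∈ J, cnv (cnv (k j) (rv (k i))) (h i) y := by
      intro y
      have : cnv (k j) u y = ∑ i ∈ J, cnv (k j) (cnv (rv (k i)) (h i)) y := by
        simp only [hu]
        conv_lhs => unfold cnv
        simp only [Finset.mul_sum]
        rw [integral_finsetSum]
        · rfl
        · intro i _
          obtain ⟨B, hB'⟩ := (hBs i).bd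
          exact ((hk j).comp_sub_left y).mul_bdd (c := B) (hBs i).meas.aestronglyMeasurable
            (Filter.Eventually.of_forall hB')
      rw [this]
      exact Finset.sum_congr rfl fun i _ => cnv_comp (hk j) (rv_int (hk i)) (hB i) y
    simp only [e2, Finset.mul_sum]
    rw [integral_finsetSum]
    · refine Finset.sum_congr rfl fun i _ => ?_
      congr 1; funext x; ring
    · intro i _
      refine (hB j).mul_int (cnv_bd (hΦm i j) ?_ (hB i))
      refine ⟨(hΦm i j).aestronglyMeasurable, ?_⟩
      exact (hΦ i j).trans_lt ENNReal.ofReal_lt_top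
  have s3 : ∫ y, u y * u y ≤ S * A := by
    rw [s2]
    calc ∑ j ∈ J, ∑ i ∈ J, ∫ x, cnv (cnv (k j) (rv (k i))) (h i) x * h j x
        ≤ ∑ j ∈ J, ∑ i ∈ J, ρ i j * ((n2 (h i) * n2 (h i) + n2 (h j) * n2 (h j)) / 2) := by
          refine Finset.sum_le_sum fun j _ => Finset.sum_le_sum fun i _ => ?_
          refine (young_real (hΦm i j) (hB i) (hB j) (hρ i j) (hΦ i j)).trans ?_
          refine mul_le_mul_of_nonneg_left ?_ (hρ i j)
          nlinarith [sq_nonneg (n2 (h i) - n2 (h j))]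
      _ = (∑ j ∈ J, ∑ i ∈ J, ρ i j * (n2 (h i) * n2 (h i))) / 2 +
          (∑ j ∈ J, ∑ i ∈ J, ρ i j * (n2 (h j) * n2 (h j))) / 2 := by
          rw [Finset.sum_div, Finset.sum_div, ← Finset.sum_add_distrib]
          refine Finset.sum_congr rfl fun j _ => ?_
          rw [Finset.sum_div, Finset.sum_div, ← Finset.sum_add_distrib]
          refine Finset.sum_congr rfl fun i _ => ?_
          ring
      _ ≤ (S * A) / 2 + (S * A) / 2 := by
          have t1 : ∑ j ∈ J, ∑ i ∈ J, ρ i j * (n2 (h j) * n2 (h j)) ≤ S * A := by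
            rw [hA', Finset.mul_sum]
            refine Finset.sum_le_sum fun j _ => ?_
            rw [← Finset.sum_mul]
            refine mul_le_mul_of_nonneg_right ?_ (mul_self_nonneg _)
            rw [Finset.sum_congr rfl fun i _ => hρs i j]
            exact hS j
          have t2 : ∑ j ∈ J, ∑ i ∈ J, ρ i j * (n2 (h i) * n2 (h i)) ≤ S * A := by
            rw [Finset.sum_comm]
            rw [hA', Finset.mul_sum]
            refine Finset.sum_le_sum fun j _ => ?_
            rw [← Finset.sum_mul]
            exact mul_le_mul_of_nonneg_right (hS j) (mul_self_nonneg _)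
          gcongr
      _ = S * A := by ring
  have s4 : A * A ≤ (S * ∫ x, g x * g x) * A := by
    have c1 : A ≤ n2 g * n2 u := by
      have := CS_real hg hBu
      rw [← s1, abs_of_nonneg hA0] at this; exact this
    calc A * A ≤ (n2 g * n2 u) * (n2 g * n2 u) := mul_self_le_mul_self hA0 c1
      _ = (∫ x, g x * g x) * ∫ y, u y * u y := by rw [← n2_sq, ← n2_sq]; ring
      _ ≤ (∫ x, g x * g x) * (S * A) :=
          mul_le_mul_of_nonneg_left s3 (integral_nonneg fun x => mul_self_nonneg _)
      _ = _ := by ring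
  rcases hA0.eq_or_lt with h0 | h0
  · rw [← h0]
    exact mul_nonneg hS0 (integral_nonneg fun x => mul_self_nonneg _)
  · exact le_of_mul_le_mul_right s4 h0

end PartG

section PartH

/-- dilated kernel -/
def kt (ψ : Rn n → ℝ) (t : ℝ) (v : Rn n) : ℝ := (t ^ n)⁻¹ * ψ (t⁻¹ • v)

theorem cvl_eq_cnv (ψ : Rn n → ℝ) (t : ℝ) (f : Rn n → ℝ) (x : Rn n) : cvl ψ t f x = cnv (kt ψ t) f x := rfl

theorem lint_scale {F : Rn n → ℝ≥0∞} (hF : Measurable F) {t : ℝ} (ht : 0 < t) :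
    ∫⁻ v, ENNReal.ofReal ((t ^ n)⁻¹) * F (t⁻¹ • v) = ∫⁻ v, F v := by
  rw [lintegral_const_mul _ (by fun_prop)]
  have h1 := Measure.map_addHaar_smul (volume : Measure (Rn n)) (inv_ne_zero ht.ne')
  have h2 : ∫⁻ v, F (t⁻¹ • v) = ∫⁻ v, F v ∂(Measure.map (fun v : Rn n => t⁻¹ • v) volume) := by
    rw [lintegral_map hF (by fun_prop)]
  have h1' : Measure.map (fun v : Rn n => t⁻¹ • v) volume = ENNReal.ofReal (t ^ n) • (volume : Measure (Rn n)) := by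
    have := h1
    simp only [finrank_euclideanSpace, Fintype.card_fin, inv_pow, inv_inv] at this
    rw [abs_of_pos (by positivity)] at this
    exact this
  rw [h2, h1', lintegral_smul_measure, smul_eq_mul, ← mul_assoc, ← ENNReal.ofReal_mul (by positivity),
    inv_mul_cancel₀ (by positivity), ENNReal.ofReal_one, one_mul]

section
variable {ψ : Rn n → ℝ} {μ : Measure (Rn n)} {η C : ℝ}

theorem kt_meas (H : KD ψ μ η C) (t : ℝ) : Measurable (kt ψ t) := by
  have := H.meas
  unfold kt; fun_prop

theorem kt_int (H : KD ψ μ η C) {t : ℝ} (ht : 0 < t) : Integrable (kt ψ t) volume := by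
  unfold kt
  exact (H.int.comp_smul (inv_ne_zero ht.ne')).const_mul _

theorem kt_zero (H : KD ψ μ η C) {t : ℝ} : ∫ v, kt ψ t v = 0 := by
  unfold kt
  rw [integral_const_mul, Measure.integral_comp_smul, H.zero]; simp

theorem kt_modu (H : KD ψ μ η C) {t : ℝ} (ht : 0 < t) (h : Rn n) :
    ∫⁻ v, ‖kt ψ t (v + h) - kt ψ t v‖ₑ ≤ ENNReal.ofReal (C * t ^ (-(η/2)) * ‖h‖ ^ (η/2)) := by
  have hm := H.meas
  have h1 : ∀ v, ‖kt ψ t (v + h) - kt ψ t v‖ₑ =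
      ENNReal.ofReal ((t ^ n)⁻¹) * (fun x => ‖ψ (x + t⁻¹ • h) - ψ x‖ₑ) (t⁻¹ • v) := by
    intro v
    unfold kt
    rw [← mul_sub, enorm_mul, Real.enorm_eq_ofReal (by positivity), smul_add]
  rw [lintegral_congr h1, lint_scale (F := fun x => ‖ψ (x + t⁻¹ • h) - ψ x‖ₑ) (by fun_prop) ht]
  refine (H.modu _).trans (ENNReal.ofReal_le_ofReal ?_)
  rw [norm_scale ht, Real.div_rpow (norm_nonneg _) ht.le, Real.rpow_neg ht.le]
  apply le_of_eq
  ring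

theorem kt_moment (H : KD ψ μ η C) {t : ℝ} (ht : 0 < t) :
    ∫⁻ v, ‖kt ψ t v‖ₑ * ENNReal.ofReal (‖v‖ ^ (η/2)) ≤ ENNReal.ofReal (C * t ^ (η/2)) * Kg n (η/2) := by
  have hη := H.hη
  have hC := H.hC
  calc ∫⁻ v, ‖kt ψ t v‖ₑ * ENNReal.ofReal (‖v‖ ^ (η/2))
      ≤ ∫⁻ v : Rn n, ENNReal.ofReal (C * t ^ (η/2)) * ENNReal.ofReal (kap n (η/2) t ‖v - 0‖) := by
        refine lintegral_mono fun v => ?_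
        refine (mul_le_mul_left (ker_size_e H ht v) _).trans ?_
        have hv := norm_nonneg v
        rw [← ENNReal.ofReal_mul (mul_nonneg hC.le (kap_nonneg ht hv)), ← ENNReal.ofReal_mul (by positivity), sub_zero]
        refine ENNReal.ofReal_le_ofReal ?_
        unfold kap
        have e1 : t ^ η = t ^ (η/2) * t ^ (η/2) := by rw [← Real.rpow_add ht]; congr 1; ring
        have e2 : (t + ‖v‖) ^ (-((n:ℝ) + η/2)) = (t + ‖v‖) ^ (-((n:ℝ) + η)) * (t + ‖v‖) ^ (η/2) := by
          rw [← Real.rpow_add (by positivity)]; congr 1; ring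
        rw [e1, e2]
        have e3 : ‖v‖ ^ (η/2) ≤ (t + ‖v‖) ^ (η/2) := Real.rpow_le_rpow hv (by linarith) (by linarith)
        calc C * (t ^ (η/2) * t ^ (η/2) * (t + ‖v‖) ^ (-((n:ℝ) + η))) * ‖v‖ ^ (η/2)
            ≤ C * (t ^ (η/2) * t ^ (η/2) * (t + ‖v‖) ^ (-((n:ℝ) + η))) * (t + ‖v‖) ^ (η/2) := by gcongr
          _ = _ := by ring
    _ = ENNReal.ofReal (C * t ^ (η/2)) * ∫⁻ v : Rn n, ENNReal.ofReal (kap n (η/2) t ‖v - 0‖) := by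
        rw [lintegral_const_mul]
        exact (kap_meas.comp (by fun_prop)).ennreal_ofReal
    _ ≤ _ := mul_le_mul_right (kap_int (by linarith) 0 ht) _

end

theorem cnv_L1 {L K : Rn n → ℝ} (hLm : Measurable L) (hL : Integrable L volume) (hKm : Measurable K)
    (hK : Integrable K volume) (hK0 : ∫ v, K v = 0) {A B b : ℝ} {Q : ℝ≥0∞} (hA : 0 ≤ A)
    (hmod : ∀ h, ∫⁻ v, ‖L (v + h) - L v‖ₑ ≤ ENNReal.ofReal (A * ‖h‖ ^ b))
    (hmom : ∫⁻ v, ‖K v‖ₑ * ENNReal.ofReal (‖v‖ ^ b) ≤ ENNReal.ofReal B * Q) :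
    ∫⁻ v, ‖cnv L K v‖ₑ ≤ ENNReal.ofReal (A * B) * Q := by
  have hae : ∀ᵐ v ∂(volume : Measure (Rn n)), Integrable (fun y => L (v - y) * K y) volume :=
    (integrand_prod hL hK).prod_right_ae
  calc ∫⁻ v, ‖cnv L K v‖ₑ ≤ ∫⁻ v, ∫⁻ y, ‖K y‖ₑ * ‖L (v + -y) - L v‖ₑ := by
        refine lintegral_mono_ae ?_
        filter_upwards [hae] with v hv
        have : cnv L K v = ∫ y, K y * (L (v + -y) - L v) := by
          have e : ∀ y, K y * (L (v + -y) - L v) = L (v - y) * K y - L v * K y := by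
            intro y; rw [sub_eq_add_neg v y]; ring
          simp only [e]
          rw [integral_sub hv (hK.const_mul _), integral_const_mul, hK0]; simp [cnv]
        rw [this]
        refine (enorm_integral_le_lintegral_enorm _).trans (le_of_eq ?_)
        simp only [enorm_mul]
    _ = ∫⁻ y, ∫⁻ v, ‖K y‖ₑ * ‖L (v + -y) - L v‖ₑ := by
        apply lintegral_lintegral_swap
        apply Measurable.aemeasurable
        simp only [Function.uncurry_def]
        fun_prop
    _ ≤ ∫⁻ y, ENNReal.ofReal A * (‖K y‖ₑ * ENNReal.ofReal (‖y‖ ^ b)) := by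
        refine lintegral_mono fun y => ?_
        rw [lintegral_const_mul _ (by fun_prop)]
        refine (mul_le_mul_right (hmod (-y)) _).trans (le_of_eq ?_)
        rw [norm_neg, ENNReal.ofReal_mul hA]; ring
    _ = ENNReal.ofReal A * ∫⁻ y, (‖K y‖ₑ * ENNReal.ofReal (‖y‖ ^ b)) := lintegral_const_mul _ (by fun_prop)
    _ ≤ ENNReal.ofReal A * (ENNReal.ofReal B * Q) := mul_le_mul_right hmom _
    _ = _ := by rw [ENNReal.ofReal_mul hA, mul_assoc]

section
variable {ψ : Rn n → ℝ} {μ : Measure (Rn n)} {η C : ℝ}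

theorem orth_tf (H : KD ψ μ η C) {s t : ℝ} (hs : 0 < s) (ht : 0 < t) :
    ∫⁻ v, ‖cnv (kt ψ t) (rv (kt ψ s)) v‖ₑ ≤ ENNReal.ofReal (C * C * tf (η/2) s t) * Kg n (η/2) := by
  have hC := H.hC
  have hη := H.hη
  have ms := kt_meas H s
  have mt := kt_meas H t
  have mr : Measurable (rv (kt ψ s)) := ms.comp measurable_neg
  have ir := rv_int (kt_int H hs)
  have zr : ∫ v, rv (kt ψ s) v = 0 := by
    unfold rv
    rw [integral_neg_eq_self (fun v => kt ψ s v)]; exact kt_zero H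
  have modr : ∀ h, ∫⁻ v, ‖rv (kt ψ s) (v + h) - rv (kt ψ s) v‖ₑ ≤ ENNReal.ofReal (C * s ^ (-(η/2)) * ‖h‖ ^ (η/2)) := by
    intro h
    have := kt_modu H hs (-h)
    rw [norm_neg, ← lintegral_neg_eq_self] at this
    simpa [rv, neg_add, add_comm] using this
  have momr : ∫⁻ v, ‖rv (kt ψ s) v‖ₑ * ENNReal.ofReal (‖v‖ ^ (η/2)) ≤ ENNReal.ofReal (C * s ^ (η/2)) * Kg n (η/2) := by
    have := kt_moment H hs
    rw [← lintegral_neg_eq_self] at this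
    simpa [rv] using this
  rcases le_total s t with h | h
  · refine (cnv_L1 mt (kt_int H ht) mr ir zr (by positivity) (kt_modu H ht) momr).trans (le_of_eq ?_)
    congr 2
    unfold tf
    rw [min_eq_right, Real.div_rpow hs.le ht.le, Real.rpow_neg ht.le]
    · ring
    · rw [div_le_div_iff₀ ht hs]; nlinarith
  · rw [cnv_comm]
    refine (cnv_L1 mr ir mt (kt_int H ht) (kt_zero H) (by positivity) modr (kt_moment H ht)).trans (le_of_eq ?_)
    congr 2
    unfold tf
    rw [min_eq_left, Real.div_rpow ht.le hs.le, Real.rpow_neg hs.le]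
    · ring
    · rw [div_le_div_iff₀ hs ht]; nlinarith

/-- dyadic summation constant -/
def Sb (b : ℝ) : ℝ := ∑' k : ℤ, tf b 1 ((2:ℝ) ^ k)

theorem tf_pow {b : ℝ} (k : ℕ) : tf b 1 ((2:ℝ) ^ (k:ℤ)) = ((2:ℝ) ^ (-b)) ^ k ∧
    tf b 1 ((2:ℝ) ^ (-(k:ℤ))) = ((2:ℝ) ^ (-b)) ^ k := by
  have e : ((2:ℝ) ^ (-b)) ^ k = (((2:ℝ) ^ k)⁻¹) ^ b := by
    rw [← Real.rpow_natCast, ← Real.rpow_mul (by norm_num), ← Real.rpow_natCast, ← Real.rpow_neg (by norm_num),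
      ← Real.rpow_mul (by norm_num)]
    congr 1; ring
  have h1 : (1:ℝ) ≤ 2 ^ k := one_le_pow₀ (by norm_num)
  have h2 : ((2:ℝ) ^ k)⁻¹ ≤ 1 := inv_le_one_of_one_le₀ h1
  rw [e]
  unfold tf
  constructor
  · rw [zpow_natCast, div_one, one_div, min_eq_right (h2.trans h1)]
  · rw [zpow_neg, zpow_natCast, div_one, one_div, inv_inv, min_eq_left (h2.trans h1)]

theorem Sb_summable {b : ℝ} (hb : 0 < b) : Summable (fun k : ℤ => tf b 1 ((2:ℝ) ^ k)) := by
  have hg : Summable (fun k : ℕ => ((2:ℝ) ^ (-b)) ^ k) :=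
    summable_geometric_of_lt_one (by positivity) (Real.rpow_lt_one_of_one_lt_of_neg (by norm_num) (by linarith))
  refine Summable.of_nat_of_neg ?_ ?_
  · simpa only [(tf_pow _).1] using hg
  · simpa only [(tf_pow _).2] using hg

theorem tf_dyad {b s : ℝ} (hs : 0 < s) (i j : ℤ) :
    tf b ((2:ℝ) ^ i * s) ((2:ℝ) ^ j * s) = tf b 1 ((2:ℝ) ^ (j - i)) := by
  unfold tf
  rw [zpow_sub₀ (by norm_num)]
  congr 2
  · field_simp
  · field_simp

theorem tf_nonneg' {b s t : ℝ} (hs : 0 < s) (ht : 0 < t) : 0 ≤ tf b s t := by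
  unfold tf; positivity

theorem Sb_le {b s : ℝ} (hb : 0 < b) (hs : 0 < s) (J : Finset ℤ) (i : ℤ) :
    ∑ j ∈ J, tf b ((2:ℝ) ^ i * s) ((2:ℝ) ^ j * s) ≤ Sb b := by
  simp only [tf_dyad hs]
  have h1 : Summable (fun j : ℤ => tf b 1 ((2:ℝ) ^ (j - i))) := (Equiv.subRight i).summable_iff.mpr (Sb_summable hb)
  refine (h1.sum_le_tsum J fun j _ => tf_nonneg' one_pos (by positivity)).trans (le_of_eq ?_)
  exact (Equiv.subRight i).tsum_eq (fun k : ℤ => tf b 1 ((2:ℝ) ^ k))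

theorem dyad_sum (H : KD ψ μ η C) {g : Rn n → ℝ} (hg : Bd g) {s : ℝ} (hs : 0 < s) :
    ∑' j : ℤ, ∫⁻ x, ‖cvl ψ ((2:ℝ) ^ j * s) g x‖ₑ ^ 2 ≤
      ENNReal.ofReal (C * C * (Kg n (η/2)).toReal * Sb (η/2)) * ∫⁻ x, ‖g x‖ₑ ^ 2 := by
  have hη := H.hη
  have hC := H.hC
  have hKg := Kg_ne_top n (show 0 < η/2 by linarith)
  have hS0 : 0 ≤ Sb (η/2) := tsum_nonneg fun j => tf_nonneg' one_pos (by positivity)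
  rw [ENNReal.tsum_eq_iSup_sum]
  refine iSup_le fun J => ?_
  have hpos : ∀ j : ℤ, 0 < (2:ℝ) ^ j * s := fun j => by positivity
  have hB : ∀ j : ℤ, Bd (cnv (kt ψ ((2:ℝ) ^ j * s)) g) := fun j => cnv_bd (kt_meas H _) (kt_int H (hpos j)) hg
  have key := almost_orth J (k := fun j : ℤ => kt ψ ((2:ℝ) ^ j * s)) (fun j => kt_meas H _)
    (fun j => kt_int H (hpos j))
    (ρ := fun i j => C * C * (Kg n (η/2)).toReal * tf (η/2) ((2:ℝ) ^ i * s) ((2:ℝ) ^ j * s))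
    (fun i j => mul_nonneg (by positivity) (tf_nonneg' (hpos i) (hpos j)))
    (fun i j => by unfold tf; rw [min_comm])
    (fun i j => by
      refine (orth_tf H (hpos i) (hpos j)).trans (le_of_eq ?_)
      have := tf_nonneg' (b := η/2) (hpos i) (hpos j)
      rw [← ENNReal.ofReal_toReal hKg, ← ENNReal.ofReal_mul (by positivity), ENNReal.toReal_ofReal (by positivity)]
      congr 1; ring)
    (fun i j => by
      have m1 := kt_meas H ((2:ℝ) ^ j * s)
      have m2 : Measurable (rv (kt ψ ((2:ℝ) ^ i * s))) := (kt_meas H _).comp measurable_neg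
      unfold cnv
      have : Measurable (fun q : Rn n × Rn n => kt ψ ((2:ℝ) ^ j * s) (q.1 - q.2) * rv (kt ψ ((2:ℝ) ^ i * s)) q.2) := by
        fun_prop
      exact this.stronglyMeasurable.integral_prod_right'.measurable)
    (S := C * C * (Kg n (η/2)).toReal * Sb (η/2)) (by positivity)
    (fun i => by
      rw [← Finset.mul_sum]
      exact mul_le_mul_of_nonneg_left (Sb_le (by linarith) hs J i) (by positivity)) hg
  rw [lint_sq hg, n2_sq, ← ENNReal.ofReal_mul (by positivity)]
  refine le_trans (le_of_eq ?_) (ENNReal.ofReal_le_ofReal key)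
  rw [ENNReal.ofReal_sum_of_nonneg fun j _ => integral_nonneg fun x => mul_self_nonneg _]
  refine Finset.sum_congr rfl fun j _ => ?_
  rw [← n2_sq, ← lint_sq (hB j)]
  rfl

end

theorem tau_scale {F : ℝ → ℝ≥0∞} (hF : Measurable F) {a : ℝ} (ha : 0 < a) :
    ∫⁻ t, F (a * t) ∂tau = ∫⁻ t, F t ∂tau := by
  rw [lintegral_tau hF, lintegral_tau (by fun_prop), ← lintegral_indicator measurableSet_Ioi,
    ← lintegral_indicator measurableSet_Ioi]
  set G := (Ioi (0:ℝ)).indicator fun t => ENNReal.ofReal t⁻¹ * F t with hG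
  have hGm : Measurable G := Measurable.indicator (by fun_prop) measurableSet_Ioi
  have e : ∀ t, (Ioi (0:ℝ)).indicator (fun t => ENNReal.ofReal t⁻¹ * F (a * t)) t = ENNReal.ofReal a * G (a * t) := by
    intro t
    simp only [hG, indicator, mem_Ioi, mul_pos_iff_of_pos_left ha]
    split_ifs with h
    · rw [← mul_assoc, ← ENNReal.ofReal_mul ha.le]; congr 2; field_simp
    · simp
  simp only [e]
  rw [lintegral_const_mul _ (by fun_prop)]
  have h2 : ∫⁻ t, G (a * t) = ∫⁻ t, G t ∂(Measure.map (fun t : ℝ => a * t) volume) := by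
    rw [lintegral_map hGm (by fun_prop)]
  rw [h2, Real.map_volume_mul_left ha.ne', lintegral_smul_measure, smul_eq_mul, ← mul_assoc,
    ← ENNReal.ofReal_mul ha.le, abs_of_pos (by positivity), mul_inv_cancel₀ ha.ne', ENNReal.ofReal_one, one_mul]

theorem tau_dyad {F : ℝ → ℝ≥0∞} (hF : Measurable F) {B : ℝ≥0∞}
    (hB : ∀ s : ℝ, 0 < s → ∑' j : ℤ, F ((2:ℝ) ^ j * s) ≤ B) : ∫⁻ t, F t ∂tau ≤ B := by
  have h1 : ∫⁻ t, F t ∂tau ≤ ∫⁻ t, ∑' j : ℤ, (Ico ((2:ℝ) ^ j) ((2:ℝ) ^ (j+1))).indicator F t ∂tau := by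
    refine lintegral_mono_ae ?_
    filter_upwards [ae_tau_pos] with t ht
    obtain ⟨j, hj⟩ := exists_mem_Ico_zpow ht (one_lt_two)
    refine le_trans (le_of_eq ?_) (ENNReal.le_tsum j)
    rw [indicator_of_mem hj]
  have h2 : ∀ j : ℤ, ∫⁻ t, (Ico ((2:ℝ) ^ j) ((2:ℝ) ^ (j+1))).indicator F t ∂tau =
      ∫⁻ s, (Ico (1:ℝ) 2).indicator (fun s => F ((2:ℝ) ^ j * s)) s ∂tau := by
    intro j
    rw [← tau_scale (hF.indicator measurableSet_Ico) (show (0:ℝ) < 2 ^ j by positivity)]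
    congr 1; funext s
    have hp : (0:ℝ) < 2 ^ j := by positivity
    have : (2:ℝ) ^ j * s ∈ Ico ((2:ℝ) ^ j) ((2:ℝ) ^ (j+1)) ↔ s ∈ Ico (1:ℝ) 2 := by
      rw [mem_Ico, mem_Ico, zpow_add_one₀ (by norm_num)]
      constructor
      · rintro ⟨a, b⟩
        exact ⟨by nlinarith, lt_of_mul_lt_mul_left b hp.le⟩
      · rintro ⟨a, b⟩
        exact ⟨by nlinarith, mul_lt_mul_of_pos_left b hp⟩
    simp only [indicator, this]
  refine h1.trans ?_
  rw [lintegral_tsum fun j => (hF.indicator measurableSet_Ico).aemeasurable]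
  simp only [h2]
  rw [← lintegral_tsum fun j => (Measurable.indicator (by fun_prop) measurableSet_Ico).aemeasurable]
  calc ∫⁻ s, ∑' j : ℤ, (Ico (1:ℝ) 2).indicator (fun s => F ((2:ℝ) ^ j * s)) s ∂tau
      ≤ ∫⁻ s, (Ico (1:ℝ) 2).indicator (fun _ => B) s ∂tau := by
        refine lintegral_mono fun s => ?_
        by_cases hs : s ∈ Ico (1:ℝ) 2
        · simp only [indicator_of_mem hs]; exact hB s (by linarith [hs.1])
        · simp [indicator_of_notMem hs]
    _ = ∫⁻ t in Ioi (0:ℝ), ENNReal.ofReal t⁻¹ * (Ico (1:ℝ) 2).indicator (fun _ => B) t :=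
        lintegral_tau (measurable_const.indicator measurableSet_Ico)
    _ ≤ ∫⁻ t, (Ico (1:ℝ) 2).indicator (fun _ => B) t := by
        refine (setLIntegral_le_lintegral _ _).trans (lintegral_mono fun t => ?_)
        by_cases hs : t ∈ Ico (1:ℝ) 2
        · rw [indicator_of_mem hs]
          refine mul_le_of_le_one_left' ?_
          rw [ENNReal.ofReal_le_one]
          exact inv_le_one_of_one_le₀ hs.1
        · simp [indicator_of_notMem hs]
    _ = B := by
        rw [lintegral_indicator measurableSet_Ico, setLIntegral_const, Real.volume_Ico]; norm_num

section
variable {ψ : Rn n → ℝ} {μ : Measure (Rn n)} {η C : ℝ}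

/-- the L2 constant -/
def C2 (n : ℕ) (μ : Measure (Rn n)) (η C : ℝ) : ℝ≥0∞ :=
  μ univ * ENNReal.ofReal (C * C * (Kg n (η/2)).toReal * Sb (η/2))

theorem C2_ne_top [IsFiniteMeasure μ] : C2 n μ η C ≠ ⊤ := by
  unfold C2; finiteness

theorem Tf_L2 [IsFiniteMeasure μ] (H : KD ψ μ η C) {g : Rn n → ℝ} (hg : Bd g) :
    ∫⁻ x, Tf ψ μ g x ^ 2 ≤ C2 n μ η C * ∫⁻ x, ‖g x‖ₑ ^ 2 := by
  have hcm := cvl_meas H.meas hg.meas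
  have hm3 : Measurable (fun q : Rn n × (Rn n × ℝ) => ‖cvl ψ q.2.2 g (q.1 + q.2.2 • q.2.1)‖ₑ ^ 2) :=
    ((hcm.comp (g := fun q : Rn n × ℝ => cvl ψ q.2 g q.1)
      (f := fun q : Rn n × (Rn n × ℝ) => (q.1 + q.2.2 • q.2.1, q.2.2)) (by fun_prop)).enorm).pow_const 2
  have hm2 : Measurable (fun q : ℝ × Rn n => ‖cvl ψ q.1 g q.2‖ₑ ^ 2) :=
    ((hcm.comp (g := fun q : Rn n × ℝ => cvl ψ q.2 g q.1)
      (f := fun q : ℝ × Rn n => (q.2, q.1)) (by fun_prop)).enorm).pow_const 2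
  have hFm : Measurable (fun t : ℝ => ∫⁻ w, ‖cvl ψ t g w‖ₑ ^ 2) := hm2.lintegral_prod_right'
  unfold Tf
  simp only [L2n_sq]
  rw [lintegral_lintegral_swap hm3.aemeasurable]
  have e : ∀ q : Rn n × ℝ, ∫⁻ x, ‖cvl ψ q.2 g (x + q.2 • q.1)‖ₑ ^ 2 = ∫⁻ x, ‖cvl ψ q.2 g x‖ₑ ^ 2 := by
    intro q
    exact lintegral_add_right_eq_self (fun x => ‖cvl ψ q.2 g x‖ₑ ^ 2) (q.2 • q.1)
  simp only [e]
  rw [lintegral_prod _ (by exact (hFm.comp measurable_snd).aemeasurable)]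
  simp only
  rw [lintegral_const, mul_comm, C2, mul_assoc]
  refine mul_le_mul_right ?_ _
  exact tau_dyad hFm fun s hs => dyad_sum H hg hs

end

end PartH

section PartI

theorem kap_le_tf {η : ℝ} (hn : 1 ≤ n) (hη : 0 < η) (hη1 : η ≤ 1/4) {t s : ℝ} (ht : 0 < t) (hs : 0 < s) :
    kap n η t s ≤ s ^ (-(n:ℝ)) * tf η s t := by
  have hn' : (1:ℝ) ≤ n := by exact_mod_cast hn
  unfold kap tf
  rcases le_total t s with h | h
  · have hmin : min (t / s) (s / t) = t / s := by
      apply min_eq_left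
      calc t / s ≤ 1 := by rwa [div_le_one hs]
        _ ≤ s / t := by rwa [one_le_div ht]
    rw [hmin, Real.div_rpow ht.le hs.le]
    have h1 : (t + s) ^ (-((n:ℝ) + η)) ≤ s ^ (-((n:ℝ) + η)) :=
      Real.rpow_le_rpow_of_nonpos hs (by linarith) (by linarith)
    calc t ^ η * (t + s) ^ (-((n:ℝ) + η)) ≤ t ^ η * s ^ (-((n:ℝ) + η)) := by gcongr
      _ = _ := by
        rw [show -((n:ℝ) + η) = -(n:ℝ) + -η by ring, Real.rpow_add hs, Real.rpow_neg hs.le η]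
        field_simp
  · have hmin : min (t / s) (s / t) = s / t := by
      apply min_eq_right
      calc s / t ≤ 1 := by rwa [div_le_one ht]
        _ ≤ t / s := by rwa [one_le_div hs]
    rw [hmin]
    have h1 : (t + s) ^ (-((n:ℝ) + η)) ≤ t ^ (-((n:ℝ) + η)) :=
      Real.rpow_le_rpow_of_nonpos ht (by linarith) (by linarith)
    calc t ^ η * (t + s) ^ (-((n:ℝ) + η)) ≤ t ^ η * t ^ (-((n:ℝ) + η)) := by gcongr
      _ = s ^ (-(n:ℝ)) * (s / t) ^ (n:ℝ) := by
        rw [← Real.rpow_add ht, Real.div_rpow hs.le ht.le, Real.rpow_neg hs.le]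
        have : (s:ℝ) ^ (n:ℝ) ≠ 0 := by positivity
        rw [show η + -((n:ℝ) + η) = -(n:ℝ) by ring, Real.rpow_neg ht.le]
        field_simp
      _ ≤ _ := by
        gcongr s ^ (-(n:ℝ)) * ?_
        exact Real.rpow_le_rpow_of_exponent_ge (by positivity) (by rwa [div_le_one ht]) (by linarith)

section
variable {ψ : Rn n → ℝ} {μ : Measure (Rn n)} {η C : ℝ}

theorem bad_pt [SFinite μ] (H : KD ψ μ η C) {x y c : Rn n} {h : ℝ} (hh : 0 < h) (hy : ‖y - c‖ ≤ n * h)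
    (hx : 8 * n * h ≤ ‖x - c‖) :
    L2n (μ.prod tau) (fun q => ‖kt ψ q.2 (x + q.2 • q.1 - y) - kt ψ q.2 (x + q.2 • q.1 - c)‖ₑ) ≤
      ENNReal.ofReal (C * 2 ^ n * kap n (2 * η) h ‖x - c‖) * Ct η := by
  have hm := H.meas
  have hη := H.hη
  have hC := H.hC
  have hn' : (1:ℝ) ≤ n := by exact_mod_cast H.n1
  set s := ‖x - c‖ with hs
  have hsh : h ≤ s := by nlinarith
  have hs0 : 0 < s := hh.trans_le hsh
  apply L2z hη hs0 (by unfold kt; fun_prop)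
  intro t ht
  have h1 := ker_E H ht hh (x - c) (x - y) (by
    rw [show x - c - (x - y) = y - c by abel]; nlinarith [hy]) (Or.inr hx)
  calc ∫⁻ z, ‖kt ψ t (x + t • z - y) - kt ψ t (x + t • z - c)‖ₑ ^ 2 ∂μ
      = ∫⁻ z, ‖(t ^ n)⁻¹ * ψ (t⁻¹ • (x - c + t • z)) - (t ^ n)⁻¹ * ψ (t⁻¹ • (x - y + t • z))‖ₑ ^ 2 ∂μ := by
        congr 1; funext z
        unfold kt
        rw [show x + t • z - y = x - y + t • z by abel, show x + t • z - c = x - c + t • z by abel,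
          ← enorm_neg, neg_sub]
    _ ≤ _ := h1
    _ ≤ _ := by
        have htf := tf_nonneg (η := η) hs0 ht
        have hkap := kap_nonneg (n := n) (ε := 2 * η) hh hs0.le
        rw [← ENNReal.ofReal_mul (by positivity)]
        gcongr ENNReal.ofReal ?_ ^ 2
        rw [← hs]
        have e2 : (h / (h + s)) ^ (2 * η) * s ^ (-(n:ℝ)) ≤ 2 ^ n * kap n (2 * η) h s := by
          unfold kap
          have e3 : s ^ (-(n:ℝ)) ≤ 2 ^ n * (h + s) ^ (-(n:ℝ)) := by
            have : (s:ℝ) ^ (-(n:ℝ)) ≤ ((h + s) / 2) ^ (-(n:ℝ)) :=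
              Real.rpow_le_rpow_of_nonpos (by positivity) (by linarith) (by linarith)
            refine this.trans (le_of_eq ?_)
            rw [Real.div_rpow (by positivity) (by norm_num), Real.rpow_neg (by norm_num : (0:ℝ) ≤ 2),
              Real.rpow_natCast]
            field_simp
          rw [Real.div_rpow hh.le (by positivity), show -((n:ℝ) + 2 * η) = -(n:ℝ) + -(2 * η) by ring,
            Real.rpow_add (by positivity), Real.rpow_neg (by positivity) (2 * η)]
          calc h ^ (2 * η) / (h + s) ^ (2 * η) * s ^ (-(n:ℝ))
              ≤ h ^ (2 * η) / (h + s) ^ (2 * η) * (2 ^ n * (h + s) ^ (-(n:ℝ))) := by gcongr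
            _ = _ := by field_simp
        calc C * ((h / (h + s)) ^ (2 * η) * kap n η t s)
            ≤ C * ((h / (h + s)) ^ (2 * η) * (s ^ (-(n:ℝ)) * tf η s t)) := by
              gcongr; exact kap_le_tf H.n1 hη H.hη1 ht hs0
          _ = C * ((h / (h + s)) ^ (2 * η) * s ^ (-(n:ℝ))) * tf η s t := by ring
          _ ≤ C * (2 ^ n * kap n (2 * η) h s) * tf η s t := by gcongr
          _ = _ := by ring

theorem kt_bd (H : KD ψ μ η C) {t : ℝ} (ht : 0 < t) : ∀ v, ‖kt ψ t v‖ ≤ (t ^ n)⁻¹ * C := by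
  intro v
  have hη := H.hη
  have h1 := H.size (t⁻¹ • v)
  have h2 : (1 + ‖t⁻¹ • v‖) ^ (-((n:ℝ) + η)) ≤ 1 :=
    Real.rpow_le_one_of_one_le_of_nonpos (by linarith [norm_nonneg (t⁻¹ • v)]) (by
      have : (0:ℝ) ≤ n := Nat.cast_nonneg n
      linarith)
  unfold kt
  rw [norm_mul, Real.norm_of_nonneg (by positivity), Real.norm_eq_abs]
  have := H.hC
  gcongr
  nlinarith

theorem kt_mul_int (H : KD ψ μ η C) {t : ℝ} (ht : 0 < t) {b : Rn n → ℝ} (hb : Integrable b volume)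
    {φ : Rn n → Rn n} (hφ : Measurable φ) : Integrable (fun y => kt ψ t (φ y) * b y) volume :=
  hb.bdd_mul (((kt_meas H t).comp hφ).aestronglyMeasurable) (Filter.Eventually.of_forall fun y => kt_bd H ht (φ y))

theorem bad_cvl (H : KD ψ μ η C) {ι : Type*} [Countable ι] {cc : ι → Rn n} {hs : ι → ℝ}
    (hdisj : Pairwise (fun i j => Disjoint (cube (cc i) (hs i)) (cube (cc j) (hs j))))
    {ctr : Rn n → Rn n} (hcm : Measurable ctr) (hctr : ∀ i, ∀ y ∈ cube (cc i) (hs i), ctr y = cc i)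
    {b : Rn n → ℝ} (hb : Integrable b volume)
    (hb0 : ∀ᵐ y ∂(volume : Measure (Rn n)), y ∉ ⋃ i, cube (cc i) (hs i) → b y = 0)
    (hbi : ∀ i, ∫ y in cube (cc i) (hs i), b y = 0) {t : ℝ} (ht : 0 < t) (w : Rn n) :
    ‖cvl ψ t b w‖ₑ ≤ ∫⁻ y, ‖kt ψ t (w - y) - kt ψ t (w - ctr y)‖ₑ * ‖b y‖ₑ := by
  have i1 := kt_mul_int H ht hb (φ := fun y => w - y) (by fun_prop)
  have i2 := kt_mul_int H ht hb (φ := fun y => w - ctr y) (by fun_prop)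
  have hU : MeasurableSet (⋃ i, cube (cc i) (hs i)) := MeasurableSet.iUnion fun i => measurableSet_cube _ _
  have z : ∫ y, kt ψ t (w - ctr y) * b y = 0 := by
    rw [← setIntegral_eq_integral_of_ae_compl_eq_zero (s := ⋃ i, cube (cc i) (hs i))]
    · rw [integral_iUnion (fun i => measurableSet_cube _ _) hdisj i2.integrableOn]
      have : ∀ i, ∫ y in cube (cc i) (hs i), kt ψ t (w - ctr y) * b y = 0 := by
        intro i
        rw [setIntegral_congr_fun (g := fun y => kt ψ t (w - cc i) * b y) (measurableSet_cube _ _)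
          (fun y hy => by simp only [hctr i y hy]), integral_const_mul, hbi i, mul_zero]
      simp only [this, tsum_zero]
    · filter_upwards [hb0] with y hy hyU
      rw [hy hyU, mul_zero]
  have e : cvl ψ t b w = ∫ y, (kt ψ t (w - y) - kt ψ t (w - ctr y)) * b y := by
    simp only [sub_mul]
    rw [integral_sub i1 i2, z, sub_zero]; rfl
  rw [e]
  refine (enorm_integral_le_lintegral_enorm _).trans (le_of_eq ?_)
  simp only [enorm_mul]

/-- constant for the bad part -/
def Cb (n : ℕ) (η C : ℝ) : ℝ≥0∞ := ENNReal.ofReal (C * 2 ^ n) * Ct η * Kg n (2 * η)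

theorem Cb_ne_top (hη : 0 < η) : Cb n η C ≠ ⊤ := by
  have := Ct_ne_top η
  have := Kg_ne_top n (show 0 < 2 * η by linarith)
  unfold Cb; finiteness

theorem bad_int [SFinite μ] (H : KD ψ μ η C) {ι : Type*} [Countable ι] {cc : ι → Rn n} {hs : ι → ℝ}
    (hpos : ∀ i, 0 < hs i)
    (hdisj : Pairwise (fun i j => Disjoint (cube (cc i) (hs i)) (cube (cc j) (hs j))))
    {ctr : Rn n → Rn n} (hcm : Measurable ctr) (hctr : ∀ i, ∀ y ∈ cube (cc i) (hs i), ctr y = cc i)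
    {hgt : Rn n → ℝ} (hgm : Measurable hgt) (hhgt : ∀ i, ∀ y ∈ cube (cc i) (hs i), hgt y = hs i)
    {b : Rn n → ℝ} (hbm : Measurable b) (hb : Integrable b volume)
    (hb0 : ∀ᵐ y ∂(volume : Measure (Rn n)), y ∉ ⋃ i, cube (cc i) (hs i) → b y = 0)
    (hbi : ∀ i, ∫ y in cube (cc i) (hs i), b y = 0) :
    ∫⁻ x in (⋃ i, cube (cc i) (8 * n * hs i))ᶜ, Tf ψ μ b x ≤ Cb n η C * ∫⁻ y, ‖b y‖ₑ := by
  have hm := H.meas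
  have hη := H.hη
  have hC := H.hC
  have hUs : MeasurableSet (⋃ i, cube (cc i) (8 * n * hs i)) := MeasurableSet.iUnion fun i => measurableSet_cube _ _
  have step : ∀ x ∈ (⋃ i, cube (cc i) (8 * n * hs i))ᶜ, Tf ψ μ b x ≤
      ∫⁻ y, ENNReal.ofReal (C * 2 ^ n) * ENNReal.ofReal (kap n (2 * η) (hgt y) ‖x - ctr y‖) * Ct η * ‖b y‖ₑ := by
    intro x hx
    have m1 : Measurable (Function.uncurry fun (q : Rn n × ℝ) (y : Rn n) =>
        ‖kt ψ q.2 (x + q.2 • q.1 - y) - kt ψ q.2 (x + q.2 • q.1 - ctr y)‖ₑ * ‖b y‖ₑ) := by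
      simp only [Function.uncurry_def]; unfold kt; fun_prop
    calc Tf ψ μ b x ≤ L2n (μ.prod tau) (fun q => ∫⁻ y, ‖kt ψ q.2 (x + q.2 • q.1 - y) -
          kt ψ q.2 (x + q.2 • q.1 - ctr y)‖ₑ * ‖b y‖ₑ) := by
          unfold Tf
          refine L2n_mono ?_
          refine ae_prod_tau _ fun z t ht => ?_
          exact bad_cvl H hdisj hcm hctr hb hb0 hbi ht _
      _ ≤ ∫⁻ y, L2n (μ.prod tau) (fun q => ‖kt ψ q.2 (x + q.2 • q.1 - y) -
          kt ψ q.2 (x + q.2 • q.1 - ctr y)‖ₑ * ‖b y‖ₑ) := minkowski m1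
      _ ≤ _ := by
          refine lintegral_mono_ae ?_
          filter_upwards [hb0] with y hy
          by_cases hyU : y ∈ ⋃ i, cube (cc i) (hs i)
          · obtain ⟨i, hi⟩ := mem_iUnion.mp hyU
            have m2 : Measurable (fun q : Rn n × ℝ => ‖kt ψ q.2 (x + q.2 • q.1 - y) -
              kt ψ q.2 (x + q.2 • q.1 - ctr y)‖ₑ) := by unfold kt; fun_prop
            simp only [mul_comm _ ‖b y‖ₑ]
            rw [L2n_const_mul m2]
            refine mul_le_mul_right ?_ _
            rw [← ENNReal.ofReal_mul (by positivity), hctr i y hi, hhgt i y hi]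
            refine bad_pt H (hpos i) (cube_subset_ball _ hi (hpos i)) ?_
            apply norm_ge_of_not_mem_cube
            intro hxi
            exact hx (mem_iUnion.mpr ⟨i, hxi⟩)
          · simp only [hy hyU, enorm_zero, mul_zero]
            unfold L2n; simp
  have mk : Measurable (fun q : Rn n × Rn n => kap n (2 * η) (hgt q.2) ‖q.1 - ctr q.2‖) := by
    unfold kap; fun_prop
  calc ∫⁻ x in (⋃ i, cube (cc i) (8 * n * hs i))ᶜ, Tf ψ μ b x
      ≤ ∫⁻ x in (⋃ i, cube (cc i) (8 * n * hs i))ᶜ, ∫⁻ y, ENNReal.ofReal (C * 2 ^ n) *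
          ENNReal.ofReal (kap n (2 * η) (hgt y) ‖x - ctr y‖) * Ct η * ‖b y‖ₑ :=
        setLIntegral_mono' hUs.compl step
    _ ≤ ∫⁻ x, ∫⁻ y, ENNReal.ofReal (C * 2 ^ n) *
          ENNReal.ofReal (kap n (2 * η) (hgt y) ‖x - ctr y‖) * Ct η * ‖b y‖ₑ := setLIntegral_le_lintegral _ _
    _ = ∫⁻ y, ∫⁻ x, ENNReal.ofReal (C * 2 ^ n) *
          ENNReal.ofReal (kap n (2 * η) (hgt y) ‖x - ctr y‖) * Ct η * ‖b y‖ₑ := by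
        apply lintegral_lintegral_swap
        apply Measurable.aemeasurable
        simp only [Function.uncurry_def]
        exact ((measurable_const.mul mk.ennreal_ofReal).mul measurable_const).mul (by fun_prop)
    _ ≤ ∫⁻ y, Cb n η C * ‖b y‖ₑ := by
        refine lintegral_mono_ae ?_
        filter_upwards [hb0] with y hy
        by_cases hyU : y ∈ ⋃ i, cube (cc i) (hs i)
        · obtain ⟨i, hi⟩ := mem_iUnion.mp hyU
          have mk' : Measurable (fun x : Rn n => ENNReal.ofReal (kap n (2 * η) (hgt y) ‖x - ctr y‖)) :=
            (kap_meas.comp (by fun_prop)).ennreal_ofReal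
          rw [lintegral_mul_const _ (by fun_prop), lintegral_mul_const _ (by fun_prop),
            lintegral_const_mul _ mk']
          refine mul_le_mul_left ?_ _
          unfold Cb
          rw [mul_right_comm]
          refine mul_le_mul_right ?_ _
          exact kap_int (by linarith) _ (by rw [hhgt i y hi]; exact hpos i)
        · simp [hy hyU]
    _ = _ := lintegral_const_mul _ (by fun_prop)

end
end PartI

section PartJ

theorem avg_enorm_mul {f : Rn n → ℝ} {c : Rn n} {h : ℝ} (hh : 0 < h) :
    ‖avg f (cube c h)‖ₑ * volume (cube c h) ≤ ∫⁻ x in cube c h, ‖f x‖ₑ := by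
  have h0 := volume_cube_ne_zero c hh
  have ht := volume_cube_ne_top c hh
  unfold avg
  have e : ‖((volume (cube c h)).toReal)⁻¹‖ₑ = (volume (cube c h))⁻¹ := by
    rw [Real.enorm_eq_ofReal (by positivity), ENNReal.ofReal_inv_of_pos (ENNReal.toReal_pos h0 ht),
      ENNReal.ofReal_toReal ht]
  rw [enorm_mul, e]
  calc (volume (cube c h))⁻¹ * ‖∫ x in cube c h, f x‖ₑ * volume (cube c h)
      = ‖∫ x in cube c h, f x‖ₑ * ((volume (cube c h))⁻¹ * volume (cube c h)) := by ring
    _ = ‖∫ x in cube c h, f x‖ₑ := by rw [ENNReal.inv_mul_cancel h0 ht, mul_one]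
    _ ≤ _ := enorm_integral_le_lintegral_enorm _

section
variable {ψ : Rn n → ℝ} {μ : Measure (Rn n)} {η C : ℝ}

/-- weak type constant -/
def Cwk (n : ℕ) (μ : Measure (Rn n)) (η C : ℝ) : ℝ≥0∞ :=
  4 * C2 n μ η C * 2 ^ n + (ENNReal.ofReal ((8 * n) ^ n) + 4 * Cb n η C)

theorem Cwk_ne_top [IsFiniteMeasure μ] (hη : 0 < η) : Cwk n μ η C ≠ ⊤ := by
  have := Cb_ne_top (n := n) (C := C) hη
  have := C2_ne_top (n := n) (μ := μ) (η := η) (C := C)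
  unfold Cwk; finiteness

theorem Tf_add_le [SFinite μ] (H : KD ψ μ η C) {f g b : Rn n → ℝ} (hgm : Measurable g) (hbm : Measurable b)
    (hg : Integrable g volume) (hb : Integrable b volume) (hf : ∀ x, f x = g x + b x) (x : Rn n) :
    Tf ψ μ f x ≤ Tf ψ μ g x + Tf ψ μ b x := by
  unfold Tf
  refine le_trans (L2n_mono ?_) (L2n_add (F_meas H.meas hgm x).enorm.aemeasurable
    (F_meas H.meas hbm x).enorm.aemeasurable)
  refine ae_prod_tau _ fun z t ht => ?_
  have e : cvl ψ t f (x + t • z) = cvl ψ t g (x + t • z) + cvl ψ t b (x + t • z) := by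
    have i1 := kt_mul_int H ht hg (φ := fun y => x + t • z - y) (by fun_prop)
    have i2 := kt_mul_int H ht hb (φ := fun y => x + t • z - y) (by fun_prop)
    unfold cvl
    simp only [hf, mul_add]
    exact integral_add i1 i2
  simp only [e]
  exact enorm_add_le _ _

theorem weak_type [IsFiniteMeasure μ] (H : KD ψ μ η C) {f : Rn n → ℝ} (hf : Measurable f) {c : Rn n} {ρ : ℝ}
    (hρ : 0 < ρ) (hsupp : ∀ x, x ∉ cube c ρ → f x = 0) (hI : ∫⁻ x, ‖f x‖ₑ ≠ ⊤) {lam : ℝ≥0∞}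
    (hl0 : lam ≠ 0) (hlt : lam ≠ ⊤) (hav : ∫⁻ x, ‖f x‖ₑ ≤ lam * volume (cube c ρ)) :
    volume {x | lam < Tf ψ μ f x} ≤ Cwk n μ η C * ((∫⁻ x, ‖f x‖ₑ) / lam) := by
  set I := ∫⁻ x, ‖f x‖ₑ with hIdef
  have hn' : (1:ℝ) ≤ n := by exact_mod_cast H.n1
  have hfI : Integrable f volume := ⟨hf.aestronglyMeasurable, lt_top_iff_ne_top.mpr hI⟩
  have hIle : ∀ s : Set (Rn n), ∫⁻ x in s, ‖f x‖ₑ ≤ I := fun s => setLIntegral_le_lintegral _ _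
  obtain ⟨S, hSc, hS, hSd, hSae⟩ := cz_cubes c hρ hf.enorm lam (ne_top_of_le_ne_top hI (hIle _))
    ((hIle _).trans hav)
  have : Countable S := hSc.to_subtype
  set cc : S → Rn n := fun q => q.1.1 with hcc
  set hs : S → ℝ := fun q => q.1.2 with hhs
  have hpos : ∀ i, 0 < hs i := fun i => (hS i.1 i.2).1
  have hdisj : Pairwise (fun i j => Disjoint (cube (cc i) (hs i)) (cube (cc j) (hs j))) := by
    intro i j hij
    exact hSd i.2 j.2 (fun h => hij (Subtype.ext h))
  set Om : Set (Rn n) := ⋃ i, cube (cc i) (hs i) with hOm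
  have hOmm : MeasurableSet Om := MeasurableSet.iUnion fun i => measurableSet_cube _ _
  have hae : ∀ᵐ x ∂(volume : Measure (Rn n)), x ∉ Om → ‖f x‖ₑ ≤ lam := by
    filter_upwards [hSae] with x hx hxO
    by_cases hxc : x ∈ cube c ρ
    · refine hx hxc ?_
      intro h
      simp only [mem_iUnion] at h
      obtain ⟨q, hq, hxq⟩ := h
      exact hxO (mem_iUnion.mpr ⟨⟨q, hq⟩, hxq⟩)
    · rw [hsupp x hxc]; simp
  -- pieces
  set P : Option S → Set (Rn n) := fun o => o.elim Omᶜ (fun i => cube (cc i) (hs i)) with hP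
  have hPm : ∀ o, MeasurableSet (P o) := by
    rintro (_ | i)
    · exact hOmm.compl
    · exact measurableSet_cube _ _
  have hPd : ∀ o o', o ≠ o' → P o ∩ P o' = ∅ := by
    rintro (_ | i) (_ | j) hne
    · exact absurd rfl hne
    · ext x; simp only [hP, Option.elim, mem_inter_iff, mem_empty_iff_false, iff_false, not_and]
      intro hx hx'; exact hx (mem_iUnion.mpr ⟨j, hx'⟩)
    · ext x; simp only [hP, Option.elim, mem_inter_iff, mem_empty_iff_false, iff_false, not_and]
      intro hx' hx; exact hx (mem_iUnion.mpr ⟨i, hx'⟩)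
    · have : i ≠ j := fun h => hne (by rw [h])
      exact disjoint_iff_inter_eq_empty.mp (hdisj this)
  obtain ⟨ctr, hcm, hctr'⟩ := exists_measurable_piecewise P hPm
    (fun o _ => o.elim (0 : Rn n) cc) (fun o => measurable_const)
    (fun o o' hne x hx => absurd hx (by rw [hPd o o' hne]; exact notMem_empty x))
  obtain ⟨hgt, hgtm, hgt'⟩ := exists_measurable_piecewise P hPm
    (fun o _ => o.elim (0 : ℝ) hs) (fun o => measurable_const)
    (fun o o' hne x hx => absurd hx (by rw [hPd o o' hne]; exact notMem_empty x))
  have hT : MeasurableSet {x | ‖f x‖ₑ ≤ lam} := measurableSet_le hf.enorm measurable_const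
  obtain ⟨g, hgm, hg'⟩ := exists_measurable_piecewise P hPm
    (fun o => o.elim ({x | ‖f x‖ₑ ≤ lam}.indicator f) (fun i _ => avg f (cube (cc i) (hs i))))
    (by
      rintro (_ | i)
      · exact hf.indicator hT
      · exact measurable_const)
    (fun o o' hne x hx => absurd hx (by rw [hPd o o' hne]; exact notMem_empty x))
  have hctr : ∀ i, ∀ y ∈ cube (cc i) (hs i), ctr y = cc i := fun i y hy => hctr' (some i) hy
  have hhgt : ∀ i, ∀ y ∈ cube (cc i) (hs i), hgt y = hs i := fun i y hy => hgt' (some i) hy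
  have hgQ : ∀ i, ∀ y ∈ cube (cc i) (hs i), g y = avg f (cube (cc i) (hs i)) := fun i y hy => hg' (some i) hy
  have hgO : ∀ y, y ∉ Om → g y = {x | ‖f x‖ₑ ≤ lam}.indicator f y := fun y hy => hg' none hy
  -- bounds on g
  have hgb : ∀ x, ‖g x‖ₑ ≤ 2 ^ n * lam := by
    intro x
    by_cases hx : x ∈ Om
    · obtain ⟨i, hi⟩ := mem_iUnion.mp hx
      rw [hgQ i x hi]
      have h1 := (avg_enorm_mul (f := f) (c := cc i) (hpos i)).trans (hS i.1 i.2).2.2.2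
      exact (ENNReal.mul_le_mul_iff_left (volume_cube_ne_zero _ (hpos i)) (volume_cube_ne_top _ (hpos i))).mp h1
    · rw [hgO x hx]
      have h2 : (1:ℝ≥0∞) ≤ 2 ^ n := one_le_pow₀ (by norm_num)
      by_cases hx' : ‖f x‖ₑ ≤ lam
      · rw [indicator_of_mem (by exact hx')]
        exact hx'.trans (le_mul_of_one_le_left' h2)
      · rw [indicator_of_notMem (by exact hx')]; simp
  have hgI : ∫⁻ x, ‖g x‖ₑ ≤ I := by
    rw [hIdef, ← lintegral_add_compl _ hOmm, ← lintegral_add_compl (fun x => ‖f x‖ₑ) hOmm]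
    refine add_le_add ?_ ?_
    · rw [hOm, lintegral_iUnion (fun i => measurableSet_cube _ _) hdisj,
        lintegral_iUnion (fun i => measurableSet_cube _ _) hdisj]
      refine ENNReal.tsum_le_tsum fun i => ?_
      rw [setLIntegral_congr_fun (g := fun _ => ‖avg f (cube (cc i) (hs i))‖ₑ) (measurableSet_cube _ _)
        (fun y hy => by simp only [hgQ i y hy]), setLIntegral_const]
      exact avg_enorm_mul (hpos i)
    · refine setLIntegral_mono' hOmm.compl fun x hx => ?_
      rw [hgO x hx]
      by_cases hx' : ‖f x‖ₑ ≤ lam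
      · rw [indicator_of_mem (by exact hx')]
      · rw [indicator_of_notMem (by exact hx')]; simp
  have hgi : Integrable g volume := ⟨hgm.aestronglyMeasurable, hgI.trans_lt (lt_top_iff_ne_top.mpr hI)⟩
  have hgBd : Bd g := by
    refine ⟨hgm, hgi, ⟨(2 ^ n * lam).toReal, fun x => ?_⟩⟩
    have := ENNReal.toReal_mono (ENNReal.mul_ne_top (by simp) hlt) (hgb x)
    simpa using this
  have hg2 : ∫⁻ x, ‖g x‖ₑ ^ 2 ≤ 2 ^ n * lam * I := by
    calc ∫⁻ x, ‖g x‖ₑ ^ 2 ≤ ∫⁻ x, 2 ^ n * lam * ‖g x‖ₑ := by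
          refine lintegral_mono fun x => ?_
          rw [sq]; exact mul_le_mul_left (hgb x) _
      _ = 2 ^ n * lam * ∫⁻ x, ‖g x‖ₑ := lintegral_const_mul _ hgm.enorm
      _ ≤ _ := mul_le_mul_right hgI _
  -- bad part
  set b : Rn n → ℝ := fun x => f x - g x with hb
  have hbm : Measurable b := hf.sub hgm
  have hbi : Integrable b volume := hfI.sub hgi
  have hbI : ∫⁻ x, ‖b x‖ₑ ≤ 2 * I := by
    calc ∫⁻ x, ‖b x‖ₑ ≤ ∫⁻ x, ‖f x‖ₑ + ‖g x‖ₑ := lintegral_mono fun x => enorm_sub_le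
      _ = I + ∫⁻ x, ‖g x‖ₑ := lintegral_add_left hf.enorm _
      _ ≤ I + I := by gcongr
      _ = _ := (two_mul _).symm
  have hb0 : ∀ᵐ y ∂(volume : Measure (Rn n)), y ∉ ⋃ i, cube (cc i) (hs i) → b y = 0 := by
    filter_upwards [hae] with x hx hxO
    simp only [hb, hgO x hxO]
    rw [indicator_of_mem (by exact hx hxO), sub_self]
  have hbz : ∀ i, ∫ y in cube (cc i) (hs i), b y = 0 := by
    intro i
    simp only [hb]
    rw [integral_sub hfI.integrableOn hgi.integrableOn,
      setIntegral_congr_fun (g := fun _ => avg f (cube (cc i) (hs i))) (measurableSet_cube _ _)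
        (fun y hy => hgQ i y hy), setIntegral_const]
    unfold avg
    have : (volume (cube (cc i) (hs i))).toReal ≠ 0 :=
      (ENNReal.toReal_pos (volume_cube_ne_zero _ (hpos i)) (volume_cube_ne_top _ (hpos i))).ne'
    rw [smul_eq_mul, measureReal_def, ← mul_assoc, mul_inv_cancel₀ this, one_mul, sub_self]
  have hbad := bad_int H hpos hdisj hcm hctr hgtm hhgt hbm hbi hb0 hbz
  set Os : Set (Rn n) := ⋃ i, cube (cc i) (8 * n * hs i) with hOs
  have hOsm : MeasurableSet Os := MeasurableSet.iUnion fun i => measurableSet_cube _ _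
  -- measure of the exceptional set
  have hOsv : volume Os ≤ ENNReal.ofReal ((8 * n) ^ n) * (I / lam) := by
    calc volume Os ≤ ∑' i, volume (cube (cc i) (8 * n * hs i)) := measure_iUnion_le _
      _ = ∑' i, ENNReal.ofReal ((8 * n) ^ n) * volume (cube (cc i) (hs i)) := by
          congr 1; funext i
          exact volume_cube_mul (cc i) (cc i) (hpos i) (by positivity)
      _ = ENNReal.ofReal ((8 * n) ^ n) * ∑' i, volume (cube (cc i) (hs i)) := ENNReal.tsum_mul_left
      _ ≤ _ := by
          refine mul_le_mul_right ?_ _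
          rw [ENNReal.le_div_iff_mul_le (Or.inl hl0) (Or.inl hlt), mul_comm, ← ENNReal.tsum_mul_left]
          calc ∑' i, lam * volume (cube (cc i) (hs i)) ≤ ∑' i, ∫⁻ x in cube (cc i) (hs i), ‖f x‖ₑ :=
                ENNReal.tsum_le_tsum fun i => (hS i.1 i.2).2.2.1.le
            _ = ∫⁻ x in Om, ‖f x‖ₑ := (lintegral_iUnion (fun i => measurableSet_cube _ _) hdisj _).symm
            _ ≤ I := hIle _
  have hTg : Measurable (Tf ψ μ g) := Tf_meas H.meas hgm
  have hTb : Measurable (Tf ψ μ b) := Tf_meas H.meas hbm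
  have hl2 : lam / 2 ≠ 0 := (ENNReal.div_pos hl0 (by norm_num)).ne'
  have hl2t : lam / 2 ≠ ⊤ := ENNReal.div_ne_top hlt (by norm_num)
  have hG : volume {x | lam / 2 ≤ Tf ψ μ g x} ≤ 4 * C2 n μ η C * 2 ^ n * (I / lam) := by
    have h1 : volume {x | (lam / 2) ^ 2 ≤ Tf ψ μ g x ^ 2} ≤ (∫⁻ x, Tf ψ μ g x ^ 2) / (lam / 2) ^ 2 :=
      meas_ge_le_lintegral_div (hTg.pow_const 2).aemeasurable (by positivity) (by finiteness)
    refine (measure_mono ?_).trans (h1.trans ?_)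
    · intro x hx
      have hx' : lam / 2 ≤ Tf ψ μ g x := hx
      exact pow_le_pow_left' hx' 2
    · rw [ENNReal.div_le_iff_le_mul (Or.inl (by positivity)) (Or.inl (by finiteness))]
      refine (Tf_L2 H hgBd).trans ((mul_le_mul_right hg2 _).trans (le_of_eq ?_))
      have e : (lam / 2) ^ 2 * 4 = lam * lam := by
        rw [div_eq_mul_inv, mul_pow, mul_assoc, ← ENNReal.inv_pow, show (2:ℝ≥0∞) ^ 2 = 4 by norm_num,
          ENNReal.inv_mul_cancel (by norm_num) (by norm_num), mul_one, sq]
      calc C2 n μ η C * (2 ^ n * lam * I) = C2 n μ η C * 2 ^ n * lam * (I / lam * lam) := by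
            rw [ENNReal.div_mul_cancel hl0 hlt]; ring
        _ = C2 n μ η C * 2 ^ n * (I / lam) * (lam * lam) := by ring
        _ = _ := by rw [← e]; ring
  have hB : volume {x | x ∉ Os ∧ lam / 2 ≤ Tf ψ μ b x} ≤ 4 * Cb n η C * (I / lam) := by
    have h1 : (volume.restrict Osᶜ) {x | lam / 2 ≤ Tf ψ μ b x} ≤ (∫⁻ x in Osᶜ, Tf ψ μ b x) / (lam / 2) :=
      meas_ge_le_lintegral_div hTb.aemeasurable hl2 hl2t
    rw [Measure.restrict_apply (measurableSet_le measurable_const hTb)] at h1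
    refine (measure_mono ?_).trans (h1.trans ?_)
    · intro x hx; exact ⟨hx.2, hx.1⟩
    · rw [ENNReal.div_le_iff_le_mul (Or.inl hl2) (Or.inl hl2t)]
      refine hbad.trans ((mul_le_mul_right hbI _).trans (le_of_eq ?_))
      have e : lam / 2 * 2 = lam := ENNReal.div_mul_cancel (by norm_num) (by norm_num)
      calc Cb n η C * (2 * I) = Cb n η C * 2 * (I / lam * lam) := by
            rw [ENNReal.div_mul_cancel hl0 hlt]; ring
        _ = Cb n η C * 2 * (I / lam * (lam / 2 * 2)) := by rw [e]
        _ = _ := by ring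
  calc volume {x | lam < Tf ψ μ f x}
      ≤ volume ({x | lam / 2 ≤ Tf ψ μ g x} ∪ (Os ∪ {x | x ∉ Os ∧ lam / 2 ≤ Tf ψ μ b x})) := by
        refine measure_mono fun x hx => ?_
        by_contra hne
        simp only [mem_union, mem_ofPred_eq, not_or, not_and, not_le] at hne
        have h1 := hne.1
        have h2 := hne.2.2 hne.2.1
        have h3 := Tf_add_le H hgm hbm hgi hbi (f := f) (fun x => by simp [hb]) x
        have h4 := h3.trans_lt (ENNReal.add_lt_add h1 h2)
        rw [ENNReal.add_halves] at h4
        exact absurd hx (not_lt.mpr h4.le)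
    _ ≤ _ := (measure_union_le _ _).trans (add_le_add hG ((measure_union_le _ _).trans (add_le_add hOsv hB)))
    _ = _ := by unfold Cwk; ring

end
end PartJ

section PartK
variable {ψ : Rn n → ℝ} {μ : Measure (Rn n)} {η C : ℝ}

def Lk (n : ℕ) (η : ℝ) : ℝ≥0∞ := ENNReal.ofReal ((1 + n * dil n) ^ ((n:ℝ) + η))

theorem dil_pos (n : ℕ) : 0 < dil n := by unfold dil; positivity

theorem dil_one (n : ℕ) : 1 ≤ dil n := by
  unfold dil
  have : (0:ℝ) ≤ n := by positivity
  linarith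

theorem Lk_ne_zero (n : ℕ) (η : ℝ) : Lk n η ≠ 0 := by
  unfold Lk
  have := dil_pos n
  have : 0 < (1 + n * dil n) ^ ((n:ℝ) + η) := by positivity
  simpa using this

theorem one_le_kap (hη : 0 < η) {c y : Rn n} {r : ℝ} (hr : 0 < r) (hy : y ∈ cube c (dil n * r)) :
    1 ≤ Lk n η * volume (cube c r) * ENNReal.ofReal (kap n η r ‖y - c‖) := by
  have hd := dil_pos n
  have h1 := cube_subset_ball c hy (by positivity)
  unfold Lk
  rw [volume_cube c hr, ← ENNReal.ofReal_mul (by positivity), ← ENNReal.ofReal_mul (by positivity),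
    ← ENNReal.ofReal_one]
  apply ENNReal.ofReal_le_ofReal
  rw [← kap_eq hr (norm_nonneg _)]
  have h2 : 1 + ‖y - c‖ / r ≤ 1 + n * dil n := by
    gcongr
    rw [div_le_iff₀ hr]; linarith
  have hq : (0:ℝ) < (n:ℝ) + η := by positivity
  have h3 : (1 + n * dil n) ^ (-((n:ℝ) + η)) ≤ (1 + ‖y - c‖ / r) ^ (-((n:ℝ) + η)) :=
    Real.rpow_le_rpow_of_nonpos (by positivity) h2 (by linarith)
  have h4 : (1 + n * dil n) ^ ((n:ℝ) + η) * (1 + n * dil n) ^ (-((n:ℝ) + η)) = 1 := by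
    rw [← Real.rpow_add (by positivity)]; simp
  have h5 : r ^ n ≤ (2 * r) ^ n := by gcongr; linarith
  calc (1:ℝ) = ((1 + n * dil n) ^ ((n:ℝ) + η) * (1 + n * dil n) ^ (-((n:ℝ) + η))) * (r ^ n * (r ^ n)⁻¹) := by
        rw [h4, mul_inv_cancel₀ (by positivity)]; norm_num
    _ = (1 + n * dil n) ^ ((n:ℝ) + η) * r ^ n * ((r ^ n)⁻¹ * (1 + n * dil n) ^ (-((n:ℝ) + η))) := by ring
    _ ≤ (1 + n * dil n) ^ ((n:ℝ) + η) * (2 * r) ^ n * ((r ^ n)⁻¹ * (1 + ‖y - c‖ / r) ^ (-((n:ℝ) + η))) := by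
        gcongr

/-- The main constant. -/
def CA (n : ℕ) (μ : Measure (Rn n)) (η C : ℝ) (Cw : ℝ≥0∞) : ℝ≥0∞ :=
  (2 ^ (n + 2) * (Cwk n μ η C + 1) * Lk n η + Cd μ η C) * ((Kg n η + 1) * Cw)

theorem CA_ne_top [IsFiniteMeasure μ] (hη : 0 < η) {Cw : ℝ≥0∞} (hw : Cw ≠ ⊤) : CA n μ η C Cw ≠ ⊤ := by
  have h1 := Cwk_ne_top (n := n) (μ := μ) (C := C) hη
  have h2 := Cd_ne_top (n := n) (μ := μ) (η := η) (C := C)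
  have h3 := Kg_ne_top n hη
  unfold CA Lk
  finiteness

theorem CA_ne_zero {Cw : ℝ≥0∞} (hw : Cw ≠ 0) : CA n μ η C Cw ≠ 0 := by
  have := Lk_ne_zero n η
  unfold CA
  simp [this, hw]

theorem hyp_main [IsFiniteMeasure μ] (H : KD ψ μ η C)
    {w : Rn n → ℝ≥0∞} {a : Rn n → ℝ → ℝ≥0∞} {Cw : ℝ≥0∞} (W : WData w a Cw)
    {f : Rn n → ℝ} (hfm : Measurable f) (hf : LocallyIntegrable f volume) {N : ℝ≥0∞} (hN0 : N ≠ 0)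
    (hNt : N ≠ ⊤)
    (hN : ∀ c h, 0 < h → ∫⁻ x in cube c h, ‖f x - avg f (cube c h)‖ₑ ≤ N * ∫⁻ x in cube c h, w x)
    (c : Rn n) (r : ℝ) (hr : 0 < r) :
    2 ^ (n + 2) * volume {x | x ∈ cube c r ∧ cInf (Tf ψ μ f) c r + CA n μ η C Cw * N * a c r < Tf ψ μ f x} ≤
      volume (cube c r) := by
  have hη := H.hη
  have hK := Cwk_ne_top (n := n) (μ := μ) (C := C) hη
  have hKg := Kg_ne_top n hη
  have hCd := Cd_ne_top (n := n) (μ := μ) (η := η) (C := C)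
  have hcw := W.cw
  have hcw0 : Cw ≠ 0 := (lt_of_lt_of_le one_pos W.cw1).ne'
  have ha0 := W.apos c r hr
  have hat := W.afin c r hr
  have hL0 := Lk_ne_zero n η
  have hLt : Lk n η ≠ ⊤ := by unfold Lk; finiteness
  set V := volume (cube c r) with hV
  have hVt : V ≠ ⊤ := volume_cube_ne_top c hr
  set M := avg f (cube c r) with hM
  set f0 : Rn n → ℝ := fun y => f y - M with hf0
  have hf0m : Measurable f0 := hfm.sub_const M
  set B := (Kg n η + 1) * Cw * N with hB
  have hB0 : B ≠ 0 := by simp [hB, hcw0, hN0]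
  have hBt : B ≠ ⊤ := by finiteness
  have hK0 : KInt η f0 c r ≤ B * a c r := by
    refine (growth_kap W hf hN hη c hr).trans ?_
    calc Kg n η * (Cw * N * a c r) ≤ (Kg n η + 1) * (Cw * N * a c r) := by gcongr; exact le_self_add
      _ = _ := by rw [hB]; ring
  have hKt : KInt η f0 c r ≠ ⊤ := ne_top_of_le_ne_top (by finiteness) hK0
  have hT : Tf ψ μ f = Tf ψ μ f0 := Tf_sub_const H hfm.aestronglyMeasurable hr M hKt
  set f1 := (cube c (dil n * r)).indicator f0 with hf1
  have hf1m : Measurable f1 := hf0m.indicator (measurableSet_cube _ _)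
  have hI : ∫⁻ x, ‖f1 x‖ₑ ≤ Lk n η * V * (B * a c r) := by
    refine le_trans ?_ (mul_le_mul_right hK0 _)
    unfold KInt
    rw [← lintegral_const_mul' _ _ (by finiteness)]
    refine lintegral_mono fun y => ?_
    by_cases hy : y ∈ cube c (dil n * r)
    · simp only [hf1, indicator_of_mem hy]
      calc ‖f0 y‖ₑ = 1 * ‖f0 y‖ₑ := (one_mul _).symm
        _ ≤ (Lk n η * V * ENNReal.ofReal (kap n η r ‖y - c‖)) * ‖f0 y‖ₑ := by
            gcongr; exact one_le_kap hη hr hy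
        _ = _ := by ring
    · simp [hf1, indicator_of_notMem hy]
  set D : ℝ≥0∞ := 2 ^ (n + 2) * (Cwk n μ η C + 1) with hD
  have hD0 : D ≠ 0 := by simp [hD]
  have hD1 : 1 ≤ D := by
    rw [hD]
    exact one_le_mul (one_le_pow₀ (by norm_num)) le_add_self
  have hDt : D ≠ ⊤ := by finiteness
  set lam := D * (Lk n η * (B * a c r)) with hlam
  have hl0 : lam ≠ 0 := by simp [hlam, hD0, hL0, hB0, ha0]
  have hlt : lam ≠ ⊤ := by finiteness
  have hav : ∫⁻ x, ‖f1 x‖ₑ ≤ lam * volume (cube c (dil n * r)) := by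
    refine hI.trans ?_
    calc Lk n η * V * (B * a c r) = 1 * (Lk n η * (B * a c r)) * V := by ring
      _ ≤ D * (Lk n η * (B * a c r)) * volume (cube c (dil n * r)) := by
        gcongr
        exact measure_mono (cube_mono c (by have := dil_one n; nlinarith))
  have hw := weak_type H hf1m (mul_pos (dil_pos n) hr) (fun x hx => indicator_of_notMem hx _)
    (ne_top_of_le_ne_top (by finiteness) hI) hl0 hlt hav
  have hdiv : (∫⁻ x, ‖f1 x‖ₑ) / lam ≤ V / D := by
    rw [ENNReal.div_le_iff_le_mul (Or.inl hl0) (Or.inl hlt)]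
    refine hI.trans (le_of_eq ?_)
    calc Lk n η * V * (B * a c r) = V * (Lk n η * (B * a c r)) := by ring
      _ = (V / D * D) * (Lk n η * (B * a c r)) := by rw [ENNReal.div_mul_cancel hD0 hDt]
      _ = _ := by rw [hlam]; ring
  have hsub : {x | x ∈ cube c r ∧ cInf (Tf ψ μ f) c r + CA n μ η C Cw * N * a c r < Tf ψ μ f x} ⊆
      {x | lam < Tf ψ μ f1 x} := by
    rintro x ⟨hx, hlt'⟩
    show lam < Tf ψ μ f1 x
    by_contra hcon
    have hcon' : Tf ψ μ f1 x ≤ lam := not_lt.mp hcon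
    refine absurd hlt' (not_lt.mpr ?_)
    rw [← tsub_le_iff_right]
    unfold cInf
    refine le_iInf₂ fun x' hx' => ?_
    rw [tsub_le_iff_right, hT]
    refine (decomp H hf0m hr hKt hx hx').trans ?_
    calc Tf ψ μ f1 x + Cd μ η C * KInt η f0 c r + Tf ψ μ f0 x'
        ≤ lam + Cd μ η C * (B * a c r) + Tf ψ μ f0 x' := by gcongr
      _ = _ := by rw [hlam, hD, hB]; unfold CA; ring
  calc 2 ^ (n + 2) * volume {x | x ∈ cube c r ∧ cInf (Tf ψ μ f) c r + CA n μ η C Cw * N * a c r < Tf ψ μ f x}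
      ≤ 2 ^ (n + 2) * (Cwk n μ η C * (V / D)) := by
        gcongr
        exact (measure_mono hsub).trans (hw.trans (mul_le_mul_right hdiv _))
    _ ≤ 2 ^ (n + 2) * ((Cwk n μ η C + 1) * (V / D)) := by gcongr; exact le_self_add
    _ = V / D * D := by rw [hD]; ring
    _ = V := ENNReal.div_mul_cancel hD0 hDt

/-- John–Nirenberg constant. -/
def CJ (Cw : ℝ≥0∞) (p : ℝ) : ℝ≥0∞ := ∑' k : ℕ, ((k : ℝ≥0∞) + 1) ^ p * (1 - (2 * Cw)⁻¹) ^ k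

theorem p_est [IsFiniteMeasure μ] (H : KD ψ μ η C)
    {w : Rn n → ℝ≥0∞} {a : Rn n → ℝ → ℝ≥0∞} {Cw : ℝ≥0∞} (W : WData w a Cw)
    {f : Rn n → ℝ} (hfm : Measurable f) (hf : LocallyIntegrable f volume) {N : ℝ≥0∞} (hN0 : N ≠ 0)
    (hNt : N ≠ ⊤)
    (hN : ∀ c h, 0 < h → ∫⁻ x in cube c h, ‖f x - avg f (cube c h)‖ₑ ≤ N * ∫⁻ x in cube c h, w x)
    (p : ℝ) (hp : 1 < p) (c : Rn n) (r : ℝ) (hr : 0 < r) :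
    ∫⁻ x in cube c r, ((Tf ψ μ f x - cInf (Tf ψ μ f) c r) / w x) ^ p * w x ≤
      (CA n μ η C Cw * N) ^ p * CJ Cw p * ∫⁻ x in cube c r, w x := by
  have hcw0 : Cw ≠ 0 := (lt_of_lt_of_le one_pos W.cw1).ne'
  exact jn_main W (Tf_meas H.meas hfm) (mul_ne_zero (CA_ne_zero hcw0) hN0)
    (hyp_main H W hfm hf hN0 hNt hN) p hp c hr

theorem ae_fin [IsFiniteMeasure μ] (H : KD ψ μ η C)
    {w : Rn n → ℝ≥0∞} {a : Rn n → ℝ → ℝ≥0∞} {Cw : ℝ≥0∞} (W : WData w a Cw)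
    {f : Rn n → ℝ} (hfm : Measurable f) (hf : LocallyIntegrable f volume) {N : ℝ≥0∞} (hN0 : N ≠ 0)
    (hNt : N ≠ ⊤)
    (hN : ∀ c h, 0 < h → ∫⁻ x in cube c h, ‖f x - avg f (cube c h)‖ₑ ≤ N * ∫⁻ x in cube c h, w x)
    {x₀ : Rn n} (hx₀ : Tf ψ μ f x₀ < ⊤) : ∀ᵐ x, Tf ψ μ f x < ⊤ := by
  have hcw := W.cw
  have hT := Tf_meas (μ := μ) H.meas hfm
  have hwm := W.meas
  have key : ∀ k : ℕ, ∀ᵐ x, x ∈ cube x₀ ((k:ℝ) + 1) → Tf ψ μ f x < ⊤ := by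
    intro k
    have hk : (0:ℝ) < k + 1 := by positivity
    have h1 := p_est H W hfm hf hN0 hNt hN 2 (by norm_num) x₀ _ hk
    have hcA := CA_ne_top (n := n) (μ := μ) (C := C) H.hη hcw
    have hJ : CJ Cw 2 ≠ ⊤ := jn_const hcw 2
    have hwi : ∫⁻ x in cube x₀ ((k:ℝ) + 1), w x ≠ ⊤ := by
      refine ne_top_of_le_ne_top ?_ (W.a1 x₀ _ hk)
      have := W.afin x₀ _ hk
      have := volume_cube_ne_top x₀ hk
      finiteness
    have hA2 : (CA n μ η C Cw * N) ^ (2:ℝ) ≠ ⊤ := ENNReal.rpow_ne_top_of_nonneg (by norm_num) (by finiteness)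
    have h2 := ae_lt_top (by fun_prop) (ne_top_of_le_ne_top (by finiteness) h1)
    rw [ae_restrict_iff' (measurableSet_cube _ _)] at h2
    filter_upwards [h2] with x hx hxc
    have h3 := hx hxc
    by_contra hcon
    have ht : Tf ψ μ f x = ⊤ := by simpa using hcon
    have hc : cInf (Tf ψ μ f) x₀ ((k:ℝ) + 1) ≠ ⊤ :=
      (lt_of_le_of_lt (iInf₂_le x₀ (mem_cube_self x₀ hk)) hx₀).ne
    rw [ht, ENNReal.top_sub hc, ENNReal.top_div_of_ne_top (W.fin x).ne,
      ENNReal.top_rpow_of_pos (by norm_num), ENNReal.top_mul (W.pos x).ne'] at h3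
    exact lt_irrefl _ h3
  filter_upwards [ae_all_iff.mpr key] with x hx
  obtain ⟨k, hk⟩ := exists_nat_gt ‖x - x₀‖
  refine hx k ?_
  by_contra hc
  have := norm_ge_of_not_mem_cube hc
  linarith

end PartK

section PartL

/-- Simplified kernel conditions with a single exponent. -/
structure PS (ψ : Rn n → ℝ) (η D : ℝ) : Prop where
  n1 : 1 ≤ n
  hη : 0 < η
  hη1 : η ≤ 1/4
  hD : 0 < D
  int : Integrable ψ volume
  zero : ∫ x, ψ x = 0
  size : ∀ x, |ψ x| ≤ D * (1 + ‖x‖) ^ (-((n:ℝ) + η))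
  reg : ∀ x h : Rn n, 2 * ‖h‖ ≤ ‖x‖ →
    |ψ (x + h) - ψ x| ≤ D * (‖h‖ / (1 + ‖x‖)) ^ (2 * η) * (1 + ‖x‖) ^ (-((n:ℝ) + η))

theorem PS_of {C₁ C₂ δ γ : ℝ} (hn : 1 ≤ n) (hC₁ : 0 < C₁) (_hC₂ : 0 < C₂) (hδ : 0 < δ) (hγ : 0 < γ)
    {ψ : Rn n → ℝ} (hψ : PsiKernel n C₁ C₂ δ γ ψ) :
    PS ψ (min (min δ (γ / 2)) (1 / 4)) (max C₁ C₂) := by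
  obtain ⟨h1, h2, h3, h4⟩ := hψ
  set η := min (min δ (γ / 2)) (1 / 4) with hη
  have e1 : η ≤ δ := (min_le_left _ _).trans (min_le_left _ _)
  have e2 : 2 * η ≤ γ := by
    have : η ≤ γ / 2 := (min_le_left _ _).trans (min_le_right _ _)
    linarith
  have e0 : 0 < η := by positivity
  refine ⟨hn, e0, min_le_right _ _, by positivity, h1, h2, fun x => ?_, fun x h hh => ?_⟩
  · refine (h3 x).trans ?_
    have hx := norm_nonneg x
    gcongr
    · exact le_max_left _ _
    · linarith
  · refine (h4 x h hh).trans ?_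
    have hx := norm_nonneg x
    have hh0 := norm_nonneg h
    have hp : 0 < 1 + ‖x‖ := by positivity
    have hle : ‖h‖ / (1 + ‖x‖) ≤ 1 := by rw [div_le_one hp]; linarith
    have a1 : ‖h‖ ^ γ * (1 + ‖x‖) ^ (-((n:ℝ) + δ + γ)) =
        (‖h‖ / (1 + ‖x‖)) ^ γ * (1 + ‖x‖) ^ (-((n:ℝ) + δ)) := by
      rw [Real.div_rpow hh0 hp.le, show -((n:ℝ) + δ + γ) = -γ + -((n:ℝ) + δ) by ring,
        Real.rpow_add hp, Real.rpow_neg hp.le γ]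
      ring
    have a2 : (‖h‖ / (1 + ‖x‖)) ^ γ ≤ (‖h‖ / (1 + ‖x‖)) ^ (2 * η) :=
      Real.rpow_le_rpow_of_exponent_ge_of_imp (by positivity) hle e2 (by intro _ h; linarith)
    rw [mul_assoc, a1, ← mul_assoc]
    gcongr
    · exact le_max_right _ _
    · linarith

theorem PS.meas {ψ : Rn n → ℝ} {η D : ℝ} (H : PS ψ η D) : Measurable ψ := by
  have hη := H.hη
  have hD := H.hD
  refine measurable_of_continuousOn_compl_singleton 0 ?_
  intro x hx
  have hx0 : x ≠ 0 := hx
  apply ContinuousAt.continuousWithinAt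
  have hxn : 0 < ‖x‖ := norm_pos_iff.mpr hx0
  rw [ContinuousAt, tendsto_iff_norm_sub_tendsto_zero]
  have hlim : Filter.Tendsto (fun y : Rn n => D * (‖y - x‖ / (1 + ‖x‖)) ^ (2 * η) * (1 + ‖x‖) ^ (-((n:ℝ) + η)))
      (nhds x) (nhds 0) := by
    have hc : Continuous (fun y : Rn n => D * (‖y - x‖ / (1 + ‖x‖)) ^ (2 * η) * (1 + ‖x‖) ^ (-((n:ℝ) + η))) := by
      have : Continuous fun y : Rn n => (‖y - x‖ / (1 + ‖x‖)) ^ (2 * η) :=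
        Continuous.rpow_const (by fun_prop) (fun _ => Or.inr (by positivity))
      fun_prop
    have := hc.tendsto x
    simpa [Real.zero_rpow (by positivity : 2 * η ≠ 0)] using this
  refine squeeze_zero' (Filter.Eventually.of_forall fun _ => norm_nonneg _) ?_ hlim
  filter_upwards [Metric.ball_mem_nhds x (half_pos hxn)] with y hy
  rw [mem_ball, dist_eq_norm] at hy
  have := H.reg x (y - x) (by linarith)
  simpa using this

theorem PS.size0 {ψ : Rn n → ℝ} {η D : ℝ} (H : PS ψ η D) (x : Rn n) : |ψ x| ≤ D := by
  have hη := H.hη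
  refine (H.size x).trans ?_
  have : (1 + ‖x‖) ^ (-((n:ℝ) + η)) ≤ 1 :=
    Real.rpow_le_one_of_one_le_of_nonpos (by linarith [norm_nonneg x]) (by
      have : (0:ℝ) ≤ n := by positivity
      linarith)
  nlinarith [H.hD]

theorem PS.modu {ψ : Rn n → ℝ} {η D : ℝ} (H : PS ψ η D) :
    ∃ C : ℝ, 0 ≤ C ∧ ∀ h : Rn n, ∫⁻ x, ‖ψ (x + h) - ψ x‖ₑ ≤ ENNReal.ofReal (C * ‖h‖ ^ (η / 2)) := by
  have hη := H.hη
  have hη1 := H.hη1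
  have hD := H.hD
  have hm := H.meas
  set I := ∫⁻ x, ‖ψ x‖ₑ with hI
  have hIt : I ≠ ⊤ := H.int.2.ne
  set v := volume (ball (0 : Rn n) 1) with hv
  have hvt : v ≠ ⊤ := measure_ball_lt_top.ne
  have hKg := Kg_ne_top n hη
  set T := 2 * I + ENNReal.ofReal D * Kg n η + ENNReal.ofReal (2 * D) * (ENNReal.ofReal (2 ^ n) * v) with hT
  have hTt : T ≠ ⊤ := by finiteness
  refine ⟨T.toReal, ENNReal.toReal_nonneg, fun h => ?_⟩
  rw [ENNReal.ofReal_mul ENNReal.toReal_nonneg, ENNReal.ofReal_toReal hTt]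
  rcases eq_or_ne h 0 with h0 | h0
  · simp [h0]
  have hh0 : 0 < ‖h‖ := norm_pos_iff.mpr h0
  rcases le_total 1 ‖h‖ with h1 | h1
  · have a1 : ∫⁻ x, ‖ψ (x + h) - ψ x‖ₑ ≤ 2 * I := by
      calc ∫⁻ x, ‖ψ (x + h) - ψ x‖ₑ ≤ ∫⁻ x, (‖ψ (x + h)‖ₑ + ‖ψ x‖ₑ) := lintegral_mono fun x => enorm_sub_le
        _ = (∫⁻ x, ‖ψ (x + h)‖ₑ) + I := by rw [lintegral_add_right _ hm.enorm]
        _ = _ := by rw [lintegral_add_right_eq_self (fun x => ‖ψ x‖ₑ) h, two_mul]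
    have a2 : 1 ≤ ENNReal.ofReal (‖h‖ ^ (η / 2)) := by
      rw [← ENNReal.ofReal_one]
      exact ENNReal.ofReal_le_ofReal (Real.one_le_rpow h1 (by positivity))
    calc _ ≤ 2 * I := a1
      _ ≤ T := by rw [hT, add_assoc]; exact le_self_add
      _ = T * 1 := (mul_one _).symm
      _ ≤ _ := mul_le_mul_right a2 _
  · have hpt : ∀ x : Rn n, ‖ψ (x + h) - ψ x‖ₑ ≤
        ENNReal.ofReal (‖h‖ ^ (η / 2)) * (ENNReal.ofReal D * ENNReal.ofReal (kap n η 1 ‖x - 0‖)) +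
        (ball (0 : Rn n) (2 * ‖h‖)).indicator (fun _ => ENNReal.ofReal (2 * D)) x := by
      intro x
      rw [Real.enorm_eq_ofReal_abs]
      have hx := norm_nonneg x
      by_cases hxb : x ∈ ball (0 : Rn n) (2 * ‖h‖)
      · rw [indicator_of_mem hxb]
        refine le_add_left (ENNReal.ofReal_le_ofReal ?_)
        have := abs_sub (ψ (x + h)) (ψ x)
        linarith [H.size0 x, H.size0 (x + h)]
      · refine le_add_right ?_
        rw [← ENNReal.ofReal_mul hD.le, ← ENNReal.ofReal_mul (by positivity)]
        apply ENNReal.ofReal_le_ofReal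
        rw [mem_ball_zero_iff, not_lt] at hxb
        refine (H.reg x h hxb).trans ?_
        have b1 : (‖h‖ / (1 + ‖x‖)) ^ (2 * η) ≤ ‖h‖ ^ (η / 2) := by
          calc (‖h‖ / (1 + ‖x‖)) ^ (2 * η) ≤ ‖h‖ ^ (2 * η) := by
                gcongr
                exact div_le_self hh0.le (by linarith)
            _ ≤ _ := Real.rpow_le_rpow_of_exponent_ge hh0 h1 (by linarith)
        have b2 : kap n η 1 ‖x - 0‖ = (1 + ‖x‖) ^ (-((n:ℝ) + η)) := by simp [kap]
        rw [b2, mul_comm D, mul_assoc]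
        gcongr
    have a3 : volume (ball (0 : Rn n) (2 * ‖h‖)) ≤ ENNReal.ofReal (‖h‖ ^ (η / 2)) * (ENNReal.ofReal (2 ^ n) * v) := by
      rw [Measure.addHaar_ball_of_pos volume _ (by positivity), finrank_euclideanSpace_fin, mul_pow, mul_comm (2 ^ n),
        ENNReal.ofReal_mul (by positivity), mul_assoc]
      gcongr
      rw [← Real.rpow_natCast]
      refine Real.rpow_le_rpow_of_exponent_ge hh0 h1 ?_
      have : (1:ℝ) ≤ n := by exact_mod_cast H.n1
      linarith
    calc _ ≤ ∫⁻ x, (ENNReal.ofReal (‖h‖ ^ (η / 2)) * (ENNReal.ofReal D * ENNReal.ofReal (kap n η 1 ‖x - 0‖)) +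
        (ball (0 : Rn n) (2 * ‖h‖)).indicator (fun _ => ENNReal.ofReal (2 * D)) x) := lintegral_mono hpt
      _ = ENNReal.ofReal (‖h‖ ^ (η / 2)) * (ENNReal.ofReal D * ∫⁻ x : Rn n, ENNReal.ofReal (kap n η 1 ‖x - 0‖)) +
          ENNReal.ofReal (2 * D) * volume (ball (0 : Rn n) (2 * ‖h‖)) := by
        rw [lintegral_add_right _ (measurable_const.indicator measurableSet_ball),
          lintegral_const_mul' _ _ (by finiteness), lintegral_const_mul' _ _ (by finiteness),
          lintegral_indicator_const measurableSet_ball]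
      _ ≤ ENNReal.ofReal (‖h‖ ^ (η / 2)) * (ENNReal.ofReal D * Kg n η) +
          ENNReal.ofReal (2 * D) * (ENNReal.ofReal (‖h‖ ^ (η / 2)) * (ENNReal.ofReal (2 ^ n) * v)) := by
        gcongr
        exact kap_int hη 0 one_pos
      _ = (ENNReal.ofReal D * Kg n η + ENNReal.ofReal (2 * D) * (ENNReal.ofReal (2 ^ n) * v)) *
          ENNReal.ofReal (‖h‖ ^ (η / 2)) := by ring
      _ ≤ _ := by
        gcongr
        rw [hT, add_assoc]
        exact le_add_self

end PartL

section PartM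

theorem sq_aux (x : ℝ) {t : ℝ} (ht : 0 ≤ t) : x ^ 2 * t ≤ (x * (1 + t)) ^ 2 := by
  rw [mul_pow]
  exact mul_le_mul_of_nonneg_left (by nlinarith) (by positivity)

theorem PS.pow_lower {ψ : Rn n → ℝ} {η D : ℝ} (H : PS ψ η D) {s K : ℝ} {x : Rn n} (hs : 0 ≤ s) (hK : 0 < K)
    (h : (1 + s) / K ≤ 1 + ‖x‖) :
    (1 + ‖x‖) ^ (-((n:ℝ) + η)) ≤ K ^ ((n:ℝ) + η) * (1 + s) ^ (-((n:ℝ) + η)) := by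
  have hη := H.hη
  have hn : (0:ℝ) ≤ n := by positivity
  calc (1 + ‖x‖) ^ (-((n:ℝ) + η)) ≤ ((1 + s) / K) ^ (-((n:ℝ) + η)) :=
        Real.rpow_le_rpow_of_nonpos (by positivity) h (by linarith)
    _ = _ := by
        rw [Real.div_rpow (by positivity) hK.le, Real.rpow_neg hK.le, div_inv_eq_mul, mul_comm]

/-- good part -/
theorem PS.good {ψ : Rn n → ℝ} {η D : ℝ} (H : PS ψ η D) {u v z : Rn n} {k : ℝ} (hk : 0 < k)
    (huv : ‖u - v‖ ≤ 2 * n * k) (hc : 8 * n * k ≤ ‖u‖) (hz : ‖z‖ ≤ 1) (hg : 2 * ‖u - v‖ ≤ ‖u + z‖) :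
    |ψ (u + z) - ψ (v + z)| ≤ D * (8 * n) ^ (2 * η) * 2 ^ ((n:ℝ) + η) *
      ((k / (k + ‖u‖)) ^ (2 * η) * (1 + ‖u‖) ^ (-((n:ℝ) + η))) := by
  have hη := H.hη
  have hD := H.hD
  have hn : (1:ℝ) ≤ n := by exact_mod_cast H.n1
  have hu : 0 < ‖u‖ := lt_of_lt_of_le (by positivity) hc
  have hlow : (1 + ‖u‖) / 2 ≤ 1 + ‖u + z‖ := by
    have : ‖u‖ ≤ ‖u + z‖ + ‖z‖ := by
      calc ‖u‖ = ‖(u + z) - z‖ := by simp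
        _ ≤ _ := norm_sub_le _ _
    have := norm_nonneg (u + z)
    linarith
  have h1 := H.reg (u + z) (v - u) (by rw [norm_sub_rev]; exact hg)
  rw [show u + z + (v - u) = v + z by abel, abs_sub_comm, norm_sub_rev] at h1
  refine h1.trans ?_
  have h2 := H.pow_lower (norm_nonneg u) two_pos hlow
  have h3 : ‖u - v‖ / (1 + ‖u + z‖) ≤ (8 * n) * (k / (k + ‖u‖)) := by
    have hku : k ≤ ‖u‖ := by nlinarith
    calc ‖u - v‖ / (1 + ‖u + z‖) ≤ (2 * n * k) / ((1 + ‖u‖) / 2) := by gcongr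
      _ ≤ (2 * n * k) / ((k + ‖u‖) / 4) := by
          gcongr (2 * n * k) / ?_
          linarith
      _ = _ := by field_simp; ring
  calc D * (‖u - v‖ / (1 + ‖u + z‖)) ^ (2 * η) * (1 + ‖u + z‖) ^ (-((n:ℝ) + η))
      ≤ D * ((8 * n) * (k / (k + ‖u‖))) ^ (2 * η) * (2 ^ ((n:ℝ) + η) * (1 + ‖u‖) ^ (-((n:ℝ) + η))) := by
        gcongr
    _ = _ := by rw [Real.mul_rpow (by positivity) (by positivity)]; ring

theorem PS.bad {ψ : Rn n → ℝ} {η D : ℝ} (H : PS ψ η D) {u v z : Rn n} {k : ℝ}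
    (huv : ‖u - v‖ ≤ 2 * n * k) (hc : 8 * n * k ≤ ‖u‖) (hz : ‖z‖ ≤ 1) :
    |ψ (u + z) - ψ (v + z)| ≤ 2 * D * 4 ^ ((n:ℝ) + η) * (1 + ‖u‖) ^ (-((n:ℝ) + η)) := by
  have hD := H.hD
  have key : ∀ w : Rn n, ‖w‖ ≥ 3 / 4 * ‖u‖ → |ψ (w + z)| ≤ D * 4 ^ ((n:ℝ) + η) * (1 + ‖u‖) ^ (-((n:ℝ) + η)) := by
    intro w hw
    have hlow : (1 + ‖u‖) / 4 ≤ 1 + ‖w + z‖ := by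
      have : ‖w‖ ≤ ‖w + z‖ + ‖z‖ := by
        calc ‖w‖ = ‖(w + z) - z‖ := by simp
          _ ≤ _ := norm_sub_le _ _
      have := norm_nonneg (w + z)
      linarith
    have h2 := H.pow_lower (norm_nonneg u) four_pos hlow
    calc _ ≤ _ := H.size _
      _ ≤ D * (4 ^ ((n:ℝ) + η) * (1 + ‖u‖) ^ (-((n:ℝ) + η))) := by gcongr
      _ = _ := by ring
  have h1 := key u (by linarith [norm_nonneg u])
  have h2 := key v (by
    have : ‖u‖ ≤ ‖u - v‖ + ‖v‖ := by
      calc ‖u‖ = ‖(u - v) + v‖ := by simp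
        _ ≤ _ := norm_add_le _ _
    linarith)
  have := abs_sub (ψ (u + z)) (ψ (v + z))
  linarith

theorem PS.near {ψ : Rn n → ℝ} {η D : ℝ} (H : PS ψ η D) {u v z : Rn n} {k : ℝ} (hk : 0 < k)
    (hk1 : k ≤ 1) (hc : ‖u‖ ≤ 8 * n * k) :
    |ψ (u + z) - ψ (v + z)| ≤ 2 * D * (1 + 8 * n) ^ ((n:ℝ) + 3 * η) *
      ((k / (k + ‖u‖)) ^ (2 * η) * (1 + ‖u‖) ^ (-((n:ℝ) + η))) := by
  have hη := H.hη
  have hD := H.hD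
  have hn : (0:ℝ) ≤ n := by positivity
  have hu := norm_nonneg u
  have h1 : (1 + 8 * n : ℝ)⁻¹ ≤ k / (k + ‖u‖) := by
    rw [inv_eq_one_div, div_le_div_iff₀ (by positivity) (by positivity)]; linarith
  have h2 : 1 + ‖u‖ ≤ 1 + 8 * n := by nlinarith
  have h3 : ((1 + 8 * n : ℝ)⁻¹) ^ (2 * η) ≤ (k / (k + ‖u‖)) ^ (2 * η) := by gcongr
  have h4 : (1 + 8 * n : ℝ) ^ (-((n:ℝ) + η)) ≤ (1 + ‖u‖) ^ (-((n:ℝ) + η)) :=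
    Real.rpow_le_rpow_of_nonpos (by positivity) h2 (by linarith)
  have h5 : (1 + 8 * n : ℝ) ^ ((n:ℝ) + 3 * η) * (((1 + 8 * n : ℝ)⁻¹) ^ (2 * η) * (1 + 8 * n : ℝ) ^ (-((n:ℝ) + η))) = 1 := by
    rw [Real.inv_rpow (by positivity), ← Real.rpow_neg (by positivity), ← Real.rpow_add (by positivity),
      ← Real.rpow_add (by positivity)]
    ring_nf; simp
  have := abs_sub (ψ (u + z)) (ψ (v + z))
  calc |ψ (u + z) - ψ (v + z)| ≤ 2 * D * 1 := by linarith [H.size0 (u + z), H.size0 (v + z)]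
    _ = 2 * D * ((1 + 8 * n : ℝ) ^ ((n:ℝ) + 3 * η) * (((1 + 8 * n : ℝ)⁻¹) ^ (2 * η) * (1 + 8 * n : ℝ) ^ (-((n:ℝ) + η)))) := by
        rw [h5]
    _ ≤ 2 * D * ((1 + 8 * n : ℝ) ^ ((n:ℝ) + 3 * η) * ((k / (k + ‖u‖)) ^ (2 * η) * (1 + ‖u‖) ^ (-((n:ℝ) + η)))) := by
        gcongr
    _ = _ := by ring

set_option maxHeartbeats 800000 in
theorem PS.KD_of {ψ : Rn n → ℝ} {η D : ℝ} (H : PS ψ η D) {μ : Measure (Rn n)} [IsFiniteMeasure μ]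
    (hsupp : ∀ᵐ z ∂μ, ‖z‖ ≤ 1) {Cm : ℝ} (hCm : 0 ≤ Cm)
    (hμ : ∀ (u : Rn n) (s : ℝ), 0 < s → 2 * s ≤ ‖u‖ → μ (ball (-u) s) ≤ ENNReal.ofReal (Cm * (s / ‖u‖))) :
    ∃ C, KD ψ μ η C := by
  have hη := H.hη
  have hη1 := H.hη1
  have hD := H.hD
  have hn : (1:ℝ) ≤ n := by exact_mod_cast H.n1
  obtain ⟨Cu, hCu, hmod⟩ := H.modu
  set m := (μ univ).toReal with hm
  have hm0 : 0 ≤ m := ENNReal.toReal_nonneg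
  have hmE : μ univ = ENNReal.ofReal m := (ENNReal.ofReal_toReal (measure_ne_top _ _)).symm
  set Cg := D * (8 * n) ^ (2 * η) * 2 ^ ((n:ℝ) + η) with hCg
  set Cb := 2 * D * 4 ^ ((n:ℝ) + η) with hCb
  set Cn := 2 * D * (1 + 8 * n) ^ ((n:ℝ) + 3 * η) with hCn
  have hCg0 : 0 < Cg := by positivity
  have hCb0 : 0 < Cb := by positivity
  have hCn0 : 0 < Cn := by positivity
  set X := Cg * (1 + m) with hX
  set Y := Cb * (1 + Cm * (8 * n)) with hY
  set Z := Cn * (1 + m) with hZ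
  have hX0 : 0 < X := by positivity
  have hY0 : 0 < Y := by positivity
  have hZ0 : 0 < Z := by positivity
  refine ⟨D + Cu + X + Y + Z, H.n1, H.meas, H.int, H.zero, hη, hη1, by positivity, fun x => ?_, hsupp,
    fun u v k hk huv hc => ?_, fun h => ?_⟩
  · refine (H.size x).trans ?_
    gcongr; linarith
  · set q := k / (k + ‖u‖) with hq
    have hu0 := norm_nonneg u
    have hq0 : 0 < q := by positivity
    have hq1 : q ≤ 1 := by rw [hq, div_le_one (by positivity)]; linarith
    set Q := q ^ (2 * η) with hQ
    set R := (1 + ‖u‖) ^ (-((n:ℝ) + η)) with hR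
    have hQ0 : 0 < Q := by positivity
    have hR0 : 0 < R := by positivity
    have hsq : ∀ {a b : ℝ}, |a| ≤ b → ‖a‖ₑ ^ 2 ≤ ENNReal.ofReal (b ^ 2) := by
      intro a b hab
      rw [Real.enorm_eq_ofReal_abs, ← ENNReal.ofReal_pow (abs_nonneg _)]
      exact ENNReal.ofReal_le_ofReal (by gcongr)
    rw [← ENNReal.ofReal_pow (by positivity)]
    rcases le_or_gt (8 * n * k) ‖u‖ with h8 | h8
    · have hu : 0 < ‖u‖ := lt_of_lt_of_le (by positivity) h8
      have hpt : ∀ᵐ z ∂μ, ‖ψ (u + z) - ψ (v + z)‖ₑ ^ 2 ≤ ENNReal.ofReal ((Cg * (Q * R)) ^ 2) +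
          (ball (-u) (4 * n * k)).indicator (fun _ => ENNReal.ofReal ((Cb * R) ^ 2)) z := by
        filter_upwards [hsupp] with z hz
        by_cases hzb : z ∈ ball (-u) (4 * n * k)
        · rw [indicator_of_mem hzb]
          exact le_add_left (hsq (H.bad huv h8 hz))
        · refine le_add_right (hsq (H.good hk huv h8 hz ?_))
          rw [mem_ball, dist_eq_norm, sub_neg_eq_add, not_lt, add_comm] at hzb
          linarith
      have hmu := hμ u (4 * n * k) (by positivity) (by linarith)
      have hle : Cm * (4 * n * k / ‖u‖) ≤ Cm * (8 * n) * Q ^ 2 := by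
        have e1 : 4 * n * k / ‖u‖ ≤ 8 * n * q := by
          have hku : k ≤ ‖u‖ := by nlinarith
          calc 4 * n * k / ‖u‖ ≤ 4 * n * k / ((k + ‖u‖) / 2) := by
                gcongr 4 * n * k / ?_
                linarith
            _ = _ := by rw [hq]; field_simp; ring
        have e2 : q ≤ Q ^ 2 := by
          rw [hQ, ← Real.rpow_natCast, ← Real.rpow_mul hq0.le]
          calc q = q ^ (1:ℝ) := (Real.rpow_one q).symm
            _ ≤ _ := Real.rpow_le_rpow_of_exponent_ge hq0 hq1 (by push_cast; linarith)
        calc Cm * (4 * n * k / ‖u‖) ≤ Cm * (8 * n * q) := by gcongr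
          _ ≤ Cm * (8 * n * Q ^ 2) := by gcongr
          _ = _ := by ring
      calc _ ≤ ∫⁻ z, (ENNReal.ofReal ((Cg * (Q * R)) ^ 2) +
          (ball (-u) (4 * n * k)).indicator (fun _ => ENNReal.ofReal ((Cb * R) ^ 2)) z) ∂μ := lintegral_mono_ae hpt
        _ = ENNReal.ofReal ((Cg * (Q * R)) ^ 2) * μ univ +
            ENNReal.ofReal ((Cb * R) ^ 2) * μ (ball (-u) (4 * n * k)) := by
          rw [lintegral_add_right _ (measurable_const.indicator measurableSet_ball), lintegral_const,
            lintegral_indicator_const measurableSet_ball]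
        _ ≤ ENNReal.ofReal ((Cg * (Q * R)) ^ 2) * ENNReal.ofReal m +
            ENNReal.ofReal ((Cb * R) ^ 2) * ENNReal.ofReal (Cm * (8 * n) * Q ^ 2) := by
          rw [hmE]
          gcongr
          exact hmu.trans (ENNReal.ofReal_le_ofReal hle)
        _ = ENNReal.ofReal ((Cg * (Q * R)) ^ 2 * m + (Cb * R) ^ 2 * (Cm * (8 * n) * Q ^ 2)) := by
          rw [← ENNReal.ofReal_mul (by positivity), ← ENNReal.ofReal_mul (by positivity),
            ENNReal.ofReal_add (by positivity) (by positivity)]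
        _ ≤ _ := by
          apply ENNReal.ofReal_le_ofReal
          set t := Cm * (8 * n) with ht
          have ht0 : 0 ≤ t := by positivity
          have f1 : Cg ^ 2 * m ≤ X ^ 2 := by
            rw [hX]; exact sq_aux _ hm0
          have f2 : Cb ^ 2 * t ≤ Y ^ 2 := by
            rw [hY]; exact sq_aux _ ht0
          have f3 : X ^ 2 + Y ^ 2 ≤ (D + Cu + X + Y + Z) ^ 2 := by
            have : (X + Y) ^ 2 ≤ (D + Cu + X + Y + Z) ^ 2 := pow_le_pow_left₀ (by positivity) (by linarith) 2
            nlinarith [mul_pos hX0 hY0]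
          calc (Cg * (Q * R)) ^ 2 * m + (Cb * R) ^ 2 * (t * Q ^ 2) = (Cg ^ 2 * m + Cb ^ 2 * t) * (Q * R) ^ 2 := by ring
            _ ≤ (D + Cu + X + Y + Z) ^ 2 * (Q * R) ^ 2 :=
              mul_le_mul_of_nonneg_right (by linarith) (by positivity)
            _ = _ := by ring
    · have hk1 : k ≤ 1 := by
        rcases hc with h | h
        · exact h
        · exact absurd h (not_le.mpr h8)
      calc _ ≤ ∫⁻ z, ENNReal.ofReal ((Cn * (Q * R)) ^ 2) ∂μ :=
            lintegral_mono fun z => hsq (H.near hk hk1 h8.le)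
        _ = ENNReal.ofReal ((Cn * (Q * R)) ^ 2 * m) := by
          rw [lintegral_const, hmE, ← ENNReal.ofReal_mul (by positivity)]
        _ ≤ _ := by
          apply ENNReal.ofReal_le_ofReal
          have f1 : Cn ^ 2 * m ≤ Z ^ 2 := by
            rw [hZ]; exact sq_aux _ hm0
          have f3 : Z ^ 2 ≤ (D + Cu + X + Y + Z) ^ 2 := pow_le_pow_left₀ (by positivity) (by linarith) 2
          calc (Cn * (Q * R)) ^ 2 * m = Cn ^ 2 * m * (Q * R) ^ 2 := by ring
            _ ≤ (D + Cu + X + Y + Z) ^ 2 * (Q * R) ^ 2 :=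
              mul_le_mul_of_nonneg_right (by linarith) (by positivity)
            _ = _ := by ring
  · refine (hmod h).trans (ENNReal.ofReal_le_ofReal ?_)
    gcongr; linarith

theorem KD_dirac {ψ : Rn n → ℝ} {η D : ℝ} (H : PS ψ η D) : ∃ C, KD ψ (Measure.dirac 0) η C := by
  refine H.KD_of (by simp [ae_dirac_eq]) le_rfl ?_
  intro u s hs h2
  rw [Measure.dirac_apply' _ measurableSet_ball, indicator_of_notMem]
  · simp
  · rw [mem_ball, dist_eq_norm]; simp; linarith

theorem KD_ball {ψ : Rn n → ℝ} {η D : ℝ} (H : PS ψ η D) :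
    ∃ C, KD ψ (volume.restrict (ball (0 : Rn n) 1)) η C := by
  have : IsFiniteMeasure (volume.restrict (ball (0 : Rn n) 1)) :=
    ⟨by rw [Measure.restrict_apply_univ]; exact measure_ball_lt_top⟩
  set v := (volume (ball (0 : Rn n) 1)).toReal with hv
  have hvE : volume (ball (0 : Rn n) 1) = ENNReal.ofReal v := (ENNReal.ofReal_toReal measure_ball_lt_top.ne).symm
  have hv0 : 0 ≤ v := ENNReal.toReal_nonneg
  refine H.KD_of (Cm := 2 * v) ?_ (by positivity) ?_
  · filter_upwards [ae_restrict_mem measurableSet_ball] with z hz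
    rw [mem_ball_zero_iff] at hz; exact hz.le
  · intro u s hs h2
    rw [Measure.restrict_apply measurableSet_ball]
    rcases eq_empty_or_nonempty (ball (-u) s ∩ ball (0 : Rn n) 1) with he | ⟨z, hz1, hz2⟩
    · simp [he]
    · rw [mem_ball, dist_eq_norm, sub_neg_eq_add] at hz1
      rw [mem_ball_zero_iff] at hz2
      have : ‖u‖ ≤ ‖z + u‖ + ‖z‖ := by
        calc ‖u‖ = ‖(z + u) - z‖ := by simp
          _ ≤ _ := norm_sub_le _ _
      have hu2 : ‖u‖ ≤ 2 := by linarith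
      have hu0 : 0 < ‖u‖ := by linarith
      refine (measure_mono inter_subset_left).trans ?_
      rw [Measure.addHaar_ball_of_pos volume _ hs, finrank_euclideanSpace_fin, hvE,
        ← ENNReal.ofReal_mul (by positivity)]
      apply ENNReal.ofReal_le_ofReal
      have h3 : s ^ n ≤ s := pow_le_of_le_one hs.le (by linarith) (by have := H.n1; omega)
      calc s ^ n * v ≤ s * v := by gcongr
        _ = 2 * v * (s / 2) := by ring
        _ ≤ _ := by gcongr

end PartM

section PartN

theorem Tf_iter {ψ f : Rn n → ℝ} {μ : Measure (Rn n)} [SFinite μ] (hψ : Measurable ψ) (hf : Measurable f) (x : Rn n) :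
    Tf ψ μ f x = (∫⁻ t in Ioi (0:ℝ), ENNReal.ofReal (t⁻¹) * ∫⁻ z, ‖cvl ψ t f (x + t • z)‖ₑ ^ 2 ∂μ) ^ (1/2:ℝ) := by
  unfold Tf L2n
  have hm : Measurable (fun q : Rn n × ℝ => ‖cvl ψ q.2 f (x + q.2 • q.1)‖ₑ ^ 2) := (F_meas hψ hf x).enorm.pow_const 2
  rw [lintegral_prod_symm _ hm.aemeasurable, lintegral_tau (hm.lintegral_prod_left')]

theorem enorm_sq_real (a : ℝ) : ‖a‖ₑ ^ 2 = ENNReal.ofReal (a ^ 2) := by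
  rw [Real.enorm_eq_ofReal_abs, ← ENNReal.ofReal_pow (abs_nonneg _), sq_abs]

theorem Gfun_eq {ψ f : Rn n → ℝ} (hψ : Measurable ψ) (hf : Measurable f) :
    Gfun ψ f = Tf ψ (Measure.dirac 0) f := by
  funext x
  rw [Tf_iter hψ hf, Gfun]
  congr 1
  refine setLIntegral_congr_fun measurableSet_Ioi fun t ht => ?_
  have ht' : 0 < t := ht
  have hm : Measurable (fun z : Rn n => ‖cvl ψ t f (x + t • z)‖ₑ ^ 2) :=
    ((F_meas hψ hf x).comp (measurable_id.prodMk measurable_const)).enorm.pow_const 2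
  rw [lintegral_dirac' _ hm, smul_zero, add_zero, enorm_sq_real, ← ENNReal.ofReal_mul (by positivity)]
  congr 1
  field_simp

theorem Sfun_eq {ψ f : Rn n → ℝ} (hψ : Measurable ψ) (hf : Measurable f) :
    Sfun ψ f = Tf ψ (volume.restrict (ball (0 : Rn n) 1)) f := by
  funext x
  rw [Tf_iter hψ hf, Sfun, Sdil]
  congr 1
  refine setLIntegral_congr_fun measurableSet_Ioi fun t ht => ?_
  have ht' : 0 < t := ht
  have hm : Measurable (fun z : Rn n => ‖cvl ψ t f (x + t • z)‖ₑ ^ 2) :=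
    ((F_meas hψ hf x).comp (measurable_id.prodMk measurable_const)).enorm.pow_const 2
  set F : Rn n → ℝ≥0∞ := (ball (0 : Rn n) 1).indicator (fun z => ‖cvl ψ t f (x + t • z)‖ₑ ^ 2) with hF
  have hFm : Measurable F := hm.indicator measurableSet_ball
  rw [← lintegral_indicator measurableSet_ball, ← lintegral_indicator measurableSet_ball, ← hF,
    ← lint_scale hFm ht', ← lintegral_sub_right_eq_self (fun v => ENNReal.ofReal ((t ^ n)⁻¹) * F (t⁻¹ • v)) x,
    ← lintegral_const_mul' _ _ (by finiteness)]
  refine lintegral_congr fun y => ?_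
  have hiff : t⁻¹ • (y - x) ∈ ball (0 : Rn n) 1 ↔ y ∈ ball x (1 * t) := by
    rw [mem_ball_zero_iff, norm_scale ht', div_lt_one ht', mem_ball, dist_eq_norm, one_mul]
  by_cases hy : y ∈ ball x (1 * t)
  · rw [indicator_of_mem hy, hF, indicator_of_mem (hiff.mpr hy), smul_smul, mul_inv_cancel₀ ht'.ne', one_smul,
      add_sub_cancel, enorm_sq_real, ← ENNReal.ofReal_mul (by positivity), ← ENNReal.ofReal_mul (by positivity)]
    congr 1
    field_simp
    ring
  · rw [indicator_of_notMem hy, hF, indicator_of_notMem (fun h => hy (hiff.mp h))]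
    simp

theorem Gfun_congr {ψ f g : Rn n → ℝ} (h : f =ᵐ[volume] g) : Gfun ψ f = Gfun ψ g := by
  funext x; unfold Gfun
  simp_rw [cvl_congr_ae h]

theorem Sfun_congr {ψ f g : Rn n → ℝ} (h : f =ᵐ[volume] g) : Sfun ψ f = Sfun ψ g := by
  funext x; unfold Sfun Sdil
  simp_rw [cvl_congr_ae h]

end PartN

section PartO

theorem le_essInf_real {ν : Measure (Rn n)} [NeZero ν] {g : Rn n → ℝ} {b : ℝ} (h : ∀ᵐ x ∂ν, b ≤ g x) :
    b ≤ essInf g ν := by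
  rw [essInf, Filter.liminf_eq]
  refine le_csSup ?_ h
  by_contra hb
  rw [not_bddAbove_iff] at hb
  have : ∀ k : ℕ, ∀ᵐ x ∂ν, (k:ℝ) ≤ g x := by
    intro k
    obtain ⟨y, hy, hky⟩ := hb k
    have hy' : ∀ᵐ x ∂ν, y ≤ g x := hy
    filter_upwards [hy'] with x hx
    linarith
  obtain ⟨x, hx⟩ := (ae_all_iff.mpr this).exists
  obtain ⟨k, hk⟩ := exists_nat_gt (g x)
  linarith [hx k]

theorem essInf_le_real {ν : Measure (Rn n)} {g : Rn n → ℝ} (h0 : ∀ᵐ x ∂ν, 0 ≤ g x) :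
    ∀ᵐ x ∂ν, essInf g ν ≤ g x :=
  ae_essInf_le ⟨0, by simpa using h0⟩

theorem cube_neZero (c : Rn n) {h : ℝ} (hh : 0 < h) : NeZero (volume.restrict (cube c h)) :=
  ⟨by rw [Ne, Measure.restrict_eq_zero]; exact volume_cube_ne_zero c hh⟩

theorem exists_WData {ω : Rn n → ℝ} (hω : IsWeight ω) (hA : IsA1cube ω) :
    ∃ (w : Rn n → ℝ≥0∞) (a : Rn n → ℝ → ℝ≥0∞) (Cw : ℝ≥0∞), WData w a Cw ∧
      (∀ᵐ x, w x = ENNReal.ofReal (ω x)) ∧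
      ∀ c h, 0 < h → ENNReal.ofReal (wInt ω (cube c h)) = ∫⁻ x in cube c h, w x := by
  obtain ⟨h0, hloc, hpos⟩ := hω
  obtain ⟨C, hC, hA⟩ := hA
  have hm := hloc.aestronglyMeasurable
  set ω' := hm.mk ω with hω'
  have hω'm : Measurable ω' := hm.measurable_mk
  have hae : ω =ᵐ[volume] ω' := hm.ae_eq_mk
  set w : Rn n → ℝ≥0∞ := fun x => if 0 < ω' x then ENNReal.ofReal (ω' x) else 1 with hw
  have hwae : ∀ᵐ x, w x = ENNReal.ofReal (ω x) := by
    filter_upwards [hae, hpos] with x hx hp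
    have hp' : 0 < ω' x := hx ▸ hp
    simp only [hw, hx, hp', if_true]
  have hI : ∀ c h, ENNReal.ofReal (wInt ω (cube c h)) = ∫⁻ x in cube c h, w x := by
    intro c h
    unfold wInt
    rw [ofReal_integral_eq_lintegral_ofReal (integrableOn_cube hloc c h) (Filter.Eventually.of_forall h0)]
    refine lintegral_congr_ae (ae_restrict_of_ae ?_)
    filter_upwards [hwae] with x hx using hx.symm
  have hle : ∀ c h, ∀ᵐ x, x ∈ cube c h → essInf ω (volume.restrict (cube c h)) ≤ ω x := by
    intro c h
    rw [← ae_restrict_iff' (measurableSet_cube c h)]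
    exact essInf_le_real (Filter.Eventually.of_forall h0)
  have hIpos : ∀ c h, 0 < h → 0 < wInt ω (cube c h) := by
    intro c h hh
    unfold wInt
    rw [setIntegral_pos_iff_support_of_nonneg_ae (Filter.Eventually.of_forall h0) (integrableOn_cube hloc c h)]
    have : volume (Function.support ω ∩ cube c h) = volume (cube c h) := by
      apply measure_congr
      filter_upwards [hpos] with x hx
      apply propext
      exact ⟨fun h => h.2, fun h => ⟨hx.ne', h⟩⟩
    rw [this]
    exact volume_cube_pos c hh
  have hvr : ∀ (c : Rn n) h, 0 < h → 0 < (volume (cube c h)).toReal := fun c h hh =>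
    ENNReal.toReal_pos (volume_cube_ne_zero c hh) (volume_cube_ne_top c hh)
  have hepos : ∀ c h, 0 < h → 0 < essInf ω (volume.restrict (cube c h)) := by
    intro c h hh
    have h1 := hA c h hh
    have h2 : 0 < avg ω (cube c h) := mul_pos (inv_pos.mpr (hvr c h hh)) (hIpos c h hh)
    by_contra hcon
    nlinarith
  refine ⟨w, fun c h => ENNReal.ofReal (essInf ω (volume.restrict (cube c h))), ENNReal.ofReal (max C 1),
    ⟨?_, ?_, ?_, ?_, ?_, ?_, ?_, ?_, ?_, ?_⟩, hwae, fun c h _ => hI c h⟩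
  · exact Measurable.ite (measurableSet_lt measurable_const hω'm) hω'm.ennreal_ofReal measurable_const
  · intro x
    simp only [hw]
    split_ifs with h
    · simpa using h
    · exact one_pos
  · intro x
    simp only [hw]
    split_ifs with h <;> simp
  · intro c h hh
    filter_upwards [hle c h, hwae] with x hx hx2 hxc
    rw [hx2]
    exact ENNReal.ofReal_le_ofReal (hx hxc)
  · intro c h hh
    rw [← hI, ← ENNReal.ofReal_toReal (volume_cube_ne_top c hh), ← ENNReal.ofReal_mul (by positivity),
      ← ENNReal.ofReal_mul (by have := hepos c h hh; positivity)]
    apply ENNReal.ofReal_le_ofReal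
    have h1 := hA c h hh
    have h3 := hvr c h hh
    have h2 : wInt ω (cube c h) = avg ω (cube c h) * (volume (cube c h)).toReal := by
      unfold avg wInt; field_simp
    rw [h2]
    have := hepos c h hh
    gcongr
    refine h1.trans ?_
    gcongr
    exact le_max_left _ _
  · intro c h hh
    simpa using hepos c h hh
  · intro c h hh; finiteness
  · intro c h c' h' hh hh' hsub
    apply ENNReal.ofReal_le_ofReal
    have := cube_neZero c hh
    apply le_essInf_real
    rw [ae_restrict_iff' (measurableSet_cube c h)]
    filter_upwards [hle c' h'] with x hx hxc using hx (hsub hxc)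
  · finiteness
  · rw [← ENNReal.ofReal_one]
    exact ENNReal.ofReal_le_ofReal (le_max_right _ _)

theorem WData.int_ne {w : Rn n → ℝ≥0∞} {a : Rn n → ℝ → ℝ≥0∞} {Cw : ℝ≥0∞} (W : WData w a Cw)
    (c : Rn n) {h : ℝ} (hh : 0 < h) : (∫⁻ x in cube c h, w x ≠ 0) ∧ (∫⁻ x in cube c h, w x ≠ ⊤) := by
  constructor
  · rw [Ne, lintegral_eq_zero_iff W.meas]
    intro hz
    have := cube_neZero c hh
    obtain ⟨x, hx⟩ := hz.exists
    exact (W.pos x).ne' hx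
  · refine ne_top_of_le_ne_top ?_ (W.a1 c h hh)
    have := W.afin c h hh
    have := volume_cube_ne_top c hh
    have := W.cw
    finiteness

theorem hN_of {ω : Rn n → ℝ} (hω : IsWeight ω) {w : Rn n → ℝ≥0∞} {a : Rn n → ℝ → ℝ≥0∞} {Cw : ℝ≥0∞} (W : WData w a Cw)
    (hw : ∀ᵐ x, w x = ENNReal.ofReal (ω x))
    (hI : ∀ c h, 0 < h → ENNReal.ofReal (wInt ω (cube c h)) = ∫⁻ x in cube c h, w x)
    {p : ℝ} (hp : 1 < p) {f : Rn n → ℝ} (hf : LocallyIntegrable f volume) (c : Rn n) (h : ℝ) (hh : 0 < h) :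
    ∫⁻ x in cube c h, ‖f x - avg f (cube c h)‖ₑ ≤ bmoPNorm p ω f * ∫⁻ x in cube c h, w x := by
  set N := bmoPNorm p ω f with hN
  set M := avg f (cube c h) with hM
  set V := ∫⁻ x in cube c h, w x with hV
  obtain ⟨hV0, hVt⟩ := W.int_ne c hh
  have hp0 : 0 < p := by linarith
  set J := ∫⁻ x in cube c h, ‖f x - M‖ₑ ^ p * w x ^ (1 - p) with hJ
  have h1 : (V⁻¹ * J) ^ (1/p) ≤ N := by
    have e : (ENNReal.ofReal (wInt ω (cube c h)))⁻¹ * ∫⁻ x in cube c h, ENNReal.ofReal (|f x - M| ^ p * (ω x) ^ (1 - p))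
        = V⁻¹ * J := by
      rw [hI c h hh]
      congr 1
      refine lintegral_congr_ae (ae_restrict_of_ae ?_)
      filter_upwards [hw, hω.2.2] with x hx hx0
      rw [hx, Real.enorm_eq_ofReal_abs, ENNReal.ofReal_mul (by positivity),
        ENNReal.ofReal_rpow_of_nonneg (abs_nonneg _) hp0.le, ENNReal.ofReal_rpow_of_pos hx0]
    rw [← e, hN]
    unfold bmoPNorm
    exact le_iSup_of_le c (le_iSup_of_le h (le_iSup_of_le hh le_rfl))
  have h2 : J ≤ N ^ p * V := by
    have : V⁻¹ * J ≤ N ^ p := by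
      have := ENNReal.rpow_le_rpow h1 hp0.le
      rwa [← ENNReal.rpow_mul, one_div_mul_cancel hp0.ne', ENNReal.rpow_one] at this
    calc J = V * (V⁻¹ * J) := by rw [← mul_assoc, ENNReal.mul_inv_cancel hV0 hVt, one_mul]
      _ ≤ V * N ^ p := mul_le_mul_right this _
      _ = _ := mul_comm _ _
  have hpq := Real.HolderConjugate.conjExponent hp
  set q := p.conjExponent with hq
  have hq0 : 0 < q := hpq.symm.pos
  have hqe : q = p / (p - 1) := rfl
  have hp1 : p - 1 ≠ 0 := by linarith
  have hfm : AEMeasurable (fun x => ‖f x - M‖ₑ) (volume.restrict (cube c h)) :=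
    ((hf.aestronglyMeasurable.aemeasurable.sub_const M).enorm).restrict
  have hwm := W.meas
  have hol := ENNReal.lintegral_mul_le_Lp_mul_Lq (volume.restrict (cube c h)) hpq
    (f := fun x => ‖f x - M‖ₑ * w x ^ ((1 - p) / p)) (g := fun x => w x ^ ((p - 1) / p))
    (hfm.mul (by fun_prop)) (by fun_prop)
  have e1 : ∀ x, ((fun x => ‖f x - M‖ₑ * w x ^ ((1 - p) / p)) * (fun x => w x ^ ((p - 1) / p))) x = ‖f x - M‖ₑ := by
    intro x
    have : w x ^ ((1 - p) / p) * w x ^ ((p - 1) / p) = 1 := by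
      rw [← ENNReal.rpow_add _ _ (W.pos x).ne' (W.fin x).ne,
        show (1 - p) / p + (p - 1) / p = 0 by ring, ENNReal.rpow_zero]
    simp only [Pi.mul_apply, mul_assoc, this, mul_one]
  have e2 : ∀ x, (‖f x - M‖ₑ * w x ^ ((1 - p) / p)) ^ p = ‖f x - M‖ₑ ^ p * w x ^ (1 - p) := by
    intro x
    rw [ENNReal.mul_rpow_of_nonneg _ _ hp0.le, ← ENNReal.rpow_mul, div_mul_cancel₀ _ hp0.ne']
  have e3 : ∀ x, (w x ^ ((p - 1) / p)) ^ q = w x := by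
    intro x
    rw [← ENNReal.rpow_mul, hqe, show (p - 1) / p * (p / (p - 1)) = 1 by field_simp, ENNReal.rpow_one]
  rw [lintegral_congr e1, lintegral_congr e2, lintegral_congr e3] at hol
  refine hol.trans ?_
  calc J ^ (1/p) * V ^ (1/q) ≤ (N ^ p * V) ^ (1/p) * V ^ (1/q) := by gcongr
    _ = N * (V ^ (1/p) * V ^ (1/q)) := by
        rw [ENNReal.mul_rpow_of_nonneg _ _ (by positivity), ← ENNReal.rpow_mul, mul_one_div_cancel hp0.ne',
          ENNReal.rpow_one, mul_assoc]
    _ = N * V := by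
        rw [← ENNReal.rpow_add _ _ hV0 hVt, one_div, one_div, hpq.inv_add_inv_eq_one, ENNReal.rpow_one]

theorem core {ψ : Rn n → ℝ} {μ : Measure (Rn n)} [IsFiniteMeasure μ] {η C : ℝ} (H : KD ψ μ η C)
    {p : ℝ} (hp : 1 < p) {ω : Rn n → ℝ} (hω : IsWeight ω) (hA : IsA1cube ω) :
    ∃ K : ℝ≥0∞, K ≠ ⊤ ∧ ∀ f : Rn n → ℝ, Measurable f → LocallyIntegrable f volume → bmoPNorm p ω f < ⊤ →
      ∀ x₀, Tf ψ μ f x₀ < ⊤ → (∀ᵐ x, Tf ψ μ f x < ⊤) ∧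
        bloPNorm p ω (fun x => (Tf ψ μ f x).toReal) ≤ K * bmoPNorm p ω f := by
  obtain ⟨w, a, Cw, W, hw, hI⟩ := exists_WData hω hA
  have hp0 : 0 < p := by linarith
  have hCA := CA_ne_top (n := n) (μ := μ) (C := C) H.hη W.cw
  have hCJ : CJ Cw p ≠ ⊤ := jn_const W.cw p
  set K := CA n μ η C Cw * CJ Cw p ^ (1/p) + 1 with hK
  have hKt : K ≠ ⊤ := by
    have : CJ Cw p ^ (1/p) ≠ ⊤ := ENNReal.rpow_ne_top_of_nonneg (by positivity) hCJ
    finiteness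
  have hK0 : K ≠ 0 := by simp [hK]
  refine ⟨K, hKt, fun f hfm hf hfin x₀ hx₀ => ?_⟩
  set N := bmoPNorm p ω f with hN
  have hNle : ∀ N', N ≤ N' → ∀ c h, 0 < h →
      ∫⁻ x in cube c h, ‖f x - avg f (cube c h)‖ₑ ≤ N' * ∫⁻ x in cube c h, w x := fun N' hN' c h hh =>
    (hN_of hω W hw hI hp hf c h hh).trans (mul_le_mul_left hN' _)
  have hae : ∀ᵐ x, Tf ψ μ f x < ⊤ := ae_fin H W hfm hf (N := N + 1) (by simp) (by finiteness)
    (hNle _ le_self_add) hx₀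
  refine ⟨hae, ?_⟩
  set g : Rn n → ℝ := fun x => (Tf ψ μ f x).toReal with hg
  have main : ∀ N', N ≤ N' → N' ≠ 0 → N' ≠ ⊤ → bloPNorm p ω g ≤ K * N' := by
    intro N' h1 h2 h3
    unfold bloPNorm
    refine iSup_le fun c => iSup_le fun h => iSup_le fun hh => ?_
    obtain ⟨hV0, hVt⟩ := W.int_ne c hh
    have := cube_neZero c hh
    have hest := p_est H W hfm hf h2 h3 (hNle N' h1) p hp c h hh
    have hpt : ∫⁻ x in cube c h, ENNReal.ofReal ((g x - essInf g (volume.restrict (cube c h))) ^ p * (ω x) ^ (1 - p))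
        ≤ ∫⁻ x in cube c h, ((Tf ψ μ f x - cInf (Tf ψ μ f) c h) / w x) ^ p * w x := by
      set m := essInf g (volume.restrict (cube c h)) with hm
      have hmc : (cInf (Tf ψ μ f) c h).toReal ≤ m := by
        apply le_essInf_real
        rw [ae_restrict_iff' (measurableSet_cube c h)]
        filter_upwards [hae] with x hx hxc
        exact ENNReal.toReal_mono hx.ne (iInf₂_le x hxc)
      have hmg : ∀ᵐ x ∂(volume.restrict (cube c h)), m ≤ g x :=
        essInf_le_real (Filter.Eventually.of_forall fun x => ENNReal.toReal_nonneg)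
      refine lintegral_mono_ae ?_
      filter_upwards [hmg, ae_restrict_of_ae hae, ae_restrict_of_ae hw, ae_restrict_of_ae hω.2.2,
        ae_restrict_mem (measurableSet_cube c h)] with x hx1 hx2 hx3 hx4 hx5
      set b := cInf (Tf ψ μ f) c h with hb
      have hbT : b ≤ Tf ψ μ f x := iInf₂_le x hx5
      have e1 : Tf ψ μ f x - b = ENNReal.ofReal (g x - b.toReal) := by
        rw [ENNReal.ofReal_sub _ ENNReal.toReal_nonneg, hg, ENNReal.ofReal_toReal hx2.ne,
          ENNReal.ofReal_toReal (ne_top_of_le_ne_top hx2.ne hbT)]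
      have hge : 0 ≤ g x - b.toReal := by linarith
      rw [e1, hx3, ← ENNReal.ofReal_div_of_pos hx4, ENNReal.ofReal_rpow_of_nonneg (by positivity) hp0.le,
        ← ENNReal.ofReal_mul (by positivity)]
      apply ENNReal.ofReal_le_ofReal
      have e2 : ((g x - b.toReal) / ω x) ^ p * ω x = (g x - b.toReal) ^ p * ω x ^ (1 - p) := by
        rw [Real.div_rpow hge hx4.le, Real.rpow_sub hx4, Real.rpow_one]
        field_simp
      rw [e2]
      gcongr
    rw [hI c h hh]
    calc ((∫⁻ x in cube c h, w x)⁻¹ * ∫⁻ x in cube c h,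
          ENNReal.ofReal ((g x - essInf g (volume.restrict (cube c h))) ^ p * (ω x) ^ (1 - p))) ^ (1/p)
        ≤ ((∫⁻ x in cube c h, w x)⁻¹ * ((CA n μ η C Cw * N') ^ p * CJ Cw p * ∫⁻ x in cube c h, w x)) ^ (1/p) := by
          gcongr
          exact hpt.trans hest
      _ = ((CA n μ η C Cw * N') ^ p * CJ Cw p) ^ (1/p) := by
          congr 1
          rw [mul_comm, mul_assoc, ENNReal.mul_inv_cancel hV0 hVt, mul_one]
      _ = CA n μ η C Cw * CJ Cw p ^ (1/p) * N' := by
          rw [ENNReal.mul_rpow_of_nonneg _ _ (by positivity), ← ENNReal.rpow_mul, mul_one_div_cancel hp0.ne',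
            ENNReal.rpow_one]
          ring
      _ ≤ K * N' := by gcongr; exact le_self_add
  refine ENNReal.le_of_forall_pos_le_add fun ε hε _ => ?_
  have hεK : (ε : ℝ≥0∞) / K ≠ 0 := (ENNReal.div_pos (by exact_mod_cast hε.ne') hKt).ne'
  have hεt : (ε : ℝ≥0∞) / K ≠ ⊤ := ENNReal.div_ne_top (by finiteness) hK0
  refine (main (N + ε / K) le_self_add (by simp only [ne_eq, add_eq_zero, not_and]; exact fun _ => hεK)
    (by finiteness)).trans (le_of_eq ?_)
  rw [mul_add, ENNReal.mul_div_cancel hK0 hKt]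

theorem avg_congr {f g : Rn n → ℝ} (h : f =ᵐ[volume] g) (E : Set (Rn n)) : avg f E = avg g E := by
  unfold avg
  rw [integral_congr_ae (ae_restrict_of_ae h)]

theorem bmoP_congr {p : ℝ} {ω f g : Rn n → ℝ} (h : f =ᵐ[volume] g) : bmoPNorm p ω f = bmoPNorm p ω g := by
  unfold bmoPNorm
  refine iSup_congr fun c => iSup_congr fun r => iSup_congr fun hr => ?_
  congr 2
  rw [avg_congr h]
  refine lintegral_congr_ae (ae_restrict_of_ae ?_)
  filter_upwards [h] with x hx
  rw [hx]

end PartO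

theorem bmoP_bloP_of_G_and_S (n : ℕ) (hn : 1 ≤ n) (C₁ C₂ δ γ : ℝ)
    (hC₁ : 0 < C₁) (hC₂ : 0 < C₂) (hδ : 0 < δ) (hγ : 0 < γ)
    (ψ : Rn n → ℝ) (hψ : PsiKernel n C₁ C₂ δ γ ψ)
    (p : ℝ) (hp : 1 < p)
    (ω : Rn n → ℝ) (hω : IsWeight ω) (hA1 : IsA1cube ω) :
    ∃ C : ℝ, 0 < C ∧ ∀ f : Rn n → ℝ, LocallyIntegrable f volume →
      bmoPNorm p ω f < ⊤ →
        (∀ x₀ : Rn n, Gfun ψ f x₀ < ⊤ →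
          (∀ᵐ x ∂(volume : Measure (Rn n)), Gfun ψ f x < ⊤) ∧
          bloPNorm p ω (fun x => (Gfun ψ f x).toReal) ≤ ENNReal.ofReal C * bmoPNorm p ω f) ∧
        (∀ x₀ : Rn n, Sfun ψ f x₀ < ⊤ →
          (∀ᵐ x ∂(volume : Measure (Rn n)), Sfun ψ f x < ⊤) ∧
          bloPNorm p ω (fun x => (Sfun ψ f x).toReal) ≤ ENNReal.ofReal C * bmoPNorm p ω f) := by
  have P := PS_of hn hC₁ hC₂ hδ hγ hψ
  have : IsFiniteMeasure (volume.restrict (ball (0 : Rn n) 1)) :=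
    ⟨by rw [Measure.restrict_apply_univ]; exact measure_ball_lt_top⟩
  obtain ⟨D₁, H₁⟩ := KD_dirac P
  obtain ⟨D₂, H₂⟩ := KD_ball P
  obtain ⟨K₁, hK₁, R₁⟩ := core H₁ hp hω hA1
  obtain ⟨K₂, hK₂, R₂⟩ := core H₂ hp hω hA1
  have e : ENNReal.ofReal ((K₁ + K₂ + 1).toReal) = K₁ + K₂ + 1 := ENNReal.ofReal_toReal (by finiteness)
  refine ⟨(K₁ + K₂ + 1).toReal, ENNReal.toReal_pos (by simp) (by finiteness), fun f hf hb => ?_⟩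
  rw [e]
  have hm := hf.aestronglyMeasurable
  have hae : f =ᵐ[volume] hm.mk f := hm.ae_eq_mk
  have hfm : Measurable (hm.mk f) := hm.measurable_mk
  have hf' : LocallyIntegrable (hm.mk f) volume := by
    intro x
    obtain ⟨s, hs, hi⟩ := hf x
    exact ⟨s, hs, hi.congr_fun_ae (ae_restrict_of_ae hae)⟩
  rw [bmoP_congr hae] at hb ⊢
  rw [Gfun_congr hae, Sfun_congr hae, Gfun_eq P.meas hfm, Sfun_eq P.meas hfm]
  refine ⟨fun x₀ hx₀ => ?_, fun x₀ hx₀ => ?_⟩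
  · obtain ⟨h1, h2⟩ := R₁ _ hfm hf' hb x₀ hx₀
    refine ⟨h1, h2.trans (mul_le_mul_left ?_ _)⟩
    rw [add_assoc]; exact le_self_add
  · obtain ⟨h1, h2⟩ := R₂ _ hfm hf' hb x₀ hx₀
    refine ⟨h1, h2.trans (mul_le_mul_left ?_ _)⟩
    exact le_add_self.trans le_self_add

end LPW
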